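/- Let p be a prime and let n >= 2 be an integer. Then there is a constant Q such that for every q = p^h with q >= Q, the minimum distance of the dual code C_n(H(2n+1,q^2))^perp, i.e. the minimum of wt(c) over all nonzero code words c, equals 2*q^{2n-4}*(q^3 + 1). -/

import Mathlib

open scoped BigOperators

namespace HermCode

/-- The Hermitian sesquilinear form `h(x,y) = ∑ᵢ xᵢ * yᵢ^q` on `F^m`. -/
def herm (q : ℕ) {F : Type} [Field F] {m : ℕ} (x y : Fin m → F) : F :=
  ∑ i, x i * (y i) ^ q

/-- For a fixed vector `x`, the linear map `y ↦ h(y,x)`. -/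
def hermL (q : ℕ) {F : Type} [Field F] {m : ℕ} (x : Fin m → F) :
    (Fin m → F) →ₗ[F] F where
  toFun y := herm q y x
  map_add' a b := by
    simp [herm, add_mul, Finset.sum_add_distrib]
  map_smul' c a := by
    simp [herm, Finset.mul_sum, mul_assoc]

/-- The image `W^σ` of a subspace `W` under the Hermitian polarity `σ`:
the subspace of all vectors orthogonal to every vector of `W`
with respect to the Hermitian form. -/
def polar (q : ℕ) {F : Type} [Field F] {m : ℕ} (W : Submodule F (Fin m → F)) :
    Submodule F (Fin m → F) :=
  ⨅ x : W, LinearMap.ker (hermL q (x : Fin m → F))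

/-- A subspace all of whose points lie on the Hermitian variety. -/
def TotallyIsotropic (q : ℕ) {F : Type} [Field F] {m : ℕ}
    (W : Submodule F (Fin m → F)) : Prop :=
  ∀ x ∈ W, herm q x x = 0

/-- A point of the Hermitian variety: a projective point (1-dimensional subspace)
spanned by an isotropic vector. -/
def IsHermPoint (q : ℕ) {F : Type} [Field F] {m : ℕ}
    (P : Submodule F (Fin m → F)) : Prop :=
  Module.finrank F P = 1 ∧ TotallyIsotropic q P

/-- A generator of `H(2n+1,q²)`: an `n`-dimensional projective subspace all of
whose points lie on the Hermitian variety. -/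
def IsGenerator (q n : ℕ) {F : Type} [Field F]
    (W : Submodule F (Fin (2*n+2) → F)) : Prop :=
  Module.finrank F W = n + 1 ∧ TotallyIsotropic q W

/-- A code word of the dual code `C_n(H(2n+1,q²))^⊥`: a function from points to `F_p`
(vanishing off the Hermitian variety) summing to zero over every generator. -/
def IsCodeword (p q n : ℕ) {F : Type} [Field F]
    (c : Submodule F (Fin (2*n+2) → F) → ZMod p) : Prop :=
  (∀ P, ¬ IsHermPoint q P → c P = 0) ∧
  ∀ μ, IsGenerator q n μ → (∑ᶠ P ∈ {P | IsHermPoint q P ∧ P ≤ μ}, c P) = 0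

/-- The (Hamming) weight of a code word. -/
noncomputable def wt {p : ℕ} {α : Type*} (c : α → ZMod p) : ℕ :=
  Nat.card {x : α // c x ≠ 0}

open scoped Classical in
/-- The incidence vector `v_π` of `π ∩ H`. -/
noncomputable def vsub (p q : ℕ) {F : Type} [Field F] {m : ℕ}
    (π : Submodule F (Fin m → F)) : Submodule F (Fin m → F) → ZMod p :=
  fun P => if IsHermPoint q P ∧ P ≤ π then 1 else 0

/-- `θ_m(q)`, the number of points of `PG(m,q)`. -/
noncomputable def theta (q : ℕ) (m : ℤ) : ℚ :=
  ((q:ℚ)^(m+1) - 1) / ((q:ℚ) - 1)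

/-- `μ_m(q²)`, the number of points of `H(m,q²)` (with `μ_{-1} = 0`). -/
noncomputable def muH (q : ℕ) (m : ℤ) : ℚ :=
  (((q:ℚ)^(m+1) - (-1:ℚ)^(m+1)) * ((q:ℚ)^m - (-1:ℚ)^m)) / ((q:ℚ)^2 - 1)

/-- The number `N(n,i)`. -/
noncomputable def NN (q n : ℕ) (i : ℤ) : ℚ :=
  (q:ℚ)^(((n:ℤ)-1)^2 - ((((n:ℤ)-i-1).toNat.choose 2 : ℕ) : ℤ)) *
    ∏ j ∈ Finset.range ((n:ℤ)-i-2).toNat, ((q:ℚ)^(j+1) - (-1:ℚ)^(j+1))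

open scoped Classical in
/-- The quantity `Σ_{n,i}`. -/
noncomputable def SigmaNI (q n : ℕ) (i : ℤ) : ℚ :=
  if Odd ((n:ℤ) - i) then
    2*(q:ℚ)^(2*i+2) * muH q ((n:ℤ)-i-1)
      + 4 * muH q ((n:ℤ)-i-2) * ((q:ℚ)^((n:ℤ)-i-1) - 1)
          / ((q:ℚ)^((n:ℤ)-3*i-5) * ((q:ℚ)^2 - 1))
  else
    2*(q:ℚ)^(2*i+2) * (muH q ((n:ℤ)-i-1)
      + 2*((q:ℚ)^(4:ℤ) * muH q ((n:ℤ)-i-3) + (q:ℚ)^2 - 1)/((q:ℚ)^2 - 1))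

/-- `P` lies on a projective line entirely contained in the Hermitian variety that
meets both `π \ (π ⊓ π^σ)` and `π^σ \ (π ⊓ π^σ)`. -/
def OnGoodLine (q : ℕ) {F : Type} [Field F] {m : ℕ}
    (π P : Submodule F (Fin m → F)) : Prop :=
  ∃ A B : Submodule F (Fin m → F),
    Module.finrank F A = 1 ∧ A ≤ π ∧ ¬ A ≤ π ⊓ polar q π ∧
    Module.finrank F B = 1 ∧ B ≤ polar q π ∧ ¬ B ≤ π ⊓ polar q π ∧
    P ≤ A ⊔ B ∧ TotallyIsotropic q (A ⊔ B)

set_option linter.all false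

/-- Abstract nondegenerate Hermitian space over the field with `q²` elements. -/
structure HS (p q : ℕ) {F V : Type} [Field F] [Fintype F] [AddCommGroup V] [Module F V]
    (h : V →ₗ[F] V → F) : Prop where
  pp : p.Prime
  hq : ∃ k, q = p ^ k
  q2 : 2 ≤ q
  card : Fintype.card F = q ^ 2
  symm : ∀ x y, h y x = (h x y) ^ q
  nondeg : ∀ x, (∀ y, h x y = 0) → x = 0

section basics
variable {p q : ℕ} {F V : Type} [Field F] [Fintype F] [AddCommGroup V] [Module F V]
  {h : V →ₗ[F] V → F}

/-- orthogonal complement -/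
def perp (h : V →ₗ[F] V → F) (W : Submodule F V) : Submodule F V where
  carrier := {x | ∀ y ∈ W, h x y = 0}
  add_mem' := by
    intro a b ha hb y hy
    simp [ha y hy, hb y hy]
  zero_mem' := by
    intro y _
    simp
  smul_mem' := by
    intro c x hx y hy
    simp [hx y hy]

theorem mem_perp {W : Submodule F V} {x : V} : x ∈ perp h W ↔ ∀ y ∈ W, h x y = 0 := Iff.rfl

theorem HS.add_pow (H : HS p q h) (a b : F) : (a + b) ^ q = a ^ q + b ^ q := by
  obtain ⟨k, rfl⟩ := H.hq
  have hp := H.pp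
  have h0 : ((p : F)) = 0 := by
    have := FiniteField.cast_card_eq_zero F
    rw [H.card] at this
    push_cast at this
    rw [← pow_mul] at this
    exact pow_eq_zero_iff (by
      rintro h0
      have h2 := H.q2
      have : k = 0 := by omega
      subst this
      simp at h2) |>.1 this
  haveI : Fact p.Prime := ⟨hp⟩
  haveI : CharP F p := (CharP.charP_iff_prime_eq_zero hp).2 h0
  exact add_pow_char_pow a b p k

theorem HS.pow_pow (H : HS p q h) (a : F) : (a ^ q) ^ q = a := by
  rw [← pow_mul, ← sq, ← H.card, FiniteField.pow_card]

theorem HS.q0 (H : HS p q h) : q ≠ 0 := by have := H.q2; omega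

theorem HS.add_right (H : HS p q h) (x y z : V) : h x (y + z) = h x y + h x z := by
  rw [H.symm (y+z) x, map_add, Pi.add_apply, H.add_pow, ← H.symm, ← H.symm]

theorem HS.smul_right (H : HS p q h) (x y : V) (a : F) : h x (a • y) = a ^ q * h x y := by
  rw [H.symm (a • y) x, map_smul, Pi.smul_apply, smul_eq_mul, mul_pow, ← H.symm]

theorem HS.zero_right (H : HS p q h) (x : V) : h x 0 = 0 := by
  rw [H.symm 0 x]; simp [H.q0]

theorem HS.comm (H : HS p q h) {x y : V} (hxy : h x y = 0) : h y x = 0 := by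
  rw [H.symm x y, hxy, zero_pow H.q0]

theorem HS.comm_iff (H : HS p q h) {x y : V} : h x y = 0 ↔ h y x = 0 := ⟨H.comm, H.comm⟩

theorem HS.mem_perp' (H : HS p q h) {W : Submodule F V} {x : V} :
    x ∈ perp h W ↔ ∀ y ∈ W, h y x = 0 := by
  rw [mem_perp]; simp only [H.comm_iff (x := x)]

/-- the functional `x ↦ h x y` -/
def fun_of (h : V →ₗ[F] V → F) (y : V) : Module.Dual F V where
  toFun x := h x y
  map_add' a b := by simp
  map_smul' c a := by simp

theorem fun_of_apply (y x : V) : fun_of h y x = h x y := rfl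

theorem HS.mem_perp_span (H : HS p q h) {s : Set V} {x : V} :
    x ∈ perp h (Submodule.span F s) ↔ ∀ y ∈ s, h x y = 0 := by
  constructor
  · intro hx y hy
    exact hx y (Submodule.subset_span hy)
  · intro hx y hy
    induction hy using Submodule.span_induction with
    | mem y hy => exact hx y hy
    | zero => exact H.zero_right x
    | add a b _ _ ha hb => rw [H.add_right, ha, hb, add_zero]
    | smul a b _ hb => rw [H.smul_right, hb, mul_zero]

theorem HS.card_sub (H : HS p q h) [Finite V] (W : Submodule F V) :
    Nat.card W = q ^ (2 * Module.finrank F W) := by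
  rw [Module.natCard_eq_pow_finrank (K := F), Nat.card_eq_fintype_card, H.card, ← pow_mul]

theorem HS.q1 (H : HS p q h) : 1 < q := H.q2

theorem HS.finrank_perp (H : HS p q h) [Finite V] (W : Submodule F V) :
    Module.finrank F (perp h W) + Module.finrank F W = Module.finrank F V := by
  let Φ : Submodule F (Module.Dual F V) :=
    { carrier := {φ | ∃ y ∈ W, fun_of h y = φ}
      add_mem' := by
        rintro _ _ ⟨y, hy, rfl⟩ ⟨z, hz, rfl⟩
        refine ⟨y + z, W.add_mem hy hz, ?_⟩
        ext x
        simp [fun_of_apply, H.add_right]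
      zero_mem' := ⟨0, W.zero_mem, by ext x; simp [fun_of_apply, H.zero_right]⟩
      smul_mem' := by
        rintro c _ ⟨y, hy, rfl⟩
        refine ⟨c ^ q • y, W.smul_mem _ hy, ?_⟩
        ext x
        simp [fun_of_apply, H.smul_right, H.pow_pow] }
  have hperp : Φ.dualCoannihilator = perp h W := by
    ext x
    rw [Submodule.mem_dualCoannihilator, mem_perp]
    constructor
    · intro hx y hy
      exact hx _ ⟨y, hy, rfl⟩
    · rintro hx _ ⟨y, hy, rfl⟩
      exact hx y hy
  have hcard : Nat.card W = Nat.card Φ := by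
    refine Nat.card_congr (Equiv.ofBijective (fun y : W => (⟨fun_of h y.1, y.1, y.2, rfl⟩ : Φ)) ?_)
    constructor
    · intro y z hyz
      have h1 : fun_of h y.1 = fun_of h z.1 := congrArg Subtype.val hyz
      have : (y.1 - z.1) = 0 := by
        apply H.nondeg
        intro x
        apply H.comm
        have h2 := congrArg (fun φ => φ x) h1
        simp only [fun_of_apply] at h2
        have h3 := H.add_right x (y.1 - z.1) z.1
        rw [sub_add_cancel, h2] at h3
        exact left_eq_add.1 (by rw [add_comm]; exact h3)
      exact Subtype.ext (sub_eq_zero.1 this)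
    · rintro ⟨_, y, hy, rfl⟩
      exact ⟨⟨y, hy⟩, rfl⟩
  have hfr : Module.finrank F Φ = Module.finrank F W := by
    haveI : Finite Φ := Nat.finite_of_card_ne_zero (by rw [← hcard]; exact Nat.card_pos.ne')
    rw [Module.natCard_eq_pow_finrank (K := F) (V := W), Module.natCard_eq_pow_finrank (K := F) (V := Φ)] at hcard
    refine (Nat.pow_right_injective ?_ hcard).symm
    rw [Nat.card_eq_fintype_card]
    exact Fintype.one_lt_card
  have := Subspace.finrank_add_finrank_dualCoannihilator_eq Φ
  rw [hperp, hfr] at this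
  omega

theorem HS.le_perp_perp (H : HS p q h) (W : Submodule F V) : W ≤ perp h (perp h W) := by
  intro x hx y hy
  exact H.comm (hy x hx)

theorem HS.perp_perp (H : HS p q h) [Finite V] (W : Submodule F V) : perp h (perp h W) = W := by
  refine (Submodule.eq_of_le_of_finrank_eq (H.le_perp_perp W) ?_).symm
  have h1 := H.finrank_perp W
  have h2 := H.finrank_perp (perp h W)
  omega

theorem perp_anti {U W : Submodule F V} (hUW : U ≤ W) : perp h W ≤ perp h U :=
  fun _ hx y hy => hx y (hUW hy)

/-- totally isotropic subspaces -/
def TI (h : V →ₗ[F] V → F) (W : Submodule F V) : Prop := ∀ x ∈ W, h x x = 0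

theorem HS.TI_iff (H : HS p q h) {W : Submodule F V} : TI h W ↔ W ≤ perp h W := by
  classical
  constructor
  · intro hW x hx y hy
    by_contra hne
    have key : ∀ t : F, t + t ^ q = 0 := by
      intro t
      have hl : ∃ l : F, l ^ q * h x y = t := ⟨(t / h x y) ^ q, by rw [H.pow_pow]; field_simp⟩
      obtain ⟨l, hl⟩ := hl
      have h1 := hW (x + l • y) (W.add_mem hx (W.smul_mem l hy))
      simp only [map_add, map_smul, Pi.add_apply, Pi.smul_apply, H.add_right, H.smul_right,
        smul_eq_mul, hW x hx, hW y hy, hl] at h1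
      rw [H.symm x y] at h1
      have h2 : l * h x y ^ q = t ^ q := by rw [← hl, mul_pow, H.pow_pow]
      rw [h2] at h1
      rw [mul_zero, add_zero, hl] at h1
      rw [add_comm]
      simpa using h1
    let P : Polynomial F := Polynomial.X + Polynomial.X ^ q
    have hP : P.natDegree = q := by
      have := H.q2
      simp only [P]
      rw [Polynomial.natDegree_add_eq_right_of_natDegree_lt] <;> simp
      omega
    have hP0 : P ≠ 0 := by
      intro h0; rw [h0] at hP; simp at hP; exact H.q0 hP.symm
    have h1 : (Finset.univ : Finset F).card ≤ P.natDegree := by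
      refine Polynomial.card_le_degree_of_subset_roots (p := P) ?_
      intro t _
      simp only [P]
      rw [Polynomial.mem_roots hP0]
      simpa [P] using key t
    rw [hP, Finset.card_univ, H.card] at h1
    have := H.q2
    nlinarith
  · intro hW x hx
    exact hW hx x hx

/-- number of isotropic vectors in `W` -/
noncomputable def cI (h : V →ₗ[F] V → F) (W : Submodule F V) : ℕ :=
  Nat.card {x : V // x ∈ W ∧ h x x = 0}

end basics

set_option linter.all false

section counts
variable {p q : ℕ} {F V : Type} [Field F] [Fintype F] [AddCommGroup V] [Module F V]
  {h : V →ₗ[F] V → F}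

theorem HS.norm_card (H : HS p q h) {c : F} (hc : c ≠ 0) (hcq : c ^ q = c) :
    Nat.card {l : F // l ^ (q + 1) = c} = q + 1 := by
  classical
  have hq := H.q2
  have hcardU : Nat.card Fˣ = (q - 1) * (q + 1) := by
    rw [Nat.card_eq_fintype_card, Fintype.card_units, H.card]
    obtain ⟨m, rfl⟩ : ∃ m, q = m + 1 := ⟨q - 1, by omega⟩
    simp only [Nat.add_sub_cancel]
    rw [show (m+1)^2 = m * (m + 1 + 1) + 1 by ring]; rfl
  let φ : Fˣ →* Fˣ := powMonoidHom (q + 1)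
  have hker : Nat.card φ.ker = q + 1 := by
    rw [IsCyclic.card_powMonoidHom_ker, hcardU]; simp
  have hrange : Nat.card φ.range = q - 1 := by
    rw [IsCyclic.card_powMonoidHom_range, hcardU]; simp
  let ψ : Fˣ →* Fˣ := powMonoidHom (q - 1)
  have hker2 : Nat.card ψ.ker = q - 1 := by
    rw [IsCyclic.card_powMonoidHom_ker, hcardU]; simp
  have hle : φ.range ≤ ψ.ker := by
    rintro _ ⟨u, rfl⟩
    rw [MonoidHom.mem_ker]
    simp only [φ, ψ, powMonoidHom_apply]
    rw [← pow_mul, mul_comm, ← hcardU]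
    exact pow_card_eq_one'
  have heq : φ.range = ψ.ker := by
    apply Subgroup.eq_of_le_of_card_ge hle
    rw [hrange, hker2]
  have hcm : Units.mk0 c hc ∈ φ.range := by
    rw [heq, MonoidHom.mem_ker]
    ext
    simp only [ψ, powMonoidHom_apply, Units.val_pow_eq_pow_val, Units.val_mk0, Units.val_one]
    have : c ^ (q - 1) * c = 1 * c := by
      rw [← pow_succ, Nat.sub_add_cancel (by omega), hcq, one_mul]
    exact mul_right_cancel₀ hc this
  obtain ⟨u0, hu0⟩ := hcm
  have hu0' : (u0 : F) ^ (q + 1) = c := by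
    have := congrArg Units.val hu0
    simpa [φ] using this
  refine Eq.trans ?_ hker
  refine Nat.card_congr (Equiv.symm (Equiv.ofBijective
    (fun k : φ.ker => (⟨(k.1 : F) * u0, by
      have hk : (k.1) ^ (q + 1) = 1 := k.2
      rw [mul_pow, hu0', ← Units.val_pow_eq_pow_val, hk]; simp⟩ : {l : F // l ^ (q + 1) = c})) ?_))
  constructor
  · intro a b hab
    have h1 := congrArg Subtype.val hab
    simp only at h1
    exact Subtype.ext (Units.ext (mul_right_cancel₀ u0.ne_zero h1))
  · rintro ⟨l, hl⟩
    have hl0 : l ≠ 0 := by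
      rintro rfl
      rw [zero_pow (by omega)] at hl
      exact hc hl.symm
    refine ⟨⟨Units.mk0 l hl0 * u0⁻¹, ?_⟩, ?_⟩
    · rw [MonoidHom.mem_ker]
      ext
      simp [φ, mul_pow, hl, hu0', hc]
    · simp

/-- Recursion for isotropic vectors. -/
theorem HS.cI_rec (H : HS p q h) [Finite V] {W : Submodule F V} {w : V} (hw : w ∈ W)
    (hww : h w w ≠ 0) :
    let W' := W ⊓ perp h (Submodule.span F {w})
    Module.finrank F W = Module.finrank F W' + 1 ∧
    W' ⊓ perp h W' = W ⊓ perp h W ∧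
    (cI h W : ℤ) = cI h W' + (q + 1) * (Nat.card W' - cI h W') := by
  classical
  intro W'
  have hmem : ∀ x, x ∈ W' ↔ x ∈ W ∧ h x w = 0 := by
    intro x
    simp only [W', Submodule.mem_inf, H.mem_perp_span, Set.mem_singleton_iff, forall_eq]
  have hdec : ∀ x ∈ W, x - (h x w / h w w) • w ∈ W' := by
    intro x hx
    rw [hmem]
    refine ⟨W.sub_mem hx (W.smul_mem _ hw), ?_⟩
    simp [hww]
  have hw' : ∀ y ∈ W', h w y = 0 := fun y hy => H.comm ((hmem y).1 hy).2
  let e : W ≃ F × W' :=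
    { toFun := fun x => (h x.1 w / h w w, ⟨x.1 - (h x.1 w / h w w) • w, hdec x.1 x.2⟩)
      invFun := fun y => ⟨y.1 • w + y.2.1, W.add_mem (W.smul_mem _ hw) ((hmem _).1 y.2.2).1⟩
      left_inv := by
        intro x
        apply Subtype.ext
        simp
      right_inv := by
        rintro ⟨l, y, hy⟩
        have h0 := ((hmem y).1 hy).2
        ext
        · simp [h0, hww]
        · simp [h0, hww] }
  have hcard : Nat.card W = q ^ 2 * Nat.card W' := by
    rw [Nat.card_congr e, Nat.card_prod, Nat.card_eq_fintype_card, H.card]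
  have hfr : Module.finrank F W = Module.finrank F W' + 1 := by
    rw [H.card_sub, H.card_sub, ← pow_add] at hcard
    have := Nat.pow_right_injective H.q2 hcard
    omega
  refine ⟨hfr, ?_, ?_⟩
  · ext x
    simp only [Submodule.mem_inf]
    constructor
    · rintro ⟨hx, hx2⟩
      refine ⟨((hmem x).1 hx).1, ?_⟩
      intro y hy
      have h1 := hx2 _ (hdec y hy)
      have h2 := H.add_right x (y - (h y w / h w w) • w) ((h y w / h w w) • w)
      rw [sub_add_cancel, h1, H.smul_right, ((hmem x).1 hx).2] at h2
      simpa using h2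
    · rintro ⟨hx, hx2⟩
      exact ⟨(hmem x).2 ⟨hx, hx2 w hw⟩, fun y hy => hx2 y ((hmem y).1 hy).1⟩
  · have hval : ∀ (l : F) (y : V), y ∈ W' →
        h (l • w + y) (l • w + y) = l ^ (q + 1) * h w w + h y y := by
      intro l y hy
      simp only [map_add, map_smul, Pi.add_apply, Pi.smul_apply, H.add_right, H.smul_right,
        smul_eq_mul, hw' y hy, ((hmem y).1 hy).2]
      ring
    have haw : h w w ^ q = h w w := (H.symm w w).symm
    -- isotropic vectors of W as pairs
    have e1 : {x : V // x ∈ W ∧ h x x = 0} ≃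
        Σ y : W', {l : F // l ^ (q + 1) * h w w + h y.1 y.1 = 0} :=
      { toFun := fun x => ⟨(e ⟨x.1, x.2.1⟩).2, (e ⟨x.1, x.2.1⟩).1, by
          rw [← hval _ _ (e ⟨x.1, x.2.1⟩).2.2]
          have : (e ⟨x.1, x.2.1⟩).1 • w + (e ⟨x.1, x.2.1⟩).2.1 = x.1 := by
            simp [e]
          rw [this, x.2.2]⟩
        invFun := fun y => ⟨y.2.1 • w + y.1.1,
          W.add_mem (W.smul_mem _ hw) ((hmem _).1 y.1.2).1, by rw [hval _ _ y.1.2]; exact y.2.2⟩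
        left_inv := by
          intro x
          apply Subtype.ext
          simp [e]
        right_inv := by
          rintro ⟨⟨y, hy⟩, l, hl⟩
          have h0 := ((hmem y).1 hy).2
          have hE : e ⟨l • w + y, W.add_mem (W.smul_mem _ hw) ((hmem _).1 hy).1⟩ = (l, ⟨y, hy⟩) :=
            e.right_inv (l, ⟨y, hy⟩)
          have key : ∀ (a : F × W') (ha : a.1 ^ (q + 1) * h w w + h a.2.1 a.2.1 = 0),
              a = (l, ⟨y, hy⟩) →
              (⟨a.2, a.1, ha⟩ : Σ y : W', {l : F // l ^ (q + 1) * h w w + h y.1 y.1 = 0}) =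
              ⟨⟨y, hy⟩, l, hl⟩ := by
            rintro a ha rfl; rfl
          exact key _ _ hE }
    have hfib : ∀ y : W', Nat.card {l : F // l ^ (q + 1) * h w w + h y.1 y.1 = 0} =
        if h y.1 y.1 = 0 then 1 else q + 1 := by
      intro y
      split_ifs with hy
      · rw [Nat.card_eq_one_iff_unique]
        refine ⟨⟨fun a b => ?_⟩, ⟨⟨0, by simp [hy]⟩⟩⟩
        have : ∀ a : {l : F // l ^ (q + 1) * h w w + h y.1 y.1 = 0}, a.1 = 0 := by
          rintro ⟨l, hl⟩
          rw [hy, add_zero] at hl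
          exact pow_eq_zero_iff (by omega) |>.1 ((mul_eq_zero.1 hl).resolve_right hww)
        exact Subtype.ext ((this a).trans (this b).symm)
      · have hyq : h y.1 y.1 ^ q = h y.1 y.1 := (H.symm y.1 y.1).symm
        have hm1 : (-1 : F) ^ q = -1 := by
          have := H.add_pow (-1) 1
          rw [neg_add_cancel, zero_pow H.q0, one_pow] at this
          exact eq_neg_of_add_eq_zero_left this.symm
        refine Eq.trans ?_ (H.norm_card (c := -h y.1 y.1 / h w w) (div_ne_zero (neg_ne_zero.2 hy) hww) (by
          rw [div_pow, haw, neg_pow, hm1, hyq]; ring))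
        refine Nat.card_congr (Equiv.subtypeEquivRight fun l => ?_)
        rw [eq_div_iff hww, eq_neg_iff_add_eq_zero]
    have : Fintype W' := Fintype.ofFinite _
    have hsum : cI h W = ∑ y : W', if h y.1 y.1 = 0 then 1 else q + 1 := by
      unfold cI
      rw [Nat.card_congr e1, Nat.card_sigma]
      exact Finset.sum_congr rfl fun y _ => hfib y
    have hcI' : cI h W' = (Finset.univ.filter fun y : W' => h y.1 y.1 = 0).card := by
      unfold cI
      rw [← Fintype.card_subtype, ← Nat.card_eq_fintype_card]
      exact Nat.card_congr
        { toFun := fun x => ⟨⟨x.1, x.2.1⟩, x.2.2⟩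
          invFun := fun x => ⟨x.1.1, x.1.2, x.2⟩
          left_inv := fun _ => rfl
          right_inv := fun _ => rfl }
    have htot := Finset.card_filter_add_card_filter_not (s := (Finset.univ : Finset W'))
      (fun y : W' => h y.1 y.1 = 0)
    rw [Finset.card_univ, ← Nat.card_eq_fintype_card, ← hcI'] at htot
    rw [hsum, Finset.sum_ite, Finset.sum_const, Finset.sum_const, ← hcI']
    have h3 : ((Finset.univ.filter fun y : W' => ¬ h y.1 y.1 = 0).card : ℤ) =
      Nat.card W' - cI h W' := by
      rw [← htot]; push_cast; ring
    push_cast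
    rw [smul_eq_mul, smul_eq_mul]
    push_cast
    rw [h3]
    ring

theorem HS.cI_ti (H : HS p q h) {W : Submodule F V} (hW : TI h W) : cI h W = Nat.card W := by
  unfold cI
  refine Nat.card_congr (Equiv.subtypeEquivRight fun x => ?_)
  exact ⟨fun hx => hx.1, fun hx => ⟨hx, hW x hx⟩⟩

/-- Exact formula for the number of isotropic vectors. -/
theorem HS.cI_formula (H : HS p q h) [Finite V] (W : Submodule F V) :
    (q : ℤ) * cI h W = q ^ (2 * Module.finrank F W) +
      (-1) ^ (Module.finrank F W + Module.finrank F (W ⊓ perp h W : Submodule F V)) * (q - 1) *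
       q ^ (Module.finrank F W + Module.finrank F (W ⊓ perp h W : Submodule F V)) := by
  induction hk : Module.finrank F W generalizing W with
  | zero =>
    have hW : W = ⊥ := Submodule.finrank_eq_zero.1 hk
    have : TI h W := by rw [hW]; intro x hx; simp at hx; simp [hx]
    rw [H.cI_ti this, H.card_sub, hk]
    have hr : Module.finrank F (W ⊓ perp h W : Submodule F V) = 0 := by
      rw [hW]; simp
    rw [hr]; simp
  | succ k ih =>
    by_cases hW : TI h W
    · rw [H.cI_ti hW, H.card_sub, inf_eq_left.2 (H.TI_iff.1 hW), hk]
      rw [show k + 1 + (k + 1) = 2 * (k + 1) by ring]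
      push_cast
      rw [pow_mul (-1 : ℤ) 2]
      norm_num
      ring
    · unfold TI at hW
      push Not at hW
      obtain ⟨w, hw, hww⟩ := hW
      obtain ⟨h1, h2, h3⟩ := H.cI_rec hw hww
      have h4 := ih (W ⊓ perp h (Submodule.span F {w})) (by omega)
      rw [h2] at h4
      rw [h3, H.card_sub]
      have h5 : Module.finrank F (W ⊓ perp h (Submodule.span F {w}) : Submodule F V) = k := by omega
      rw [h5]
      push_cast
      set r := Module.finrank F (W ⊓ perp h W : Submodule F V)
      set c := (cI h (W ⊓ perp h (Submodule.span F {w})) : ℤ)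
      have e1 : (q : ℤ) * (c + (q + 1) * (q ^ (2 * k) - c)) =
        q * (q + 1) * q ^ (2 * k) - q * (q * c) := by ring
      rw [e1, h4]
      ring
end counts

set_option linter.all false

section counting
open scoped Classical
variable {p q : ℕ} {F V : Type} [Field F] [Fintype F] [AddCommGroup V] [Module F V]
  {h : V →ₗ[F] V → F}

instance finSub [Finite V] : Finite (Submodule F V) :=
  Finite.of_injective (fun W : Submodule F V => (W : Set V)) SetLike.coe_injective

/-- the finset of a set in a finite type -/
noncomputable def fs {α : Type*} [Finite α] (s : Set α) : Finset α := (Set.toFinite s).toFinset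

theorem mem_fs {α : Type*} [Finite α] {s : Set α} {x : α} : x ∈ fs s ↔ x ∈ s := by
  simp [fs]

theorem card_fs {α : Type*} [Finite α] (s : Set α) : (fs s).card = Nat.card s := by
  rw [fs, ← Set.ncard_eq_toFinset_card s]; rfl

theorem cI_eq [Finite V] (W : Submodule F V) : cI h W = (fs {x | x ∈ W ∧ h x x = 0}).card := by
  rw [card_fs]; rfl

theorem HS.card_fs_sub (H : HS p q h) [Finite V] (W : Submodule F V) :
    (fs (W : Set V)).card = q ^ (2 * Module.finrank F W) := by
  rw [card_fs, ← H.card_sub W]; rfl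

theorem finrank_sup_span [Finite V] {U : Submodule F V} {x : V} (hx : x ∉ U) :
    Module.finrank F (U ⊔ Submodule.span F {x} : Submodule F V) = Module.finrank F U + 1 := by
  have h1 := Submodule.finrank_sup_add_finrank_inf_eq U (Submodule.span F {x})
  have hx0 : x ≠ 0 := by rintro rfl; exact hx U.zero_mem
  have h2 : U ⊓ Submodule.span F {x} = ⊥ := by
    rw [eq_bot_iff]
    rintro y ⟨hy, hy'⟩
    obtain ⟨a, rfl⟩ := Submodule.mem_span_singleton.1 hy'
    by_cases ha : a = 0
    · simp [ha]
    · exact absurd ((U.smul_mem_iff ha).1 hy) hx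
  rw [h2, finrank_bot, finrank_span_singleton hx0] at h1
  omega

theorem HS.TI_sup (H : HS p q h) {U : Submodule F V} {x : V} (hU : TI h U) (hx : x ∈ perp h U)
    (hxx : h x x = 0) : TI h (U ⊔ Submodule.span F {x}) := by
  intro y hy
  obtain ⟨u, hu, v, hv, rfl⟩ := Submodule.mem_sup.1 hy
  obtain ⟨a, rfl⟩ := Submodule.mem_span_singleton.1 hv
  simp [H.add_right, H.smul_right, hU u hu, hxx, hx u hu, H.comm (hx u hu)]

/-- generators -/
def IsGen (h : V →ₗ[F] V → F) (n : ℕ) (μ : Submodule F V) : Prop :=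
  Module.finrank F μ = n + 1 ∧ TI h μ

/-- generators through `U` -/
noncomputable def gens [Finite V] (h : V →ₗ[F] V → F) (n : ℕ) (U : Submodule F V) :
    Finset (Submodule F V) := fs {μ | IsGen h n μ ∧ U ≤ μ}

/-- number of generators -/
def gg (q m : ℕ) : ℕ := ∏ i ∈ Finset.range m, (q ^ (2 * i + 1) + 1)

theorem gg_pos (q m : ℕ) : 0 < gg q m := Finset.prod_pos fun i _ => by positivity

theorem gg_succ (q m : ℕ) : gg q (m+1) = gg q m * (q ^ (2*m+1) + 1) := by
  simp [gg, Finset.prod_range_succ]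

theorem mem_gens [Finite V] {n : ℕ} {U μ : Submodule F V} :
    μ ∈ gens h n U ↔ IsGen h n μ ∧ U ≤ μ := by simp [gens, mem_fs]

theorem HS.gen_count (H : HS p q h) [Finite V] {n : ℕ} (hV : Module.finrank F V = 2*n+2) (m : ℕ) :
    ∀ U : Submodule F V, TI h U → Module.finrank F U + m = n + 1 →
      (gens h n U).card = gg q m := by
  induction m with
  | zero =>
    intro U hU hk
    have : gens h n U = {U} := by
      ext μ
      rw [mem_gens, Finset.mem_singleton]
      constructor
      · rintro ⟨⟨h1, h2⟩, h3⟩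
        exact (Submodule.eq_of_le_of_finrank_eq h3 (by omega)).symm
      · rintro rfl
        exact ⟨⟨by omega, hU⟩, le_rfl⟩
    rw [this]; simp [gg]
  | succ m ih =>
    intro U hU hk
    set j := Module.finrank F U with hj
    have hn : n = j + m := by omega
    let X : Finset V := fs {x | x ∈ perp h U ∧ h x x = 0 ∧ x ∉ U}
    have hUp := H.TI_iff.1 hU
    have hXc : X.card + q ^ (2*j) = cI h (perp h U) := by
      rw [cI_eq, hj, ← H.card_fs_sub U, ← Finset.card_union_of_disjoint]
      · congr 1
        ext x
        simp only [X, Finset.mem_union, mem_fs, Set.mem_setOf_eq, SetLike.mem_coe]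
        constructor
        · rintro (h1 | h1)
          · exact ⟨h1.1, h1.2.1⟩
          · exact ⟨hUp h1, hU x h1⟩
        · intro h1
          by_cases hx : x ∈ U
          · exact Or.inr hx
          · exact Or.inl ⟨h1.1, h1.2, hx⟩
      · rw [Finset.disjoint_left]
        intro x hx hx'
        simp only [X, mem_fs, Set.mem_setOf_eq, SetLike.mem_coe] at hx hx'
        exact hx.2.2 hx'
    have hdc := Finset.sum_card_bipartiteAbove_eq_sum_card_bipartiteBelow
      (s := gens h n U) (t := X) (fun μ x => x ∈ μ)
    have hL : ∀ μ ∈ gens h n U, (Finset.bipartiteAbove (fun (μ : Submodule F V) x => x ∈ μ) X μ).card + q^(2*j)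
        = q ^ (2*n+2) := by
      intro μ hμ
      obtain ⟨⟨h1, h2⟩, h3⟩ := mem_gens.1 hμ
      have h4 := H.card_fs_sub μ
      rw [h1] at h4
      rw [show 2*n+2 = 2*(n+1) by ring, ← h4, hj, ← H.card_fs_sub U, ← Finset.card_union_of_disjoint]
      · congr 1
        ext x
        simp only [X, Finset.bipartiteAbove, Finset.mem_filter, Finset.mem_union, mem_fs, Set.mem_setOf_eq, SetLike.mem_coe]
        constructor
        · rintro (h1 | h1)
          · exact h1.2
          · exact h3 h1
        · intro h1
          by_cases hx : x ∈ U
          · exact Or.inr hx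
          · exact Or.inl ⟨⟨perp_anti h3 (H.TI_iff.1 h2 h1), h2 x h1, hx⟩, h1⟩
      · rw [Finset.disjoint_left]
        intro x hx hx'
        simp only [X, Finset.bipartiteAbove, Finset.mem_filter, mem_fs, Set.mem_setOf_eq, SetLike.mem_coe] at hx hx'
        exact hx.1.2.2 hx'
    have hR : ∀ x ∈ X, (Finset.bipartiteBelow (fun (μ : Submodule F V) x => x ∈ μ) (gens h n U) x).card
        = gg q m := by
      intro x hx
      simp only [X, mem_fs, Set.mem_setOf_eq] at hx
      rw [← ih (U ⊔ Submodule.span F {x}) (H.TI_sup hU hx.1 hx.2.1)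
        (by rw [finrank_sup_span hx.2.2]; omega)]
      congr 1
      ext μ
      simp only [Finset.bipartiteBelow, Finset.mem_filter, mem_gens, sup_le_iff, Submodule.span_singleton_le_iff_mem]
      tauto
    rw [Finset.sum_congr rfl hR, Finset.sum_const, smul_eq_mul] at hdc
    have hL2 : ∑ μ ∈ gens h n U, ((Finset.bipartiteAbove (fun (μ : Submodule F V) x => x ∈ μ) X μ).card + q^(2*j))
       = (gens h n U).card * q ^ (2*n+2) := by
      rw [Finset.sum_congr rfl hL, Finset.sum_const, smul_eq_mul]
    rw [Finset.sum_add_distrib, hdc, Finset.sum_const, smul_eq_mul] at hL2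
    have hf := H.cI_formula (perp h U)
    have hfp := H.finrank_perp U
    rw [H.perp_perp, inf_eq_right.2 hUp, ← hj, ← hXc] at hf
    have hfr : Module.finrank F (perp h U) = j + 2*m+2 := by omega
    rw [hfr] at hf
    rw [show q^(2*n+2) = q^(2*(j+m)+2) by rw [hn]] at hL2
    zify at hL2 ⊢
    push_cast at hf
    have hsgn : (-1:ℤ)^(j+2*m+2+j) = 1 := by
      rw [show j+2*m+2+j = 2*(j+m+1) by ring, pow_mul]; simp
    rw [hsgn] at hf
    have hq : (2:ℤ) ≤ q := by exact_mod_cast H.q2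
    set G : ℤ := ((gens h n U).card : ℤ)
    rw [gg_succ]; push_cast
    set g : ℤ := ((gg q m : ℕ) : ℤ)
    set x : ℤ := (X.card : ℤ)
    set a : ℤ := (q:ℤ)^j with ha
    set c : ℤ := (q:ℤ)^(m+1) with hc
    have e1 : (q:ℤ)^(2*j) = a^2 := by rw [ha, ← pow_mul]; ring_nf
    have e2 : (q:ℤ)^(2*(j+m)+2) = a^2*c^2 := by rw [ha, hc, ← pow_mul, ← pow_mul, ← pow_add]; ring_nf
    have e3 : (q:ℤ)^(2*(j+2*m+2)) = a^2*c^4 := by rw [ha, hc, ← pow_mul, ← pow_mul, ← pow_add]; ring_nf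
    have e4 : (q:ℤ)^(j+2*m+2+j) = a^2*c^2 := by rw [ha, hc, ← pow_mul, ← pow_mul, ← pow_add]; ring_nf
    have e5 : (q:ℤ)*(q:ℤ)^(2*m+1) = c^2 := by rw [hc, ← pow_mul, ← pow_succ']; ring_nf
    rw [e1, e2] at hL2
    rw [e3, e4, e1] at hf
    have ha0 : 0 < a := by positivity
    have hc1 : 1 < c := by rw [hc]; exact one_lt_pow₀ (by omega) (by omega)
    have hne : (q:ℤ) * a^2*(c^2-1) ≠ 0 := by
      have : 0 < c^2-1 := by nlinarith
      positivity
    apply mul_left_cancel₀ hne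
    generalize (q:ℤ)^(2*m+1) = d at e5
    linear_combination (-(q:ℤ))*hL2 + g*hf - a^2*(c^2-1)*g*e5
end counting

set_option linter.all false

section codewords
open scoped Classical
variable {p q : ℕ} {F V : Type} [Field F] [Fintype F] [AddCommGroup V] [Module F V]
  {h : V →ₗ[F] V → F}

theorem HS.TI_span (H : HS p q h) {x : V} (hxx : h x x = 0) : TI h (Submodule.span F {x}) := by
  intro y hy
  obtain ⟨a, rfl⟩ := Submodule.mem_span_singleton.1 hy
  simp [H.smul_right, hxx]

/-- counting generators through `x` hitting `E` -/
theorem HS.hit (H : HS p q h) [Finite V] {n : ℕ} (hV : Module.finrank F V = 2*n+2) {m : ℕ}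
    (hn : n = m + 1) {x : V} (hx0 : x ≠ 0) (hxx : h x x = 0) (E : Finset V)
    (hE : ∀ e ∈ E, e ∉ Submodule.span F {x}) (G : Finset (Submodule F V))
    (hG : G ⊆ gens h n (Submodule.span F {x})) (L : ℝ)
    (hL : ∀ μ ∈ G, L ≤ ((E.filter (fun e => e ∈ μ)).card : ℝ)) :
    (G.card : ℝ) * L ≤ E.card * gg q m := by
  have hdc := Finset.sum_card_bipartiteAbove_eq_sum_card_bipartiteBelow
      (s := G) (t := E) (fun (μ : Submodule F V) x => x ∈ μ)
  have h1 : (G.card : ℝ) * L ≤ ((∑ a ∈ G, (Finset.bipartiteAbove (fun (μ : Submodule F V) x => x ∈ μ) E a).card : ℕ) : ℝ) := by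
    push_cast
    rw [← nsmul_eq_mul]
    apply Finset.card_nsmul_le_sum
    exact hL
  refine h1.trans ?_
  rw [hdc]
  norm_cast
  rw [← smul_eq_mul]
  apply Finset.sum_le_card_nsmul
  intro e he
  by_cases hp : e ∈ perp h (Submodule.span F {x}) ∧ h e e = 0
  · rw [← H.gen_count hV m (Submodule.span F {x} ⊔ Submodule.span F {e})
      (H.TI_sup (H.TI_span hxx) hp.1 hp.2) (by
        rw [finrank_sup_span (hE e he), finrank_span_singleton hx0]; omega)]
    apply Finset.card_le_card
    intro μ hμ
    simp only [Finset.bipartiteBelow, Finset.mem_filter] at hμ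
    have h2 := mem_gens.1 (hG hμ.1)
    rw [mem_gens]
    exact ⟨h2.1, sup_le h2.2 ((Submodule.span_singleton_le_iff_mem _ _).2 hμ.2)⟩
  · have : Finset.bipartiteBelow (fun (μ : Submodule F V) x => x ∈ μ) G e = ∅ := by
      rw [Finset.eq_empty_iff_forall_notMem]
      intro μ hμ
      simp only [Finset.bipartiteBelow, Finset.mem_filter] at hμ
      have h2 := mem_gens.1 (hG hμ.1)
      exact hp ⟨perp_anti h2.2 (H.TI_iff.1 h2.1.2 hμ.2), h2.1.2 e hμ.2⟩
    rw [this]; simp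

/-- existence of a generator through `x` avoiding several sets -/
theorem HS.exists_avoid (H : HS p q h) [Finite V] {n : ℕ} (hV : Module.finrank F V = 2*n+2) {m : ℕ}
    (hn : n = m + 1) {x : V} (hx0 : x ≠ 0) (hxx : h x x = 0) {ι : Type} [Fintype ι]
    (E : ι → Finset V) (L : ι → ℝ) (hL : ∀ i, 0 < L i)
    (hE : ∀ i, ∀ e ∈ E i, e ∉ Submodule.span F {x})
    (hEL : ∀ i, ∀ μ, IsGen h n μ → x ∈ μ → (∃ e ∈ E i, e ∈ μ) →
      L i ≤ (((E i).filter (fun e => e ∈ μ)).card : ℝ))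
    (hs : ∑ i, ((E i).card : ℝ) / L i < (q:ℝ)^(2*m+1) + 1) :
    ∃ μ, IsGen h n μ ∧ x ∈ μ ∧ ∀ i, ∀ e ∈ E i, e ∉ μ := by
  by_contra hcon
  push Not at hcon
  set G := gens h n (Submodule.span F {x}) with hG
  have hGc : G.card = gg q (m+1) := H.gen_count hV (m+1) _ (H.TI_span hxx) (by
    rw [finrank_span_singleton hx0]; omega)
  let B : ι → Finset (Submodule F V) := fun i => G.filter (fun μ => ∃ e ∈ E i, e ∈ μ)
  have hsub : G ⊆ Finset.univ.biUnion B := by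
    intro μ hμ
    have h1 := mem_gens.1 hμ
    obtain ⟨i, e, he, heμ⟩ := hcon μ h1.1 ((Submodule.span_singleton_le_iff_mem _ _).1 h1.2)
    simp only [Finset.mem_biUnion, Finset.mem_univ, true_and, B, Finset.mem_filter]
    exact ⟨i, hμ, e, he, heμ⟩
  have h1 : (G.card : ℝ) ≤ ∑ i, ((B i).card : ℝ) := by
    exact_mod_cast (Finset.card_le_card hsub).trans Finset.card_biUnion_le
  have h2 : ∀ i, ((B i).card : ℝ) ≤ ((E i).card : ℝ) / L i * gg q m := by
    intro i
    have := H.hit hV hn hx0 hxx (E i) (hE i) (B i) (Finset.filter_subset _ _) (L i) (by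
      intro μ hμ
      simp only [B, Finset.mem_filter] at hμ
      have h1 := mem_gens.1 hμ.1
      exact hEL i μ h1.1 ((Submodule.span_singleton_le_iff_mem _ _).1 h1.2) hμ.2)
    rw [div_mul_eq_mul_div, le_div_iff₀ (hL i)]
    exact this
  have h3 := h1.trans (Finset.sum_le_sum fun i _ => h2 i)
  rw [← Finset.sum_mul, hGc, gg_succ] at h3
  push_cast at h3
  have hg : (0:ℝ) < gg q m := by exact_mod_cast gg_pos q m
  nlinarith

/-- code words, on the level of vectors -/
structure CW [Finite V] (p : ℕ) (h : V →ₗ[F] V → F) (n : ℕ) (f : V → ZMod p) : Prop where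
  smul : ∀ (a : F) x, a ≠ 0 → f (a • x) = f x
  iso : ∀ x, f x ≠ 0 → h x x = 0
  zero : f 0 = 0
  sum : ∀ μ, IsGen h n μ → ∑ x ∈ fs (μ : Set V), f x = 0

/-- support -/
noncomputable def sp [Finite V] (f : V → ZMod p) : Finset V := fs {x | f x ≠ 0}

theorem mem_sp [Finite V] {f : V → ZMod p} {x : V} : x ∈ sp f ↔ f x ≠ 0 := by simp [sp, mem_fs]

theorem HS.cast_card (H : HS p q h) : ((q ^ 2 - 1 : ℕ) : ZMod p) = -1 := by
  obtain ⟨k, hk⟩ := H.hq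
  have hq := H.q2
  rw [Nat.cast_sub (by nlinarith)]
  have : (q : ZMod p) = 0 := by
    rw [hk]
    have hk0 : k ≠ 0 := by rintro rfl; simp at hk; omega
    simp [hk0]
  push_cast
  rw [this]; simp

/-- nonzero multiples -/
noncomputable def ml [Finite V] (F : Type) [Field F] [Module F V] (x : V) : Finset V :=
  fs {y | y ∈ Submodule.span F {x} ∧ y ≠ 0}

theorem mem_ml [Finite V] {x y : V} : y ∈ ml F x ↔ ∃ a : F, a ≠ 0 ∧ y = a • x ∧ x ≠ 0 := by
  simp only [ml, mem_fs, Set.mem_setOf_eq, Submodule.mem_span_singleton]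
  constructor
  · rintro ⟨⟨a, rfl⟩, hy⟩
    refine ⟨a, ?_, rfl, ?_⟩
    · rintro rfl; simp at hy
    · rintro rfl; simp at hy
  · rintro ⟨a, ha, rfl, hx⟩
    exact ⟨⟨a, rfl⟩, by simp [ha, hx]⟩

theorem HS.card_ml (H : HS p q h) [Finite V] {x : V} (hx : x ≠ 0) : (ml F x).card = q ^ 2 - 1 := by
  have h1 : ml F x = (fs (Submodule.span F {x} : Set V)).erase 0 := by
    ext y; simp [ml, mem_fs, and_comm]
  rw [h1, Finset.card_erase_of_mem (by simp [mem_fs]), H.card_fs_sub, finrank_span_singleton hx]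

theorem CW.sum_ml (H : HS p q h) [Finite V] {n : ℕ} {f : V → ZMod p} (hf : CW p h n f) {x : V}
    (hx : x ≠ 0) : ∑ y ∈ ml F x, f y = - f x := by
  have : ∀ y ∈ ml F x, f y = f x := by
    intro y hy
    obtain ⟨a, ha, rfl, _⟩ := mem_ml.1 hy
    exact hf.smul a x ha
  rw [Finset.sum_congr rfl this, Finset.sum_const, H.card_ml hx, nsmul_eq_mul, H.cast_card]
  ring

/-- a generator through a support vector contains another one outside any given ... -/
theorem CW.exists_other (H : HS p q h) [Finite V] {n : ℕ} {f : V → ZMod p} (hf : CW p h n f) {x : V}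
    (hx : f x ≠ 0) {μ : Submodule F V} (hμ : IsGen h n μ) (hxμ : x ∈ μ) :
    ∃ y ∈ μ, f y ≠ 0 ∧ y ∉ Submodule.span F {x} := by
  by_contra hcon
  push Not at hcon
  have hx0 : x ≠ 0 := by rintro rfl; exact hx hf.zero
  have h1 := hf.sum μ hμ
  have h2 : ∑ y ∈ ml F x, f y = ∑ y ∈ fs (μ : Set V), f y := by
    apply Finset.sum_subset
    · intro y hy
      obtain ⟨a, ha, rfl, _⟩ := mem_ml.1 hy
      simpa [mem_fs] using μ.smul_mem a hxμ
    · intro y hy hy'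
      by_contra hne
      have h3 := hcon y (by simpa [mem_fs] using hy) hne
      refine hy' ?_
      simp only [ml, mem_fs, Set.mem_setOf_eq]
      refine ⟨h3, ?_⟩
      rintro rfl; exact hne hf.zero
  rw [hf.sum_ml H hx0, h1, neg_eq_zero] at h2
  exact hx h2

/-- if a scalar-closed set avoiding `<x>` hits `μ` then it hits in at least `q²-1` vectors -/
theorem HS.hit_ml (H : HS p q h) [Finite V] {E : Finset V} (hE : ∀ (a : F) e, a ≠ 0 → e ∈ E → a • e ∈ E)
    (h0 : (0:V) ∉ E) {μ : Submodule F V} (hμ : ∃ e ∈ E, e ∈ μ) :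
    (q:ℝ)^2 - 1 ≤ ((E.filter (fun e => e ∈ μ)).card : ℝ) := by
  obtain ⟨e, he, heμ⟩ := hμ
  have he0 : e ≠ 0 := by rintro rfl; exact h0 he
  have h1 : ml F e ⊆ E.filter (fun e => e ∈ μ) := by
    intro y hy
    obtain ⟨a, ha, rfl, _⟩ := mem_ml.1 hy
    exact Finset.mem_filter.2 ⟨hE a e ha he, μ.smul_mem a heμ⟩
  have h2 := Finset.card_le_card h1
  rw [H.card_ml he0] at h2
  have hq := H.q2
  have h3 : ((q^2 - 1 : ℕ) : ℝ) ≤ ((E.filter (fun e => e ∈ μ)).card : ℝ) := by exact_mod_cast h2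
  rwa [Nat.cast_sub (by nlinarith), Nat.cast_pow, Nat.cast_one] at h3

theorem HS.qR (H : HS p q h) : (2:ℝ) ≤ q := by exact_mod_cast H.q2

/-- degree lemma -/
theorem CW.degree (H : HS p q h) [Finite V] {n m : ℕ} (hV : Module.finrank F V = 2*n+2) (hn : n = m+1)
    {f : V → ZMod p} (hf : CW p h n f) {x : V} (hx : f x ≠ 0) :
    ((q:ℝ)^2 - 1) * ((q:ℝ)^(2*m+1) + 1) ≤
      (((sp f).filter (fun y => h x y = 0 ∧ y ∉ Submodule.span F {x})).card : ℝ) := by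
  by_contra hlt
  push Not at hlt
  set E := (sp f).filter (fun y => h x y = 0 ∧ y ∉ Submodule.span F {x}) with hEdef
  have hx0 : x ≠ 0 := by rintro rfl; exact hx hf.zero
  have hq := H.qR
  have hpos : (0:ℝ) < (q:ℝ)^2 - 1 := by nlinarith
  obtain ⟨μ, hμ, hxμ, hav⟩ := H.exists_avoid hV hn hx0 (hf.iso x hx) (ι := Unit) (fun _ => E)
    (fun _ => (q:ℝ)^2-1) (fun _ => hpos)
    (fun _ e he => (Finset.mem_filter.1 he).2.2)
    (fun _ μ _ _ hh => H.hit_ml (by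
      intro a e ha he
      simp only [hEdef, Finset.mem_filter, mem_sp] at he ⊢
      refine ⟨by rw [hf.smul a e ha]; exact he.1, by rw [H.smul_right, he.2.1, mul_zero], ?_⟩
      rw [Submodule.smul_mem_iff _ ha]; exact he.2.2) (by simp [hEdef]) hh)
    (by simp; rw [div_lt_iff₀ hpos]; linarith)
  obtain ⟨y, hyμ, hfy, hys⟩ := hf.exists_other H hx hμ hxμ
  exact hav () y (by
    simp only [hEdef, Finset.mem_filter, mem_sp]
    exact ⟨hfy, H.TI_iff.1 hμ.2 hxμ y hyμ, hys⟩) hyμ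

/-- dimension lemma -/
theorem HS.dim_inf (H : HS p q h) [Finite V] {n : ℕ} (hV : Module.finrank F V = 2*n+2)
    {μ W : Submodule F V} (hμ : IsGen h n μ) (hW : Module.finrank F W = n+1) :
    Module.finrank F (μ ⊓ W : Submodule F V) = Module.finrank F (μ ⊓ perp h W : Submodule F V) := by
  have hμp : perp h μ = μ := by
    have h1 := H.TI_iff.1 hμ.2
    have h2 := H.finrank_perp μ
    have h3 := hμ.1
    exact (Submodule.eq_of_le_of_finrank_eq h1 (by omega)).symm
  have h1 : μ ⊓ perp h W = perp h (μ ⊔ W) := by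
    ext x
    constructor
    · rintro ⟨hx1, hx2⟩ y hy
      obtain ⟨u, hu, v, hv, rfl⟩ := Submodule.mem_sup.1 hy
      rw [H.add_right, hx2 v hv, (H.TI_iff.1 hμ.2 hx1) u hu, add_zero]
    · intro hx
      refine ⟨?_, perp_anti le_sup_right hx⟩
      rw [← hμp]; exact perp_anti le_sup_left hx
  have h2 := Submodule.finrank_sup_add_finrank_inf_eq μ W
  have h3 := H.finrank_perp (μ ⊔ W)
  rw [h1]
  have := hμ.1
  omega

/-- the standard code word -/
noncomputable def std (h : V →ₗ[F] V → F) (α : ZMod p) (W : Submodule F V) : V → ZMod p := fun x =>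
  if h x x = 0 then α * ((if x ∈ W then 1 else 0) - (if x ∈ perp h W then 1 else 0)) else 0

theorem HS.cast_q (H : HS p q h) {k : ℕ} (hk : k ≠ 0): ((q ^ k : ℕ) : ZMod p) = 0 := by
  obtain ⟨k, hk⟩ := H.hq
  have hq := H.q2
  have : (q : ZMod p) = 0 := by
    rw [hk]
    have hk0 : k ≠ 0 := by rintro rfl; simp at hk; omega
    simp [hk0]
  push_cast
  rw [this]; simp [*]

theorem HS.std_cw (H : HS p q h) [Finite V] {n : ℕ} (hV : Module.finrank F V = 2*n+2)
    (α : ZMod p) {W : Submodule F V} (hW : Module.finrank F W = n+1) : CW p h n (std h α W) where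
  smul a x ha := by
    unfold std
    have : h (a • x) (a • x) = 0 ↔ h x x = 0 := by
      simp [H.smul_right, ha]
    simp only [this, Submodule.smul_mem_iff _ ha]
  iso x hx := by
    by_contra hne
    exact hx (by simp [std, hne])
  zero := by simp [std]
  sum μ hμ := by
    have h1 : ∀ x ∈ fs (μ : Set V), std h α W x =
        α * ((if x ∈ W then 1 else 0) - (if x ∈ perp h W then 1 else 0)) := by
      intro x hx
      have : h x x = 0 := hμ.2 x (by simpa [mem_fs] using hx)
      simp [std, this]
    rw [Finset.sum_congr rfl h1, ← Finset.mul_sum, Finset.sum_sub_distrib]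
    have h2 : ∀ U : Submodule F V, ∑ x ∈ fs (μ : Set V), (if x ∈ U then (1:ZMod p) else 0) =
        ((q ^ (2 * Module.finrank F (μ ⊓ U : Submodule F V)) : ℕ) : ZMod p) := by
      intro U
      rw [← H.card_fs_sub, Finset.sum_ite, Finset.sum_const_zero, add_zero, Finset.sum_const, nsmul_one]
      congr 2
      ext x; simp [mem_fs]
    rw [h2, h2, H.dim_inf hV hμ hW, sub_self, mul_zero]

theorem CW.sub (H : HS p q h) [Finite V] {n : ℕ} {f g : V → ZMod p} (hf : CW p h n f) (hg : CW p h n g) :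
    CW p h n (fun x => f x - g x) where
  smul a x ha := by simp only [hf.smul a x ha, hg.smul a x ha]
  iso x hx := by
    by_contra hne
    have h1 : f x = 0 := by by_contra h; exact hne (hf.iso x h)
    have h2 : g x = 0 := by by_contra h; exact hne (hg.iso x h)
    simp [h1, h2] at hx
  zero := by simp [hf.zero, hg.zero]
  sum μ hμ := by rw [Finset.sum_sub_distrib, hf.sum μ hμ, hg.sum μ hμ, sub_self]

/-- real bounds for the number of isotropic vectors -/
theorem HS.cI_le (H : HS p q h) [Finite V] (W : Submodule F V) {m : ℕ} (hk : Module.finrank F W = m + 1)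
    (hr : Module.finrank F (W ⊓ perp h W : Submodule F V) ≤ m) :
    (cI h W : ℝ) ≤ (q:ℝ)^(2*m+1) + (q:ℝ)^(2*m) := by
  have hf := H.cI_formula W
  rw [hk] at hf
  set r := Module.finrank F (W ⊓ perp h W : Submodule F V)
  have hq := H.qR
  have hf' : (q:ℝ) * cI h W = (q:ℝ)^(2*(m+1)) + (-1)^(m+1+r) * (q-1) * (q:ℝ)^(m+1+r) := by
    exact_mod_cast hf
  have hb : (-1:ℝ)^(m+1+r) * (q-1) * (q:ℝ)^(m+1+r) ≤ (q-1) * (q:ℝ)^(2*m) := by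
    have h3 : (0:ℝ) < (q:ℝ)^(m+1+r) := by positivity
    have h4 : (0:ℝ) ≤ (q-1) * (q:ℝ)^(2*m) := mul_nonneg (by linarith) (by positivity)
    rcases Nat.lt_or_ge r m with hrm | hrm
    · have h1 : (-1:ℝ)^(m+1+r) ≤ 1 := by
        rcases neg_one_pow_eq_or ℝ (m+1+r) with h | h <;> rw [h]; norm_num
      have h2 : (q:ℝ)^(m+1+r) ≤ (q:ℝ)^(2*m) := pow_le_pow_right₀ (by linarith) (by omega)
      calc (-1:ℝ)^(m+1+r) * (q-1) * (q:ℝ)^(m+1+r) ≤ 1 * (q-1) * (q:ℝ)^(m+1+r) := by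
            gcongr; linarith
        _ ≤ _ := by rw [one_mul]; gcongr; linarith
    · have h1 : (-1:ℝ)^(m+1+r) = -1 := by
        apply Odd.neg_one_pow
        exact ⟨m, by omega⟩
      rw [h1]
      have : 0 ≤ ((q:ℝ)-1) * (q:ℝ)^(m+1+r) := mul_nonneg (by linarith) h3.le
      linarith
  have hq0 : (0:ℝ) < q := by linarith
  refine le_of_mul_le_mul_left ?_ hq0
  rw [hf']
  have e1 : (q:ℝ)^(2*(m+1)) = q^2 * q^(2*m) := by ring
  have e2 : (q:ℝ)^(2*m+1) = q * q^(2*m) := by ring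
  have : (0:ℝ) < (q:ℝ)^(2*m) := by positivity
  rw [e1, e2]
  nlinarith

/-- real bounds for the number of isotropic vectors -/
theorem HS.le_cI (H : HS p q h) [Finite V] (W : Submodule F V) {m : ℕ} (hk : Module.finrank F W = m + 1)
    (hr : Module.finrank F (W ⊓ perp h W : Submodule F V) + 1 ≤ m) :
    (q:ℝ)^(2*m+1) - (q:ℝ)^(2*m) ≤ (cI h W : ℝ) := by
  have hf := H.cI_formula W
  rw [hk] at hf
  set r := Module.finrank F (W ⊓ perp h W : Submodule F V)
  have hq := H.qR
  have hf' : (q:ℝ) * cI h W = (q:ℝ)^(2*(m+1)) + (-1)^(m+1+r) * (q-1) * (q:ℝ)^(m+1+r) := by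
    exact_mod_cast hf
  have hb : -((q-1) * (q:ℝ)^(2*m)) ≤ (-1:ℝ)^(m+1+r) * (q-1) * (q:ℝ)^(m+1+r) := by
    have h1 : -1 ≤ (-1:ℝ)^(m+1+r) := by
      rcases neg_one_pow_eq_or ℝ (m+1+r) with h | h <;> rw [h]; norm_num
    have h2 : (q:ℝ)^(m+1+r) ≤ (q:ℝ)^(2*m) := pow_le_pow_right₀ (by linarith) (by omega)
    have h3 : (0:ℝ) < (q:ℝ)^(m+1+r) := by positivity
    calc -((q-1) * (q:ℝ)^(2*m)) ≤ -((q-1) * (q:ℝ)^(m+1+r)) := by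
          apply neg_le_neg; gcongr; linarith
      _ = (-1) * (q-1) * (q:ℝ)^(m+1+r) := by ring
      _ ≤ _ := by gcongr; linarith
  have hq0 : (0:ℝ) < q := by linarith
  refine le_of_mul_le_mul_left ?_ hq0
  rw [hf']
  have e1 : (q:ℝ)^(2*(m+1)) = q^2 * q^(2*m) := by ring
  have e2 : (q:ℝ)^(2*m+1) = q * q^(2*m) := by ring
  have : (0:ℝ) < (q:ℝ)^(2*m) := by positivity
  rw [e1, e2]
  nlinarith

end codewords

set_option linter.all false

section stageTwo
open scoped Classical
variable {p q : ℕ} {F V : Type} [Field F] [Fintype F] [AddCommGroup V] [Module F V]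
  {h : V →ₗ[F] V → F}

theorem CW.eq_zero_of_small (H : HS p q h) [Finite V] {n m : ℕ} (hV : Module.finrank F V = 2*n+2)
    (hn : n = m+1) {f : V → ZMod p} (hf : CW p h n f)
    (hs : ((sp f).card : ℝ) < ((q:ℝ)^2 - 1) * ((q:ℝ)^(2*m+1) + 1)) : f = 0 := by
  funext x
  by_contra hx
  have h1 := hf.degree H hV hn hx
  have h2 : ((sp f).filter (fun y => h x y = 0 ∧ y ∉ Submodule.span F {x})).card ≤ (sp f).card :=
    Finset.card_filter_le _ _
  have h3 : (((sp f).filter (fun y => h x y = 0 ∧ y ∉ Submodule.span F {x})).card : ℝ) ≤ (sp f).card := by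
    exact_mod_cast h2
  linarith

/-- the part of the support outside `W` and its perp -/
noncomputable def EE [Finite V] (h : V →ₗ[F] V → F) (f : V → ZMod p) (W : Submodule F V) : Finset V :=
  (sp f).filter (fun x => x ∉ W ∧ x ∉ perp h W)

theorem mem_EE [Finite V] {f : V → ZMod p} {W : Submodule F V} {x : V} :
    x ∈ EE h f W ↔ f x ≠ 0 ∧ x ∉ W ∧ x ∉ perp h W := by
  simp [EE, mem_sp]

theorem powM (q : ℝ) (m : ℕ) : q^(2*(m+1)+1) = q^2 * q^(2*m+1) ∧ q^(2*(m+1)) = q * q^(2*m+1) ∧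
    q^(2*(m+1+1)) = q^3 * q^(2*m+1) := by
  refine ⟨by ring, by ring, by ring⟩

theorem CW.EE_smul (H : HS p q h) [Finite V] {n : ℕ} {f : V → ZMod p} (hf : CW p h n f)
    (W : Submodule F V) : ∀ (a : F) e, a ≠ 0 → e ∈ EE h f W → a • e ∈ EE h f W := by
  intro a e ha he
  rw [mem_EE] at he ⊢
  rw [hf.smul a e ha, Submodule.smul_mem_iff _ ha, Submodule.smul_mem_iff _ ha]
  exact he

theorem CW.stage2_key (H : HS p q h) [Finite V] {n m : ℕ} (hV : Module.finrank F V = 2*n+2)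
    (hn : n = m+1) {f : V → ZMod p} (hf : CW p h n f) (hq : (100:ℝ) ≤ q) {W : Submodule F V}
    (hW : Module.finrank F W = n+1) (hE : ((EE h f W).card : ℝ) ≤ (q:ℝ)^(2*n+1) / 20) {x : V}
    (hxW : x ∈ W) (hxP : x ∉ perp h W) (hxx : h x x = 0) :
    9/10 * (q:ℝ)^(2*n+1) ≤ ((fs {b | b ∈ perp h W ∧ b ∉ W ∧ h b b = 0 ∧ f b = - f x}).card : ℝ) := by
  by_contra hlt
  push Not at hlt
  set T := fs {b | b ∈ perp h W ∧ b ∉ W ∧ h b b = 0 ∧ f b = - f x} with hT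
  have hx0 : x ≠ 0 := by rintro rfl; exact hxP (Submodule.zero_mem _)
  set W' := W ⊓ perp h (Submodule.span F {x}) with hW'
  let D : Finset V := fs {y | y ∈ W' ∧ y ∉ Submodule.span F {x}}
  have hDc : (D.card : ℝ) ≤ (q:ℝ)^(2*n) := by
    have h1 : D.card ≤ q ^ (2*n) := by
      have hlt : W' < W := by
        refine lt_of_le_of_ne inf_le_left ?_
        intro heq
        apply hxP
        intro y hy
        have : y ∈ W' := by rw [heq]; exact hy
        exact H.comm (this.2 x (Submodule.mem_span_singleton_self x))
      have h2 := Submodule.finrank_lt_finrank_of_lt hlt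
      calc D.card ≤ (fs (W' : Set V)).card := Finset.card_le_card (by
            intro y hy
            simp only [D, mem_fs, Set.mem_setOf_eq, SetLike.mem_coe] at hy ⊢
            exact hy.1)
        _ = q ^ (2 * Module.finrank F W') := H.card_fs_sub _
        _ ≤ q ^ (2*n) := Nat.pow_le_pow_right (by have := H.q2; omega) (by omega)
    exact_mod_cast h1
  have hpos : (0:ℝ) < (q:ℝ)^2 - 1 := by nlinarith
  have hTs : ∀ (a : F) e, a ≠ 0 → e ∈ T → a • e ∈ T := by
    intro a e ha he
    simp only [hT, mem_fs, Set.mem_setOf_eq] at he ⊢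
    rw [Submodule.smul_mem_iff _ ha, Submodule.smul_mem_iff _ ha, hf.smul a e ha]
    refine ⟨he.1, he.2.1, ?_, he.2.2.2⟩
    simp [H.smul_right, he.2.2.1]
  have hDs : ∀ (a : F) e, a ≠ 0 → e ∈ D → a • e ∈ D := by
    intro a e ha he
    simp only [D, mem_fs, Set.mem_setOf_eq] at he ⊢
    rwa [Submodule.smul_mem_iff _ ha, Submodule.smul_mem_iff _ ha]
  have hspW : Submodule.span F {x} ≤ W := (Submodule.span_singleton_le_iff_mem _ _).2 hxW
  obtain ⟨μ, hμ, hxμ, hav⟩ := H.exists_avoid hV hn hx0 hxx (ι := Fin 3) ![EE h f W, D, T]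
    (fun _ => (q:ℝ)^2-1) (fun _ => hpos)
    (by
      intro i
      fin_cases i
      · intro e he hes
        exact (mem_EE.1 he).2.1 (hspW hes)
      · intro e he hes
        exact (mem_fs.1 he).2 hes
      · intro e he hes
        exact (mem_fs.1 he).2.1 (hspW hes))
    (by
      intro i μ _ _
      fin_cases i
      · exact H.hit_ml (hf.EE_smul H W) (by simp [mem_EE])
      · exact H.hit_ml hDs (by simp [D, mem_fs])
      · exact H.hit_ml hTs (by simp [hT, mem_fs]))
    (by
      simp [Fin.sum_univ_three]
      rw [← add_div, ← add_div, div_lt_iff₀ hpos]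
      obtain ⟨e1, e2, e3⟩ := powM q m
      subst hn
      rw [e1] at hE hlt
      rw [e2] at hDc
      have : (0:ℝ) < (q:ℝ)^(2*m+1) := by positivity
      have h5 : (q:ℝ) * q^(2*m+1) ≤ 1/100 * (q^2 * q^(2*m+1)) := by nlinarith
      have h6 : (q:ℝ)^(2*m+1) ≤ 1/100 * (q * q^(2*m+1)) := by nlinarith
      nlinarith)
  have hav0 := hav 0
  have hav1 := hav 1
  have hav2 := hav 2
  simp only [Matrix.cons_val_zero, Matrix.cons_val_one, Matrix.cons_val] at hav0 hav1 hav2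
  have hinf : μ ⊓ W = Submodule.span F {x} := by
    apply le_antisymm
    · rintro y ⟨hy1, hy2⟩
      by_contra hys
      refine hav1 y ?_ hy1
      simp only [D, mem_fs, Set.mem_setOf_eq]
      refine ⟨⟨hy2, ?_⟩, hys⟩
      exact perp_anti ((Submodule.span_singleton_le_iff_mem _ _).2 hxμ) (H.TI_iff.1 hμ.2 hy1)
    · exact le_inf ((Submodule.span_singleton_le_iff_mem _ _).2 hxμ) hspW
  have hdim := H.dim_inf hV hμ hW
  rw [hinf, finrank_span_singleton hx0] at hdim
  obtain ⟨b, hb0, hbs⟩ := finrank_eq_one_iff'.1 hdim.symm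
  have hbμ := b.2.1
  have hbP := b.2.2
  have hb0' : (b : V) ≠ 0 := by simpa using hb0
  have hbW : (b : V) ∉ W := by
    intro hbW
    have h1 : (b : V) ∈ Submodule.span F {x} := by rw [← hinf]; exact ⟨hbμ, hbW⟩
    obtain ⟨a, ha⟩ := Submodule.mem_span_singleton.1 h1
    have ha0 : a ≠ 0 := by rintro rfl; simp at ha; exact hb0' ha.symm
    apply hxP
    rw [← Submodule.smul_mem_iff _ ha0, ha]
    exact hbP
  have hsum := hf.sum μ hμ
  have hdisj : Disjoint (ml F x) (ml F (b : V)) := by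
    rw [Finset.disjoint_left]
    intro y hy hy'
    obtain ⟨a, ha, rfl, _⟩ := mem_ml.1 hy
    obtain ⟨c, hc, hac, _⟩ := mem_ml.1 hy'
    apply hbW
    rw [← Submodule.smul_mem_iff _ hc, ← hac]
    exact W.smul_mem a hxW
  have hsum2 : ∑ y ∈ ml F x ∪ ml F (b:V), f y = ∑ y ∈ fs (μ : Set V), f y := by
    apply Finset.sum_subset
    · intro y hy
      rw [Finset.mem_union] at hy
      simp only [mem_fs, SetLike.mem_coe]
      rcases hy with hy | hy
      · obtain ⟨a, ha, rfl, _⟩ := mem_ml.1 hy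
        exact μ.smul_mem a hxμ
      · obtain ⟨a, ha, rfl, _⟩ := mem_ml.1 hy
        exact μ.smul_mem a hbμ
    · intro y hy hy'
      simp only [mem_fs, SetLike.mem_coe] at hy
      by_contra hne
      have hy0 : y ≠ 0 := by rintro rfl; exact hne hf.zero
      apply hy'
      rw [Finset.mem_union]
      by_cases hyW : y ∈ W
      · left
        simp only [ml, mem_fs, Set.mem_setOf_eq]
        rw [← hinf]
        exact ⟨⟨hy, hyW⟩, hy0⟩
      · by_cases hyP : y ∈ perp h W
        · right
          simp only [ml, mem_fs, Set.mem_setOf_eq]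
          obtain ⟨c, hc⟩ := hbs ⟨y, hy, hyP⟩
          refine ⟨Submodule.mem_span_singleton.2 ⟨c, ?_⟩, hy0⟩
          simpa using congrArg Subtype.val hc
        · exact absurd hy (hav0 y (mem_EE.2 ⟨hne, hyW, hyP⟩))
  rw [Finset.sum_union hdisj, hf.sum_ml H hx0, hf.sum_ml H hb0', hsum] at hsum2
  refine hav2 b ?_ hbμ
  simp only [hT, mem_fs, Set.mem_setOf_eq]
  refine ⟨hbP, hbW, hμ.2 _ hbμ, ?_⟩
  linear_combination -hsum2

theorem CW.stage2_const (H : HS p q h) [Finite V] {n m : ℕ} (hV : Module.finrank F V = 2*n+2)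
    (hn : n = m+1) {f : V → ZMod p} (hf : CW p h n f) (hq : (100:ℝ) ≤ q) {W : Submodule F V}
    (hW : Module.finrank F W = n+1) (hE : ((EE h f W).card : ℝ) ≤ (q:ℝ)^(2*n+1) / 20)
    (hne : W ≠ perp h W) {x y : V}
    (hxW : x ∈ W) (hxP : x ∉ perp h W) (hxx : h x x = 0)
    (hyW : y ∈ W) (hyP : y ∉ perp h W) (hyy : h y y = 0) : f x = f y := by
  by_contra hxy
  have h1 := hf.stage2_key H hV hn hq hW hE hxW hxP hxx
  have h2 := hf.stage2_key H hV hn hq hW hE hyW hyP hyy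
  have hfp := H.finrank_perp W
  have hr : Module.finrank F (perp h W ⊓ perp h (perp h W) : Submodule F V) ≤ n := by
    rw [H.perp_perp]
    by_contra hlt
    push Not at hlt
    apply hne
    have h3 : perp h W ⊓ W = W := Submodule.eq_of_le_of_finrank_le inf_le_right (by omega)
    have h4 : perp h W ⊓ W = perp h W := Submodule.eq_of_le_of_finrank_le inf_le_left (by omega)
    rw [← h4, h3]
  have h3 := H.cI_le (perp h W) (m := n) (by omega) hr
  have h4 : (fs {b | b ∈ perp h W ∧ b ∉ W ∧ h b b = 0 ∧ f b = - f x}).card +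
    (fs {b | b ∈ perp h W ∧ b ∉ W ∧ h b b = 0 ∧ f b = - f y}).card ≤ cI h (perp h W) := by
    rw [cI_eq, ← Finset.card_union_of_disjoint]
    · apply Finset.card_le_card
      intro b hb
      simp only [Finset.mem_union, mem_fs, Set.mem_setOf_eq] at hb ⊢
      tauto
    · rw [Finset.disjoint_left]
      intro b hb hb'
      simp only [mem_fs, Set.mem_setOf_eq] at hb hb'
      apply hxy
      have := hb.2.2.2.symm.trans hb'.2.2.2
      exact neg_injective this
  have h5 : ((fs {b | b ∈ perp h W ∧ b ∉ W ∧ h b b = 0 ∧ f b = - f x}).card : ℝ) +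
    (fs {b | b ∈ perp h W ∧ b ∉ W ∧ h b b = 0 ∧ f b = - f y}).card ≤ cI h (perp h W) := by
    exact_mod_cast h4
  have e : (q:ℝ)^(2*n+1) = q * q^(2*n) := by ring
  have h0 : (0:ℝ) < (q:ℝ)^(2*n) := by positivity
  rw [e] at h1 h2 h3
  nlinarith

theorem EE_perp (H : HS p q h) [Finite V] {f : V → ZMod p} {W : Submodule F V} :
    EE h f (perp h W) = EE h f W := by
  ext x; rw [mem_EE, mem_EE, H.perp_perp]; tauto

theorem CW.stage2b (H : HS p q h) [Finite V] {n m : ℕ} (hV : Module.finrank F V = 2*n+2)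
    (hn : n = m+1) {f : V → ZMod p} (hf : CW p h n f) (hq : (100:ℝ) ≤ q) {W : Submodule F V}
    (hW : Module.finrank F W = n+1) (hE : ((EE h f W).card : ℝ) ≤ (q:ℝ)^(2*n+1) / 20) :
    ∃ α, f = std h α W := by
  obtain ⟨e1, e2, e3⟩ := powM q m
  have hQ0 : (0:ℝ) < (q:ℝ)^(2*m+1) := by positivity
  have hpos : (0:ℝ) < (q:ℝ)^2 - 1 := by nlinarith
  have hfp := H.finrank_perp W
  by_cases hWP : W = perp h W
  · refine ⟨0, ?_⟩
    have hz : ∀ x ∈ W, f x = 0 := by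
      intro x hx
      by_contra hfx
      have hx0 : x ≠ 0 := by rintro rfl; exact hfx hf.zero
      have hspW : Submodule.span F {x} ≤ W := (Submodule.span_singleton_le_iff_mem _ _).2 hx
      let D : Finset V := fs {y | y ∈ W ∧ y ∉ Submodule.span F {x}}
      have hDc : (D.card : ℝ) ≤ (q:ℝ)^(2*(n+1)) := by
        have : D.card ≤ q^(2*(n+1)) := by
          rw [← hW, ← H.card_fs_sub]
          apply Finset.card_le_card
          intro y hy
          simp only [D, mem_fs, Set.mem_setOf_eq, SetLike.mem_coe] at hy ⊢
          exact hy.1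
        exact_mod_cast this
      have hpos2 : (0:ℝ) < (q:ℝ)^4 - q^2 := by nlinarith
      obtain ⟨μ, hμ, hxμ, hav⟩ := H.exists_avoid hV hn hx0 (hf.iso x hfx) (ι := Fin 2) ![EE h f W, D]
        ![(q:ℝ)^2-1, (q:ℝ)^4-q^2] (by intro i; fin_cases i; exacts [hpos, hpos2])
        (by
          intro i
          fin_cases i
          · intro e he hes
            exact (mem_EE.1 he).2.1 (hspW hes)
          · intro e he hes
            exact (mem_fs.1 he).2 hes)
        (by
          intro i μ hμ hxμ
          fin_cases i
          · exact H.hit_ml (hf.EE_smul H W) (by simp [mem_EE])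
          · rintro ⟨e, he, heμ⟩
            replace he := mem_fs.1 he
            have hspμ : Submodule.span F {x} ≤ μ := (Submodule.span_singleton_le_iff_mem _ _).2 hxμ
            have hsub : fs ((Submodule.span F {x} ⊔ Submodule.span F {e} : Submodule F V) : Set V) \
              fs ((Submodule.span F {x} : Submodule F V) : Set V) ⊆ D.filter (fun e => e ∈ μ) := by
              intro y hy
              simp only [Finset.mem_sdiff, mem_fs, SetLike.mem_coe] at hy
              simp only [Finset.mem_filter, D, mem_fs, Set.mem_setOf_eq]
              refine ⟨⟨?_, hy.2⟩, ?_⟩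
              · exact (sup_le hspW ((Submodule.span_singleton_le_iff_mem _ _).2 he.1)) hy.1
              · exact (sup_le hspμ ((Submodule.span_singleton_le_iff_mem _ _).2 heμ)) hy.1
            have hc := Finset.card_le_card hsub
            rw [Finset.card_sdiff_of_subset (by
              intro y hy
              simp only [mem_fs, SetLike.mem_coe] at hy ⊢
              exact Submodule.mem_sup_left hy), H.card_fs_sub, H.card_fs_sub, finrank_sup_span he.2,
              finrank_span_singleton hx0] at hc
            have h9 : q^(2*(1+1)) ≤ (D.filter (fun e => e ∈ μ)).card + q^(2*1) := by omega
            have h10 : ((q:ℝ)^(2*(1+1))) ≤ (D.filter (fun e => e ∈ μ)).card + (q:ℝ)^(2*1) := by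
              exact_mod_cast h9
            norm_num at h10
            simp
            linarith)
        (by
          simp [Fin.sum_univ_two]
          subst hn
          rw [e1] at hE
          rw [e3] at hDc
          have h1 : ((EE h f W).card : ℝ) / ((q:ℝ)^2-1) ≤ 1/10 * q^(2*m+1) := by
            rw [div_le_iff₀ hpos]
            nlinarith
          have h2 : (D.card : ℝ) / ((q:ℝ)^4-q^2) ≤ 1/10 * q^(2*m+1) := by
            rw [div_le_iff₀ hpos2]
            have : (q:ℝ)^3 ≤ 1/10 * (q^4 - q^2) := by nlinarith [sq_nonneg (q:ℝ), mul_self_nonneg ((q:ℝ)^2 - 20*q)]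
            nlinarith
          linarith)
      obtain ⟨y, hyμ, hfy, hys⟩ := hf.exists_other H hfx hμ hxμ
      by_cases hyW : y ∈ W
      · exact hav 1 y (by simp only [Matrix.cons_val_one, Matrix.cons_val, D, mem_fs]; exact ⟨hyW, hys⟩) hyμ
      · exact hav 0 y (by simp only [Matrix.cons_val_zero]; exact mem_EE.2 ⟨hfy, hyW, hWP ▸ hyW⟩) hyμ
    have : f = 0 := by
      apply hf.eq_zero_of_small H hV hn
      have h1 : sp f ⊆ EE h f W := by
        intro x hx
        have hx' := mem_sp.1 hx
        rw [mem_EE]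
        have : x ∉ W := fun h' => hx' (hz x h')
        exact ⟨hx', this, hWP ▸ this⟩
      have h2 : ((sp f).card : ℝ) ≤ (EE h f W).card := by exact_mod_cast Finset.card_le_card h1
      subst hn
      rw [e1] at hE
      have hq2 : (100:ℝ) ≤ (q:ℝ)^2 := by nlinarith
      have h5 : (1:ℝ) * q^(2*m+1) ≤ 1/100 * (q^2 * q^(2*m+1)) := by nlinarith
      nlinarith
    rw [this]; funext x; simp [std]
  · have hWP' : perp h W ≠ perp h (perp h W) := by rw [H.perp_perp]; exact Ne.symm hWP
    have hW2 : Module.finrank F (perp h W) = n+1 := by omega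
    have hE2 : ((EE h f (perp h W)).card : ℝ) ≤ (q:ℝ)^(2*n+1) / 20 := by rwa [EE_perp H]
    have hM0 : (0:ℝ) < 9/10 * (q:ℝ)^(2*n+1) := by positivity
    have hα : ∃ α, (∀ x ∈ W, x ∉ perp h W → h x x = 0 → f x = α) ∧
        (∀ x ∈ perp h W, x ∉ W → h x x = 0 → f x = -α) := by
      have hne : ∀ {U : Submodule F V} {x : V}, Module.finrank F U = n+1 → ((EE h f U).card : ℝ) ≤ (q:ℝ)^(2*n+1) / 20 →
          x ∈ U → x ∉ perp h U → h x x = 0 → ∃ b ∈ perp h U, b ∉ U ∧ h b b = 0 ∧ f b = - f x := by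
        intro U x h1 h2 h3 h4 h5
        have h6 := hf.stage2_key H hV hn hq h1 h2 h3 h4 h5
        have h7 : (0:ℝ) < ((fs {b | b ∈ perp h U ∧ b ∉ U ∧ h b b = 0 ∧ f b = - f x}).card : ℝ) := by linarith
        obtain ⟨b, hb⟩ := Finset.card_pos.1 (by exact_mod_cast h7)
        have hb' := mem_fs.1 hb
        exact ⟨b, hb'⟩
      by_cases hex : ∃ x ∈ W, x ∉ perp h W ∧ h x x = 0
      · obtain ⟨x, hx1, hx2, hx3⟩ := hex
        refine ⟨f x, fun y hy1 hy2 hy3 => hf.stage2_const H hV hn hq hW hE hWP hy1 hy2 hy3 hx1 hx2 hx3, ?_⟩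
        intro y hy1 hy2 hy3
        obtain ⟨b, hb1, hb2, hb3, hb4⟩ := hne hW hE hx1 hx2 hx3
        rw [← hb4]
        exact hf.stage2_const H hV hn hq hW2 hE2 hWP' hy1 (by rwa [H.perp_perp]) hy3 hb1
          (by rwa [H.perp_perp]) hb3
      · refine ⟨0, fun x h1 h2 h3 => absurd ⟨x, h1, h2, h3⟩ hex, ?_⟩
        intro y hy1 hy2 hy3
        obtain ⟨b, hb1, hb2, hb3, hb4⟩ := hne hW2 hE2 hy1 (by rwa [H.perp_perp]) hy3
        rw [H.perp_perp] at hb1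
        exact absurd ⟨b, hb1, hb2, hb3⟩ hex
    obtain ⟨α, hα1, hα2⟩ := hα
    refine ⟨α, ?_⟩
    have hcw := hf.sub H (H.std_cw hV α hW)
    have hz : (fun x => f x - std h α W x) = 0 := by
      apply hcw.eq_zero_of_small H hV hn
      have h1 : sp (fun x => f x - std h α W x) ⊆ EE h f W ∪ fs ((W ⊓ perp h W : Submodule F V) : Set V) := by
        intro x hx
        have hx' := mem_sp.1 hx
        rw [Finset.mem_union, mem_EE, mem_fs]
        by_contra hcon
        push Not at hcon
        obtain ⟨hc1, hc2⟩ := hcon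
        have hc2' : ¬ (x ∈ W ∧ x ∈ perp h W) := hc2
        apply hx'
        by_cases hxx : h x x = 0
        · by_cases hxW : x ∈ W
          · have hxP : x ∉ perp h W := fun hh => hc2' ⟨hxW, hh⟩
            simp [std, hxx, hxW, hxP, hα1 x hxW hxP hxx]
          · by_cases hxP : x ∈ perp h W
            · simp [std, hxx, hxW, hxP, hα2 x hxP hxW hxx]
            · simp only [std, hxx, hxW, hxP, if_true, if_false, sub_self, mul_zero, sub_zero]
              by_contra hfx
              exact hxP (hc1 hfx hxW)
        · have : f x = 0 := by by_contra hfx; exact hxx (hf.iso x hfx)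
          simp [std, hxx, this]
      have h2 := (Finset.card_le_card h1).trans (Finset.card_union_le _ _)
      rw [H.card_fs_sub] at h2
      have hr : Module.finrank F (W ⊓ perp h W : Submodule F V) ≤ n := by
        by_contra hlt
        push Not at hlt
        apply hWP
        have h3 : W ⊓ perp h W = W := Submodule.eq_of_le_of_finrank_le inf_le_left (by omega)
        have h4 : W ⊓ perp h W = perp h W := Submodule.eq_of_le_of_finrank_le inf_le_right (by omega)
        rw [← h4, h3]
      have h3 : q ^ (2 * Module.finrank F (W ⊓ perp h W : Submodule F V)) ≤ q^(2*n) :=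
        Nat.pow_le_pow_right (by have := H.q2; omega) (by omega)
      have h4 : ((sp (fun x => f x - std h α W x)).card : ℝ) ≤ (EE h f W).card + (q:ℝ)^(2*n) := by
        exact_mod_cast h2.trans (Nat.add_le_add_left h3 _)
      subst hn
      rw [e1] at hE
      rw [e2] at h4
      have h5 : (q:ℝ) * q^(2*m+1) ≤ 1/100 * (q^2 * q^(2*m+1)) := by nlinarith
      nlinarith
    funext x
    have := congrFun hz x
    simp only [Pi.zero_apply] at this
    exact sub_eq_zero.1 this

end stageTwo

set_option linter.all false

section stageTwoC
open scoped Classical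
variable {p q : ℕ} {F V : Type} [Field F] [Fintype F] [AddCommGroup V] [Module F V]
  {h : V →ₗ[F] V → F}

theorem HS.greedy (H : HS p q h) [Finite V] {n : ℕ} (T : Finset V) (hT : q^(2*n) < T.card) :
    ∀ k, k ≤ n + 1 → ∃ s : Finset V, s ⊆ T ∧ s.card ≤ k ∧
      Module.finrank F (Submodule.span F (s : Set V)) = k := by
  intro k
  induction k with
  | zero => intro _; exact ⟨∅, by simp, by simp, by simp⟩
  | succ k ih =>
    intro hk
    obtain ⟨s, hs1, hs2, hs3⟩ := ih (by omega)
    have : ∃ t ∈ T, t ∉ Submodule.span F (s : Set V) := by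
      by_contra hcon
      push Not at hcon
      have h1 : T ⊆ fs ((Submodule.span F (s : Set V) : Submodule F V) : Set V) := by
        intro t ht
        rw [mem_fs]; exact hcon t ht
      have h2 := Finset.card_le_card h1
      rw [H.card_fs_sub, hs3] at h2
      have h3 : q^(2*k) ≤ q^(2*n) := Nat.pow_le_pow_right (by have := H.q2; omega) (by omega)
      omega
    obtain ⟨t, ht, hts⟩ := this
    refine ⟨insert t s, ?_, ?_, ?_⟩
    · intro y hy
      rw [Finset.mem_insert] at hy
      rcases hy with rfl | hy
      · exact ht
      · exact hs1 hy
    · exact (Finset.card_insert_le _ _).trans (by omega)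
    · rw [Finset.coe_insert, Set.insert_eq, Submodule.span_union, sup_comm, finrank_sup_span hts, hs3]

/-- Markov type counting -/
theorem markov {α β : Type*} (A : Finset α) (B : Finset β) (r : α → β → Prop) (c t : ℝ) (ht : 0 < t)
    (hc : (((A ×ˢ B).filter (fun z => r z.1 z.2)).card : ℝ) ≤ c) :
    ((A.filter (fun a => t < ((B.filter (fun b => r a b)).card : ℝ))).card : ℝ) * t ≤ c := by
  refine le_trans ?_ hc
  have h1 : ((A ×ˢ B).filter (fun z => r z.1 z.2)).card = ∑ a ∈ A, (B.filter (fun b => r a b)).card := by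
    rw [Finset.card_filter, Finset.sum_product]
    apply Finset.sum_congr rfl
    intro a _
    rw [Finset.card_filter]
  rw [h1]
  push_cast
  calc ((A.filter (fun a => t < ((B.filter (fun b => r a b)).card : ℝ))).card : ℝ) * t
      ≤ ∑ a ∈ A.filter (fun a => t < ((B.filter (fun b => r a b)).card : ℝ)), ((B.filter (fun b => r a b)).card : ℝ) := by
        rw [← nsmul_eq_mul]
        apply Finset.card_nsmul_le_sum
        intro a ha
        exact (Finset.mem_filter.1 ha).2.le
    _ ≤ _ := Finset.sum_le_sum_of_subset_of_nonneg (Finset.filter_subset _ _) (by intros; positivity)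

/-- span of elements with few non-neighbours in `B` -/
theorem HS.pick (H : HS p q h) [Finite V] {n : ℕ} (A B : Finset V) (t : ℝ) 
    (hA : (q:ℝ)^(2*n) < ((A.filter (fun a => ((B.filter (fun b => ¬ h a b = 0)).card : ℝ) ≤ t)).card : ℝ)) :
    ∃ W : Submodule F V, Module.finrank F W = n + 1 ∧ W ≤ Submodule.span F (A : Set V) ∧
      ((B.filter (fun b => b ∉ perp h W)).card : ℝ) ≤ (n+1) * t := by
  obtain ⟨s, hs1, hs2, hs3⟩ := H.greedy (n := n) _ (by exact_mod_cast hA) (n+1) le_rfl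
  refine ⟨Submodule.span F (s : Set V), hs3, Submodule.span_mono ?_, ?_⟩
  · intro y hy
    exact (Finset.mem_filter.1 (hs1 hy)).1
  have h1 : B.filter (fun b => b ∉ perp h (Submodule.span F (s : Set V))) ⊆
      s.biUnion (fun a => B.filter (fun b => ¬ h a b = 0)) := by
    intro b hb
    rw [Finset.mem_filter, H.mem_perp_span] at hb
    obtain ⟨hb1, hb2⟩ := hb
    push Not at hb2
    obtain ⟨a, ha, hab⟩ := hb2
    rw [Finset.mem_biUnion]
    exact ⟨a, ha, Finset.mem_filter.2 ⟨hb1, fun h0 => hab (H.comm h0)⟩⟩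
  have h2 : ((B.filter (fun b => b ∉ perp h (Submodule.span F (s : Set V)))).card : ℝ) ≤
      ∑ a ∈ s, ((B.filter (fun b => ¬ h a b = 0)).card : ℝ) := by
    exact_mod_cast (Finset.card_le_card h1).trans Finset.card_biUnion_le
  have h3 : ∑ a ∈ s, ((B.filter (fun b => ¬ h a b = 0)).card : ℝ) ≤ s.card * t := by
    rw [← nsmul_eq_mul]
    apply Finset.sum_le_card_nsmul
    intro a ha
    exact (Finset.mem_filter.1 (hs1 ha)).2
  have hs0 : s.Nonempty := by
    rw [Finset.nonempty_iff_ne_empty]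
    rintro rfl
    rw [Finset.coe_empty, Submodule.span_empty, finrank_bot] at hs3
    omega
  obtain ⟨a, ha⟩ := hs0
  have ht : 0 ≤ t := le_trans (Nat.cast_nonneg _) (Finset.mem_filter.1 (hs1 ha)).2
  have h4 : (s.card : ℝ) ≤ n + 1 := by exact_mod_cast hs2
  nlinarith

theorem card_filter_not {α : Type*} (A : Finset α) (P : α → Prop) :
    ((A.filter P).card : ℝ) = A.card - (A.filter (fun a => ¬ P a)).card := by
  have := Finset.card_filter_add_card_filter_not (s := A) P
  rw [eq_sub_iff_add_eq]; exact_mod_cast this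

/-- the conclusion of the characterization theorem -/
def Concl (h : V →ₗ[F] V → F) (n : ℕ) (f : V → ZMod p) : Prop :=
  ∃ (W : Submodule F V) (α : ZMod p), Module.finrank F W = n + 1 ∧ f = std h α W

theorem CW.stage2 (H : HS p q h) [Finite V] {n m : ℕ} (hV : Module.finrank F V = 2*n+2)
    (hn : n = m+1) {f : V → ZMod p} (hf : CW p h n f) (hq : (100:ℝ) ≤ q) (κ : ℝ) (hκ : 0 < κ)
    (hκ2 : κ * (n + 1) ≤ 1/100) (hS : ((sp f).card : ℝ) ≤ (2 + κ^2) * (q:ℝ)^(2*n+1))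
    (A B : Finset V) (hAS : A ⊆ sp f) (hBS : B ⊆ sp f) (hAB : Disjoint A B)
    (hA : (1 - κ^2) * (q:ℝ)^(2*n+1) ≤ A.card) (hB : (1 - κ^2) * (q:ℝ)^(2*n+1) ≤ B.card)
    (hP : (((A ×ˢ B).filter (fun z => ¬ h z.1 z.2 = 0)).card : ℝ) ≤ κ^2 * ((q:ℝ)^(2*n+1))^2) :
    Concl h n f := by
  set M : ℝ := (q:ℝ)^(2*n+1) with hM
  have hM0 : 0 < M := by positivity
  have hMq : (q:ℝ)^(2*n) ≤ M / 100 := by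
    have : M = q * (q:ℝ)^(2*n) := by rw [hM]; ring
    have h0 : (0:ℝ) < (q:ℝ)^(2*n) := by positivity
    nlinarith
  have hn0 : (0:ℝ) ≤ n := Nat.cast_nonneg n
  have hκ1 : κ ≤ 1/100 := by nlinarith
  have hκκ : κ^2 ≤ 1/100 * κ := by nlinarith
  have hκM : 0 < κ * M := by positivity
  have hbad : ∀ (A B : Finset V), (((A ×ˢ B).filter (fun z => ¬ h z.1 z.2 = 0)).card : ℝ) ≤ κ^2 * M^2 →
      (A.card : ℝ) - κ * M ≤ ((A.filter (fun a => ((B.filter (fun b => ¬ h a b = 0)).card : ℝ) ≤ κ * M)).card : ℝ) := by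
    intro A B hP
    have h1 := markov A B (fun a b => ¬ h a b = 0) (κ^2*M^2) _ hκM (by convert hP)
    rw [card_filter_not]
    simp only [not_le]
    have h2 : κ^2 * M^2 = (κ * M) * (κ * M) := by ring
    rw [h2] at h1
    have := le_of_mul_le_mul_right h1 hκM
    refine sub_le_sub_left (le_of_eq_of_le ?_ this) _
    apply congrArg
    apply congrArg Finset.card
    ext a
    simp only [Finset.mem_filter]
    refine and_congr_right fun _ => ?_
    have e : (B.filter (fun b => ¬ h a b = 0)).card = (fs {b | b ∈ B ∧ ¬ h a b = 0}).card := by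
      congr 1; ext b; simp [mem_fs]
    rw [e]
    refine Iff.of_eq (congrArg (fun z : ℕ => κ * M < (z:ℝ)) ?_)
    congr 1; ext b; simp [mem_fs]
  obtain ⟨W, hW, _, hWB⟩ := H.pick (n := n) A B (κ * M) (by
    have := hbad A B hP
    nlinarith)
  set B' := B.filter (fun b => b ∈ perp h W) with hB'
  have hB'c : (B'.card : ℝ) = B.card - (B.filter (fun b => b ∉ perp h W)).card := card_filter_not _ _
  have hP' : (((B' ×ˢ A).filter (fun z => ¬ h z.1 z.2 = 0)).card : ℝ) ≤ κ^2 * M^2 := by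
    refine le_trans ?_ hP
    norm_cast
    apply Finset.card_le_card_of_injOn Prod.swap
    · rintro ⟨b, a⟩ hz
      simp only [Finset.coe_filter, Finset.mem_product, Set.mem_setOf_eq, hB', Finset.mem_filter, Prod.swap] at hz ⊢
      exact ⟨⟨hz.1.2, hz.1.1.1⟩, fun h0 => hz.2 (H.comm h0)⟩
    · exact Prod.swap_injective.injOn
  have hnM : (n + 1) * (κ * M) ≤ M / 100 := by nlinarith
  obtain ⟨U, hU, hUs, hUA⟩ := H.pick (n := n) B' A (κ * M) (by
    have := hbad B' A hP'
    nlinarith)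
  have hUP : U = perp h W := by
    have hfp := H.finrank_perp W
    apply Submodule.eq_of_le_of_finrank_eq
    · refine hUs.trans (Submodule.span_le.2 ?_)
      intro b hb
      exact (Finset.mem_filter.1 hb).2
    · omega
  rw [hUP, H.perp_perp] at hUA
  obtain ⟨α, hα⟩ := hf.stage2b H hV hn hq hW (by
    have h1 : EE h f W ∪ (A.filter (fun a => a ∈ W) ∪ B') ⊆ sp f := by
      intro y hy
      simp only [Finset.mem_union, Finset.mem_filter, hB'] at hy
      rcases hy with hy | hy | hy
      · exact (Finset.mem_filter.1 hy).1
      · exact hAS hy.1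
      · exact hBS hy.1
    have h2 := Finset.card_le_card h1
    rw [Finset.card_union_of_disjoint, Finset.card_union_of_disjoint] at h2
    · have h3 : ((EE h f W).card : ℝ) + ((A.filter (fun a => a ∈ W)).card + B'.card) ≤ (sp f).card := by
        exact_mod_cast h2
      rw [card_filter_not] at h3
      nlinarith
    · exact Finset.disjoint_of_subset_left (Finset.filter_subset _ _)
        (Finset.disjoint_of_subset_right (Finset.filter_subset _ _) hAB)
    · rw [Finset.disjoint_left]
      intro y hy hy'
      rw [mem_EE] at hy
      simp only [Finset.mem_union, Finset.mem_filter, hB'] at hy'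
      tauto)
  exact ⟨W, α, hW, hα⟩

end stageTwoC

set_option linter.all false

/-- the characterization theorem in rank `n` -/
def TT (n : ℕ) : Prop := ∃ ε : ℝ, 0 < ε ∧ ∃ Q : ℝ, ∀ (p q : ℕ) (F V : Type) [Field F] [Fintype F]
  [AddCommGroup V] [Module F V] [Finite V] (h : V →ₗ[F] V → F), HS p q h →
  Module.finrank F V = 2*n+2 → Q ≤ q → ∀ f : V → ZMod p, CW p h n f → f ≠ 0 →
  ((sp f).card : ℝ) ≤ (2 + ε) * (q:ℝ)^(2*n+1) → Concl h n f

section base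
open scoped Classical
variable {p q : ℕ} {F V : Type} [Field F] [Fintype F] [AddCommGroup V] [Module F V]
  {h : V →ₗ[F] V → F}

theorem HS.perp_gen (H : HS p q h) [Finite V] {n : ℕ} (hV : Module.finrank F V = 2*n+2)
    {μ : Submodule F V} (hμ : IsGen h n μ) : perp h μ = μ := by
  have h1 := H.TI_iff.1 hμ.2
  have h2 := H.finrank_perp μ
  have h3 := hμ.1
  exact (Submodule.eq_of_le_of_finrank_eq h1 (by omega)).symm

theorem pair_count {α β : Type*} (A : Finset α) (B : Finset β) (r : α × β → Prop) [DecidablePred r] (t : ℝ)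
    (ht : ∀ b ∈ B, ∃ A' ⊆ A, ((A \ A').card : ℝ) ≤ t ∧ ∀ a ∈ A', ¬ r (a, b)) :
    (((A ×ˢ B).filter r).card : ℝ) ≤ B.card * t := by
  rw [Finset.card_filter, Finset.sum_product_right]
  push_cast
  rw [← nsmul_eq_mul]
  apply Finset.sum_le_card_nsmul
  intro b hb
  obtain ⟨A', hA', hc, hr⟩ := ht b hb
  refine le_trans ?_ hc
  rw [← Finset.sum_filter_add_sum_filter_not A (fun a => a ∈ A')]
  have h1 : ∑ x ∈ A.filter (fun a => a ∈ A'), (if r (x, b) then (1:ℝ) else 0) = 0 := by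
    apply Finset.sum_eq_zero
    intro a ha
    rw [if_neg (hr a (Finset.mem_filter.1 ha).2)]
  rw [h1, zero_add]
  have h2 : A.filter (fun a => ¬ a ∈ A') = A \ A' := by ext; simp
  rw [h2]
  calc ∑ x ∈ A \ A', (if r (x, b) then (1:ℝ) else 0) ≤ ∑ x ∈ A \ A', (1:ℝ) := by
        apply Finset.sum_le_sum; intro a _; split_ifs <;> norm_num
    _ = _ := by simp

theorem CW.base_deg (H : HS p q h) [Finite V] (hV : Module.finrank F V = 2*1+2)
    {f : V → ZMod p} (hf : CW p h 1 f) {x : V} (hx : f x ≠ 0) {l : Submodule F V} (hl : IsGen h 1 l)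
    (hxl : x ∈ l) : (q:ℝ)^3 - q ≤ ((fs {y | f y ≠ 0 ∧ h x y = 0 ∧ y ∉ l}).card : ℝ) := by
  have hx0 : x ≠ 0 := by rintro rfl; exact hx hf.zero
  have hxx := hf.iso x hx
  have hspl : Submodule.span F {x} ≤ l := (Submodule.span_singleton_le_iff_mem _ _).2 hxl
  set E := fs {y | f y ≠ 0 ∧ h x y = 0 ∧ y ∉ l} with hE
  have hG := H.gen_count hV 1 _ (H.TI_span hxx) (by rw [finrank_span_singleton hx0])
  have hlG : l ∈ gens h 1 (Submodule.span F {x}) := mem_gens.2 ⟨hl, hspl⟩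
  have := H.hit hV (m := 0) rfl hx0 hxx E (by
      intro e he hes
      exact (mem_fs.1 he).2.2 (hspl hes)) ((gens h 1 (Submodule.span F {x})).erase l)
      (Finset.erase_subset _ _) ((q:ℝ)^2-1) (by
      intro μ hμ
      rw [Finset.mem_erase, mem_gens] at hμ
      obtain ⟨hne, hμg, hspμ⟩ := hμ
      have hxμ : x ∈ μ := hspμ (Submodule.mem_span_singleton_self x)
      obtain ⟨y, hyμ, hfy, hys⟩ := hf.exists_other H hx hμg hxμ
      apply H.hit_ml
      · intro a e ha he
        simp only [hE, mem_fs, Set.mem_setOf_eq] at he ⊢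
        rw [hf.smul a e ha, Submodule.smul_mem_iff _ ha, H.smul_right, he.2.1, mul_zero]
        exact ⟨he.1, rfl, he.2.2⟩
      · simp [hE, mem_fs]
      · refine ⟨y, ?_, hyμ⟩
        simp only [hE, mem_fs, Set.mem_setOf_eq]
        refine ⟨hfy, H.TI_iff.1 hμg.2 hxμ y hyμ, ?_⟩
        intro hyl
        apply hne
        have h1 := finrank_sup_span hys
        rw [finrank_span_singleton hx0] at h1
        have h2 : Submodule.span F {x} ⊔ Submodule.span F {y} = μ := by
          apply Submodule.eq_of_le_of_finrank_eq
          · exact sup_le hspμ ((Submodule.span_singleton_le_iff_mem _ _).2 hyμ)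
          · rw [h1, hμg.1]
        have h3 : Submodule.span F {x} ⊔ Submodule.span F {y} = l := by
          apply Submodule.eq_of_le_of_finrank_eq
          · exact sup_le hspl ((Submodule.span_singleton_le_iff_mem _ _).2 hyl)
          · rw [h1, hl.1]
        rw [← h2, h3])
  rw [Finset.card_erase_of_mem hlG, hG] at this
  simp [gg] at this
  nlinarith

theorem TT_one : TT 1 := by
  refine ⟨1/1000000, by norm_num, 1000000, ?_⟩
  intro p q F V _ _ _ _ _ h H hV hq f hf hf0 hS
  norm_num at hS
  obtain ⟨x, hx⟩ : ∃ x, f x ≠ 0 := by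
    by_contra hcon
    push Not at hcon
    exact hf0 (funext hcon)
  have hx0 : x ≠ 0 := by rintro rfl; exact hx hf.zero
  have hdeg := hf.degree H hV (m := 0) rfl hx
  set B := (sp f).filter (fun y => h x y = 0 ∧ y ∉ Submodule.span F {x}) with hB
  set A := fs {y | f y ≠ 0 ∧ h x y ≠ 0} with hA
  have hBmem : ∀ y, y ∈ B ↔ f y ≠ 0 ∧ h x y = 0 ∧ y ∉ Submodule.span F {x} := by
    intro y; simp [hB, mem_sp]
  have hAmem : ∀ y, y ∈ A ↔ f y ≠ 0 ∧ h x y ≠ 0 := by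
    intro y; simp [hA, mem_fs]
  have hAB : Disjoint A B := by
    rw [Finset.disjoint_left]
    intro y hy hy'
    exact ((hAmem y).1 hy).2 ((hBmem y).1 hy').2.1
  have hAS : A ⊆ sp f := fun y hy => mem_sp.2 ((hAmem y).1 hy).1
  have hBS : B ⊆ sp f := fun y hy => mem_sp.2 ((hBmem y).1 hy).1
  have hcard : (A.card : ℝ) + B.card ≤ (sp f).card := by
    have := Finset.card_le_card (Finset.union_subset hAS hBS)
    rw [Finset.card_union_of_disjoint hAB] at this
    exact_mod_cast this
  have hB3 : (q:ℝ)^3 ≤ B.card := by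
    refine le_trans ?_ hdeg
    norm_num
    nlinarith
  have hsub : ∀ y ∈ B, ∃ A' ⊆ A, (q:ℝ)^3 - q ≤ A'.card ∧ ∀ a ∈ A', h a y = 0 := by
    intro y hy
    obtain ⟨hfy, hxy, hys⟩ := (hBmem y).1 hy
    have hl : IsGen h 1 (Submodule.span F {x} ⊔ Submodule.span F {y}) := by
      constructor
      · rw [finrank_sup_span hys, finrank_span_singleton hx0]
      · apply H.TI_sup (H.TI_span (hf.iso x hx)) _ (hf.iso y hfy)
        rw [H.mem_perp_span]
        simpa using H.comm hxy
    set l := Submodule.span F {x} ⊔ Submodule.span F {y}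
    have hyl : y ∈ l := Submodule.mem_sup_right (Submodule.mem_span_singleton_self y)
    refine ⟨fs {z | f z ≠ 0 ∧ h y z = 0 ∧ z ∉ l}, ?_, hf.base_deg H hV hfy hl hyl, ?_⟩
    · intro z hz
      obtain ⟨hz1, hz2, hz3⟩ := mem_fs.1 hz
      rw [hAmem]
      refine ⟨hz1, fun hxz => hz3 ?_⟩
      rw [← H.perp_gen hV hl]
      intro w hw
      obtain ⟨u, hu, v, hv, rfl⟩ := Submodule.mem_sup.1 hw
      obtain ⟨a, rfl⟩ := Submodule.mem_span_singleton.1 hu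
      obtain ⟨b, rfl⟩ := Submodule.mem_span_singleton.1 hv
      rw [H.add_right, H.smul_right, H.smul_right, H.comm hxz, H.comm hz2]
      simp
    · intro a ha
      exact H.comm (mem_fs.1 ha).2.1
  have hA3 : (q:ℝ)^3 - q ≤ A.card := by
    have hBne : B.Nonempty := by
      rw [← Finset.card_pos]
      have : (0:ℝ) < B.card := by
        refine lt_of_lt_of_le ?_ hB3
        positivity
      exact_mod_cast this
    obtain ⟨y, hy⟩ := hBne
    obtain ⟨A', h1, h2, _⟩ := hsub y hy
    exact h2.trans (by exact_mod_cast Finset.card_le_card h1)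
  have hq2 : (1000000:ℝ)^2 ≤ (q:ℝ)^2 := by gcongr
  have hqq3 : (q:ℝ) ≤ 1/1000000 * q^3 := by nlinarith
  have hq3 : 0 < (q:ℝ)^3 := by positivity
  refine hf.stage2 H hV (m := 0) rfl (by linarith) (1/200) (by norm_num) (by norm_num) ?_ A B hAS hBS hAB ?_ ?_ ?_
  · norm_num; nlinarith
  · norm_num; nlinarith
  · norm_num; nlinarith
  · have := pair_count A B (fun z => ¬ h z.1 z.2 = 0) (2/1000000 * (q:ℝ)^3) (by
      intro b hb
      obtain ⟨A', h1, h2, h3⟩ := hsub b hb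
      refine ⟨A', h1, ?_, fun a ha => by simpa using h3 a ha⟩
      rw [Finset.card_sdiff_of_subset h1, Nat.cast_sub (Finset.card_le_card h1)]
      linarith)
    refine this.trans ?_
    norm_num
    nlinarith
end base

set_option linter.all false

section projection
open scoped Classical
variable {p q : ℕ} {F V : Type} [Field F] [Fintype F] [AddCommGroup V] [Module F V]
  {h : V →ₗ[F] V → F}

/-- restriction of the form -/
def resF (h : V →ₗ[F] V → F) (U : Submodule F V) : U →ₗ[F] U → F where
  toFun x := fun y => h x y
  map_add' a b := by funext y; simp
  map_smul' c a := by funext y; simp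

theorem resF_apply (U : Submodule F V) (x y : U) : resF h U x y = h x y := rfl

/-- the complement of a hyperbolic plane -/
def hypc (h : V →ₗ[F] V → F) (z w : V) : Submodule F V :=
  perp h (Submodule.span F {z} ⊔ Submodule.span F {w})

theorem HS.mem_hypc (H : HS p q h) {z w x : V} : x ∈ hypc h z w ↔ h x z = 0 ∧ h x w = 0 := by
  rw [hypc, ← Submodule.span_union, H.mem_perp_span]
  simp
  tauto

theorem HS.res (H : HS p q h) [Finite V] {z w : V} (hzz : h z z = 0) (hzw : h z w ≠ 0) :
    HS p q (resF h (hypc h z w)) where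
  pp := H.pp
  hq := H.hq
  q2 := H.q2
  card := H.card
  symm x y := H.symm _ _
  nondeg x hx := by
    have h1 : (x : V) ∈ perp h (hypc h z w) := by
      intro y hy
      exact hx ⟨y, hy⟩
    change (x : V) ∈ perp h (perp h (Submodule.span F {z} ⊔ Submodule.span F {w})) at h1
    rw [H.perp_perp] at h1
    obtain ⟨u, hu, v, hv, huv⟩ := Submodule.mem_sup.1 h1
    obtain ⟨a, rfl⟩ := Submodule.mem_span_singleton.1 hu
    obtain ⟨b, rfl⟩ := Submodule.mem_span_singleton.1 hv
    obtain ⟨h2, h3⟩ := H.mem_hypc.1 x.2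
    rw [← huv] at h2 h3
    have hwz : h w z ≠ 0 := fun h0 => hzw (H.comm h0)
    simp [hzz, hwz] at h2
    subst h2
    simp [hzw] at h3
    subst h3
    apply Subtype.ext
    rw [← huv]; simp

theorem HS.finrank_hypc (H : HS p q h) [Finite V] {z w : V} (hzz : h z z = 0) (hzw : h z w ≠ 0) :
    Module.finrank F (hypc h z w) + 2 = Module.finrank F V := by
  have h1 : w ∉ Submodule.span F {z} := by
    intro hw
    obtain ⟨a, rfl⟩ := Submodule.mem_span_singleton.1 hw
    rw [H.smul_right, hzz, mul_zero] at hzw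
    exact hzw rfl
  have hz0 : z ≠ 0 := by rintro rfl; simp at hzw
  have := H.finrank_perp (Submodule.span F {z} ⊔ Submodule.span F {w})
  rw [finrank_sup_span h1, finrank_span_singleton hz0] at this
  exact this

/-- projected code word -/
noncomputable def prj (f : V → ZMod p) (z : V) (U : Submodule F V) : U → ZMod p :=
  fun v => ∑ l : F, f ((v : V) + l • z)

theorem HS.hypc_uniq (H : HS p q h) {z w : V} (hzw : h z w ≠ 0) {v v' : V} (hv : v ∈ hypc h z w)
    (hv' : v' ∈ hypc h z w) {l l' : F} (he : v + l • z = v' + l' • z) : l = l' ∧ v = v' := by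
  have h1 := congrArg (fun x => h x w) he
  simp [(H.mem_hypc.1 hv).2, (H.mem_hypc.1 hv').2, hzw] at h1
  subst h1
  exact ⟨rfl, add_right_cancel he⟩

theorem CW.prj (H : HS p q h) [Finite V] {n m : ℕ} (hV : Module.finrank F V = 2*n+2)
    (hn : n = m+1) {f : V → ZMod p} (hf : CW p h n f) {z w : V} (hzz : h z z = 0) (hzw : h z w ≠ 0)
    (hfz : f z = 0) : CW p (resF h (hypc h z w)) m (prj f z (hypc h z w)) where
  smul a x ha := by
    unfold HermCode.prj
    rw [← Equiv.sum_comp (Equiv.mulLeft₀ a ha)]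
    apply Finset.sum_congr rfl
    intro l _
    rw [← hf.smul a (x + l • z) ha]
    simp [mul_smul]
  iso v hv := by
    have : ∃ l : F, f ((v : V) + l • z) ≠ 0 := by
      by_contra hcon
      push Not at hcon
      exact hv (Finset.sum_eq_zero fun l _ => hcon l)
    obtain ⟨l, hl⟩ := this
    have h1 := hf.iso _ hl
    have h2 := (H.mem_hypc.1 v.2).1
    simp [H.add_right, H.smul_right, hzz, h2, H.comm h2] at h1
    exact h1
  zero := by
    unfold HermCode.prj
    apply Finset.sum_eq_zero
    intro l _
    by_cases hl : l = 0
    · simp [hl, hf.zero]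
    · simp [hf.smul l z hl, hfz]
  sum μ hμ := by
    have hz0 : z ≠ 0 := by rintro rfl; simp at hzw
    let ν := μ.map (hypc h z w).subtype ⊔ Submodule.span F {z}
    have hzU : z ∉ hypc h z w := fun hz => hzw (H.mem_hypc.1 hz).2
    have hle : μ.map (hypc h z w).subtype ≤ hypc h z w := Submodule.map_subtype_le _ μ
    have hν : IsGen h n ν := by
      constructor
      · rw [finrank_sup_span (fun hz => hzU (hle hz)), Submodule.finrank_map_subtype_eq, hμ.1, hn]
      · apply H.TI_sup _ _ hzz
        · rintro _ ⟨v, hv, rfl⟩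
          exact hμ.2 v hv
        · rintro _ ⟨v, hv, rfl⟩
          exact H.comm (H.mem_hypc.1 v.2).1
    have hsum := hf.sum ν hν
    unfold HermCode.prj
    rw [← hsum, ← Finset.sum_product']
    refine Finset.sum_bij (fun vl _ => (vl.1 : V) + vl.2 • z) ?_ ?_ ?_ ?_
    · rintro ⟨v, l⟩ hvl
      simp only [Finset.mem_product, mem_fs, SetLike.mem_coe, Finset.mem_univ, and_true] at hvl ⊢
      exact Submodule.add_mem_sup (Submodule.mem_map_of_mem hvl)
        (Submodule.smul_mem _ _ (Submodule.mem_span_singleton_self z))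
    · rintro ⟨v, l⟩ _ ⟨v', l'⟩ _ he
      obtain ⟨h1, h2⟩ := H.hypc_uniq hzw v.2 v'.2 he
      simp only at h1 h2
      rw [h1, Subtype.ext h2]
    · intro y hy
      simp only [mem_fs, SetLike.mem_coe] at hy
      obtain ⟨u, ⟨v, hv, rfl⟩, c, hc, rfl⟩ := Submodule.mem_sup.1 hy
      obtain ⟨l, rfl⟩ := Submodule.mem_span_singleton.1 hc
      exact ⟨(v, l), by simpa [mem_fs] using hv, rfl⟩
    · rintro ⟨v, l⟩ _
      rfl

/-- vectors of the support in the perp of `z`, unique in the support on their line with `z` -/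
noncomputable def sing [Finite V] (h : V →ₗ[F] V → F) (f : V → ZMod p) (z : V) : Finset V :=
  fs {x | f x ≠ 0 ∧ h x z = 0 ∧ ∀ l : F, l ≠ 0 → f (x + l • z) = 0}

theorem mem_sing [Finite V] {f : V → ZMod p} {z x : V} : x ∈ sing h f z ↔
    f x ≠ 0 ∧ h x z = 0 ∧ ∀ l : F, l ≠ 0 → f (x + l • z) = 0 := by simp [sing, mem_fs]

/-- vectors of the support in the perp of `z` -/
noncomputable def nbr [Finite V] (h : V →ₗ[F] V → F) (f : V → ZMod p) (z : V) : Finset V :=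
  fs {x | f x ≠ 0 ∧ h x z = 0}

theorem mem_nbr [Finite V] {f : V → ZMod p} {z x : V} : x ∈ nbr h f z ↔
    f x ≠ 0 ∧ h x z = 0 := by simp [nbr, mem_fs]

theorem HS.decomp (H : HS p q h) {z w x : V} (hzz : h z z = 0) (hzw : h z w ≠ 0) (hxz : h x z = 0) :
    ∃ (v : hypc h z w) (l : F), x = (v : V) + l • z := by
  refine ⟨⟨x - (h x w / h z w) • z, ?_⟩, h x w / h z w, by simp⟩
  rw [H.mem_hypc]
  simp [hzz, hxz, hzw]

theorem sing_prj [Finite V] {f : V → ZMod p} {z : V} {U : Submodule F V} {v : U} {l : F}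
    (hs : (v : V) + l • z ∈ sing h f z) : prj f z U v = f (v + l • z) := by
  unfold HermCode.prj
  refine Finset.sum_eq_single_of_mem l (Finset.mem_univ _) ?_
  intro l' _ hl'
  have := (mem_sing.1 hs).2.2 (l' - l) (sub_ne_zero.2 hl')
  rw [← this]; congr 1
  rw [add_assoc, ← add_smul]; simp

theorem CW.card_prj (H : HS p q h) [Finite V] {f : V → ZMod p} {z w : V} (hzz : h z z = 0) (hzw : h z w ≠ 0) :
    (sp (HermCode.prj f z (hypc h z w))).card ≤ (nbr h f z).card := by
  have hch : ∀ v : hypc h z w, ∃ l : F, v ∈ sp (HermCode.prj f z (hypc h z w)) → f ((v : V) + l • z) ≠ 0 := by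
    intro v
    by_contra hcon
    push Not at hcon
    apply mem_sp.1 (hcon 0).1
    exact Finset.sum_eq_zero fun l _ => (hcon l).2
  choose l hl using hch
  apply Finset.card_le_card_of_injOn (fun v : hypc h z w => (v : V) + l v • z)
  · intro v hv
    simp only [Finset.mem_coe, mem_nbr]
    refine ⟨hl v hv, ?_⟩
    simp [(H.mem_hypc.1 v.2).1, hzz]
  · intro v _ v' _ he
    exact Subtype.ext (H.hypc_uniq hzw v.2 v'.2 he).2

theorem HS.sing_count (H : HS p q h) [Finite V] {m : ℕ} {f : V → ZMod p} {z w : V} (hzz : h z z = 0)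
    (hzw : h z w ≠ 0) {W : Submodule F (hypc h z w)} (hW : Module.finrank F W = m + 1)
    {v : hypc h z w} {l : F} (hvW : v ∈ W) (hvP : v ∉ perp (resF h (hypc h z w)) W) :
    (fs {x | x ∈ sing h f z ∧ h ((v:V) + l • z) x = 0 ∧ ∃ u ∈ W, ∃ l' : F, x = (u:V) + l' • z}).card ≤ q^(2*m) := by
  have H' := H.res hzz hzw
  set h' := resF h (hypc h z w) with hh'
  set W' := W ⊓ perp h' (Submodule.span F {v}) with hW'
  have hlt : W' < W := by
    refine lt_of_le_of_ne inf_le_left ?_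
    intro heq
    apply hvP
    intro y hy
    have : y ∈ W' := by rw [heq]; exact hy
    exact H'.comm (this.2 v (Submodule.mem_span_singleton_self v))
  have h2 := Submodule.finrank_lt_finrank_of_lt hlt
  have h3 : (fs (W' : Set (hypc h z w))).card ≤ q^(2*m) := by
    rw [H'.card_fs_sub]
    exact Nat.pow_le_pow_right (by have := H.q2; omega) (by omega)
  refine le_trans ?_ h3
  have hch : ∀ x : V, ∃ u : hypc h z w, (∃ u ∈ W, ∃ l' : F, x = (u:V) + l' • z) → u ∈ W ∧ ∃ l' : F, x = (u:V) + l' • z := by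
    intro x
    by_cases hx : ∃ u ∈ W, ∃ l' : F, x = (u:V) + l' • z
    · obtain ⟨u, hu⟩ := hx
      exact ⟨u, fun _ => hu⟩
    · exact ⟨0, fun hx' => absurd hx' hx⟩
  choose u hu using hch
  apply Finset.card_le_card_of_injOn u
  · intro x hx
    obtain ⟨hx1, hx2, hx3⟩ := mem_fs.1 (Finset.mem_coe.1 hx)
    obtain ⟨huW, l', hl'⟩ := hu x hx3
    simp only [Finset.mem_coe, mem_fs]
    refine ⟨huW, ?_⟩
    show u x ∈ perp h' (Submodule.span F {v})
    rw [H'.mem_perp_span]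
    rintro y rfl
    rw [hl'] at hx2
    simp [H.add_right, H.smul_right, hzz, (H.mem_hypc.1 y.2).1, H.comm (H.mem_hypc.1 (u x).2).1] at hx2
    exact H.comm hx2
  · intro x hx x' hx' he
    obtain ⟨hx1, hx2, hx3⟩ := mem_fs.1 (Finset.mem_coe.1 hx)
    obtain ⟨hx1', hx2', hx3'⟩ := mem_fs.1 (Finset.mem_coe.1 hx')
    obtain ⟨huW, l1, hl1⟩ := hu x hx3
    obtain ⟨huW', l2, hl2⟩ := hu x' hx3'
    by_contra hne
    have hl : l2 - l1 ≠ 0 := by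
      intro h0
      apply hne
      rw [hl1, hl2, he, sub_eq_zero.1 h0]
    apply (mem_sing.1 hx1').1
    rw [← (mem_sing.1 hx1).2.2 _ hl]
    congr 1
    rw [hl2, ← he]
    conv_rhs => rw [hl1]
    rw [add_assoc, ← add_smul]; simp

/-- local structure at a good point -/
theorem CW.local (H : HS p q h) [Finite V] {n m : ℕ} (hV : Module.finrank F V = 2*n+2)
    (hn : n = m+1) {f : V → ZMod p} (hf : CW p h n f) {z : V} (hz0 : z ≠ 0) (hzz : h z z = 0)
    (hfz : f z = 0) {N : ℝ}
    (hT : ∀ (V' : Type) [AddCommGroup V'] [Module F V'] [Finite V'] (h' : V' →ₗ[F] V' → F), HS p q h' →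
      Module.finrank F V' = 2*m+2 → ∀ f : V' → ZMod p, CW p h' m f → f ≠ 0 →
      ((sp f).card : ℝ) ≤ N → Concl h' m f)
    (ht : ((nbr h f z).card : ℝ) ≤ N) (hs : (sing h f z).Nonempty) :
    ∃ A B : Set V, (∀ x ∈ sing h f z, x ∈ A ∨ x ∈ B) ∧ (∀ a ∈ A, ∀ b ∈ B, h a b = 0) ∧
      (∀ a ∈ A, (fs {x | x ∈ sing h f z ∧ h a x = 0 ∧ x ∈ A}).card ≤ q^(2*m)) ∧
      (∀ b ∈ B, (fs {x | x ∈ sing h f z ∧ h b x = 0 ∧ x ∈ B}).card ≤ q^(2*m)) := by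
  obtain ⟨w, hzw⟩ : ∃ w, h z w ≠ 0 := by
    by_contra hcon
    push Not at hcon
    exact hz0 (H.nondeg z hcon)
  have H' := H.res hzz hzw
  set h' := resF h (hypc h z w) with hh'
  have hfr := H.finrank_hypc hzz hzw
  obtain ⟨x0, hx0⟩ := hs
  obtain ⟨v0, l0, hv0⟩ := H.decomp hzz hzw (mem_sing.1 hx0).2.1
  obtain ⟨W, α, hW, hfW⟩ := hT (hypc h z w) h' H' (by omega) _ (hf.prj H hV hn hzz hzw hfz) (by
      intro h0
      have h1 := congrFun h0 v0
      rw [hv0] at hx0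
      rw [sing_prj hx0] at h1
      exact (mem_sing.1 hx0).1 h1) (by
      refine le_trans ?_ ht
      exact_mod_cast CW.card_prj H hzz hzw)
  have hperp := H'.finrank_perp W
  refine ⟨{x | ∃ v ∈ W, v ∉ perp h' W ∧ ∃ l : F, x = (v:V) + l • z},
    {x | ∃ v ∈ perp h' W, v ∉ W ∧ ∃ l : F, x = (v:V) + l • z}, ?_, ?_, ?_, ?_⟩
  · intro x hx
    obtain ⟨v, l, hvl⟩ := H.decomp hzz hzw (mem_sing.1 hx).2.1
    have h1 : HermCode.prj f z (hypc h z w) v ≠ 0 := by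
      rw [hvl] at hx
      rw [sing_prj hx]
      exact (mem_sing.1 hx).1
    rw [hfW] at h1
    by_cases hvW : v ∈ W
    · by_cases hvP : v ∈ perp h' W
      · simp [std, hvW, hvP] at h1
      · exact Or.inl ⟨v, hvW, hvP, l, hvl⟩
    · by_cases hvP : v ∈ perp h' W
      · exact Or.inr ⟨v, hvP, hvW, l, hvl⟩
      · simp [std, hvW, hvP] at h1
  · rintro _ ⟨v, hvW, hvP, l, rfl⟩ _ ⟨u, huP, huW, l', rfl⟩
    have h1 : h (u:V) v = 0 := huP v hvW
    simp [H.add_right, H.smul_right, hzz, (H.mem_hypc.1 v.2).1, H.comm (H.mem_hypc.1 u.2).1]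
    exact H.comm h1
  · rintro _ ⟨v, hvW, hvP, l, rfl⟩
    refine le_trans (Finset.card_le_card ?_) (H.sing_count (f := f) hzz hzw hW (l := l) hvW hvP)
    intro x hx
    obtain ⟨hx1, hx2, u, hu1, hu2, l', hl'⟩ := mem_fs.1 hx
    exact mem_fs.2 ⟨hx1, hx2, u, hu1, l', hl'⟩
  · rintro _ ⟨v, hvP, hvW, l, rfl⟩
    refine le_trans (Finset.card_le_card ?_) (H.sing_count (f := f) hzz hzw (m := m) (W := perp h' W)
      (by omega) (l := l) hvP (by rwa [H'.perp_perp]))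
    intro x hx
    obtain ⟨hx1, hx2, u, hu1, hu2, l', hl'⟩ := mem_fs.1 hx
    exact mem_fs.2 ⟨hx1, hx2, u, hu1, l', hl'⟩

end projection

set_option linter.all false

section variance
open scoped Classical
variable {p q : ℕ} {F V : Type} [Field F] [Fintype F] [AddCommGroup V] [Module F V]
  {h : V →ₗ[F] V → F}

/-- isotropic vectors -/
noncomputable def isoV [Finite V] (h : V →ₗ[F] V → F) : Finset V := fs {z | h z z = 0}

theorem mem_isoV [Finite V] {z : V} : z ∈ isoV h ↔ h z z = 0 := by simp [isoV, mem_fs]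

/-- isotropic vectors orthogonal to a set -/
noncomputable def isoP [Finite V] (h : V →ₗ[F] V → F) (s : Set V) : Finset V :=
  fs {z | h z z = 0 ∧ ∀ y ∈ s, h y z = 0}

theorem mem_isoP [Finite V] {s : Set V} {z : V} : z ∈ isoP h s ↔ h z z = 0 ∧ ∀ y ∈ s, h y z = 0 := by
  simp [isoP, mem_fs]

theorem HS.card_isoP (H : HS p q h) [Finite V] (s : Set V) :
    (isoP h s).card = cI h (perp h (Submodule.span F s)) := by
  rw [cI_eq]; congr 1
  ext z
  rw [mem_isoP, mem_fs]
  simp only [Set.mem_setOf_eq, H.mem_perp_span]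
  constructor
  · rintro ⟨h1, h2⟩; exact ⟨fun y hy => H.comm (h2 y hy), h1⟩
  · rintro ⟨h1, h2⟩; exact ⟨h2, fun y hy => H.comm (h1 y hy)⟩

theorem HS.rad_perp (H : HS p q h) [Finite V] (U : Submodule F V) :
    perp h U ⊓ perp h (perp h U) = U ⊓ perp h U := by
  rw [H.perp_perp, inf_comm]

theorem HS.isoP_le (H : HS p q h) [Finite V] (s : Set V) {k r m : ℕ}
    (hk : Module.finrank F (Submodule.span F s) = k) 
    (hr : Module.finrank F (Submodule.span F s ⊓ perp h (Submodule.span F s) : Submodule F V) ≤ r)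
    (hV : Module.finrank F V = k + (m + 1)) (hrm : r ≤ m) :
    ((isoP h s).card : ℝ) ≤ q^(2*m+1) + q^(2*m) := by
  rw [H.card_isoP]
  apply H.cI_le
  · have := H.finrank_perp (Submodule.span F s); omega
  · rw [H.rad_perp]; omega

theorem HS.le_isoP (H : HS p q h) [Finite V] (s : Set V) {k r m : ℕ}
    (hk : Module.finrank F (Submodule.span F s) = k) 
    (hr : Module.finrank F (Submodule.span F s ⊓ perp h (Submodule.span F s) : Submodule F V) ≤ r)
    (hV : Module.finrank F V = k + (m + 1)) (hrm : r + 1 ≤ m) :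
    (q:ℝ)^(2*m+1) - q^(2*m) ≤ ((isoP h s).card : ℝ) := by
  rw [H.card_isoP]
  apply H.le_cI
  · have := H.finrank_perp (Submodule.span F s); omega
  · rw [H.rad_perp]; omega

theorem HS.isoV_le (H : HS p q h) [Finite V] {m : ℕ} (hV : Module.finrank F V = 2*m+4) :
    ((isoV h).card : ℝ) ≤ q^(4*m+7) + q^(4*m+6) := by
  have h1 : isoV h = isoP h (∅ : Set V) := by ext z; simp [mem_isoV, mem_isoP]
  rw [h1]
  have := H.isoP_le (∅ : Set V) (k := 0) (r := 0) (m := 2*m+3) (by simp) (by simp) (by omega) (by omega)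
  convert this using 2 <;> ring

theorem span1 {x : V} (hx : x ≠ 0) : Module.finrank F (Submodule.span F ({x} : Set V)) = 1 :=
  finrank_span_singleton hx

theorem span2 [Finite V] {x y : V} (hx : x ≠ 0) (hy : y ∉ Submodule.span F ({x} : Set V)) :
    Module.finrank F (Submodule.span F ({x, y} : Set V)) = 2 := by
  have : ({x, y} : Set V) = {x} ∪ {y} := rfl
  rw [this, Submodule.span_union, finrank_sup_span hy, span1 hx]

theorem inf_le_fin [Finite V] (U W : Submodule F V) {k : ℕ} (h : Module.finrank F U = k) :
    Module.finrank F (U ⊓ W : Submodule F V) ≤ k := by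
  rw [← h]; exact Submodule.finrank_mono inf_le_left

theorem HS.isoP1_le (H : HS p q h) [Finite V] {m : ℕ} (hV : Module.finrank F V = 2*m+4) {x : V} (hx : x ≠ 0) :
    ((isoP h {x}).card : ℝ) ≤ q^(4*m+5) + q^(4*m+4) := by
  have := H.isoP_le ({x} : Set V) (k := 1) (r := 1) (m := 2*m+2) (span1 hx) (inf_le_fin _ _ (span1 hx)) (by omega) (by omega)
  convert this using 2 <;> ring

theorem HS.le_isoP1 (H : HS p q h) [Finite V] {m : ℕ} (hV : Module.finrank F V = 2*m+4) {x : V} (hx : x ≠ 0) :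
    (q:ℝ)^(4*m+5) - q^(4*m+4) ≤ ((isoP h {x}).card : ℝ) := by
  have := H.le_isoP ({x} : Set V) (k := 1) (r := 1) (m := 2*m+2) (span1 hx) (inf_le_fin _ _ (span1 hx)) (by omega) (by omega)
  convert this using 2 <;> ring

theorem HS.isoP2_le (H : HS p q h) [Finite V] {m : ℕ} (hm : 1 ≤ m) (hV : Module.finrank F V = 2*m+4) {x y : V} 
    (hx : x ≠ 0) (hy : y ∉ Submodule.span F ({x} : Set V)) :
    ((isoP h {x, y}).card : ℝ) ≤ q^(4*m+3) + q^(4*m+2) := by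
  have := H.isoP_le ({x, y} : Set V) (k := 2) (r := 2) (m := 2*m+1) (span2 hx hy) (inf_le_fin _ _ (span2 hx hy)) (by omega) (by omega)
  convert this using 2 <;> ring

theorem HS.le_isoP2 (H : HS p q h) [Finite V] {m : ℕ} (hm : 1 ≤ m) (hV : Module.finrank F V = 2*m+4) {x y : V} 
    (hx : x ≠ 0) (hy : y ∉ Submodule.span F ({x} : Set V)) :
    (q:ℝ)^(4*m+3) - q^(4*m+2) ≤ ((isoP h {x, y}).card : ℝ) := by
  have := H.le_isoP ({x, y} : Set V) (k := 2) (r := 2) (m := 2*m+1) (span2 hx hy) (inf_le_fin _ _ (span2 hx hy)) (by omega) (by omega)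
  convert this using 2 <;> ring

theorem HS.isoP3_aux (H : HS p q h) [Finite V] {m : ℕ} (hm : 1 ≤ m) (hV : Module.finrank F V = 2*m+4) {x y X : V} 
    (hx : x ≠ 0) (hy : y ∉ Submodule.span F ({x} : Set V)) (hxx : h x x = 0) (hyy : h y y = 0)
    (hXX : h X X = 0) (hxy : h x y = 0) (hXx : h X x ≠ 0) (hXy : h X y = 0) :
    ((isoP h {x, y, X}).card : ℝ) ≤ q^(4*m+1) + q^(4*m) := by
  have hyx := H.comm hxy
  have hyX := H.comm hXy
  have hxX : h x X ≠ 0 := fun h0 => hXx (H.comm h0)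
  have hs : ({x, y, X} : Set V) = {x, y} ∪ {X} := by ext; simp; tauto
  have hX : X ∉ Submodule.span F ({x, y} : Set V) := by
    intro hX
    have h1 : X ∈ perp h (Submodule.span F {x}) := by
      refine (Submodule.span_le.2 ?_) hX
      intro v hv
      rw [SetLike.mem_coe, H.mem_perp_span]
      rintro _ rfl
      rcases hv with rfl | rfl <;> assumption
    exact hXx (h1 x (Submodule.mem_span_singleton_self x))
  have h3 : Module.finrank F (Submodule.span F ({x, y, X} : Set V)) = 3 := by
    rw [hs, Submodule.span_union, finrank_sup_span hX, span2 hx hy]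
  have hrad : Submodule.span F ({x, y, X} : Set V) ⊓ perp h (Submodule.span F ({x, y, X} : Set V)) ≤ Submodule.span F {y} := by
    rintro v ⟨hv1, hv2⟩
    rw [SetLike.mem_coe, H.mem_perp_span] at hv2
    have e1 := hv2 x (by simp)
    have e2 := hv2 X (by simp)
    rw [SetLike.mem_coe, Submodule.mem_span_insert] at hv1
    obtain ⟨a, w, hw, rfl⟩ := hv1
    rw [Submodule.mem_span_pair] at hw
    obtain ⟨b, c, rfl⟩ := hw
    simp [hxx, hyx, hXx] at e1
    subst e1
    simp [hyX, hXX, hxX] at e2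
    subst e2
    simp
    exact Submodule.smul_mem _ _ (Submodule.mem_span_singleton_self y)
  have hr : Module.finrank F (Submodule.span F ({x, y, X} : Set V) ⊓ perp h (Submodule.span F ({x, y, X} : Set V)) : Submodule F V) ≤ 1 := 
    le_trans (Submodule.finrank_mono hrad) (by
      have := finrank_span_le_card (R := F) ({y} : Set V)
      simpa using this)
  have := H.isoP_le ({x, y, X} : Set V) (k := 3) (r := 1) (m := 2*m) h3 hr (by omega) (by omega)
  convert this using 2 <;> ring

theorem HS.isoP3_le (H : HS p q h) [Finite V] {m : ℕ} (hm : 1 ≤ m) (hV : Module.finrank F V = 2*m+4) {x y X : V} 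
    (hx : x ≠ 0) (hy : y ∉ Submodule.span F ({x} : Set V)) (hxx : h x x = 0) (hyy : h y y = 0)
    (hXX : h X X = 0) (hxy : h x y = 0) (hX : ¬ (h X x = 0 ↔ h X y = 0)) :
    ((isoP h {x, y, X}).card : ℝ) ≤ q^(4*m+1) + q^(4*m) := by
  by_cases h1 : h X x = 0
  · have h2 : h X y ≠ 0 := by tauto
    have hy0 : y ≠ 0 := by rintro rfl; exact hy (Submodule.zero_mem _)
    have hx' : x ∉ Submodule.span F ({y} : Set V) := by
      intro hc
      obtain ⟨a, rfl⟩ := Submodule.mem_span_singleton.1 hc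
      have ha : a ≠ 0 := by rintro rfl; simp at hx
      apply hy
      refine Submodule.mem_span_singleton.2 ⟨a⁻¹, ?_⟩
      rw [smul_smul, inv_mul_cancel₀ ha, one_smul]
    have := H.isoP3_aux hm hV hy0 hx' hyy hxx hXX (H.comm hxy) h2 h1
    rwa [Set.insert_comm] at this
  · exact H.isoP3_aux hm hV hx hy hxx hyy hXX hxy h1 (by tauto)

end variance

set_option linter.all false

section variance2
open scoped Classical
variable {p q : ℕ} {F V : Type} [Field F] [Fintype F] [AddCommGroup V] [Module F V]
  {h : V →ₗ[F] V → F}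

theorem dcount {α β : Type*} (Z : Finset α) (S : Finset β) (r : α → β → Prop) :
    ∑ z ∈ Z, ((S.filter (fun x => r z x)).card : ℝ) = ∑ x ∈ S, ((Z.filter (fun z => r z x)).card : ℝ) := by
  simp only [Finset.card_filter]
  push_cast
  exact Finset.sum_comm

theorem nbr_eq [Finite V] (f : V → ZMod p) (z : V) : nbr h f z = (sp f).filter (fun x => h x z = 0) := by
  ext x; simp [mem_nbr, mem_sp]

theorem sum_nbr [Finite V] (f : V → ZMod p) :
    ∑ z ∈ isoV h, ((nbr h f z).card : ℝ) = ∑ x ∈ sp f, ((isoP h {x}).card : ℝ) := by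
  simp only [nbr_eq]
  rw [dcount (isoV h) (sp f) (fun z x => h x z = 0)]
  apply Finset.sum_congr rfl
  intro x _
  congr 2
  ext z; simp [mem_isoV, mem_isoP]

theorem sum_nbr2 [Finite V] (f : V → ZMod p) :
    ∑ z ∈ isoV h, ((nbr h f z).card : ℝ)^2 = ∑ x ∈ sp f, ∑ y ∈ sp f, ((isoP h {x, y}).card : ℝ) := by
  have h1 : ∀ z ∈ isoV h, ((nbr h f z).card : ℝ)^2 =
      (((sp f ×ˢ sp f).filter (fun w => h w.1 z = 0 ∧ h w.2 z = 0)).card : ℝ) := by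
    intro z _
    rw [nbr_eq, Finset.filter_product (fun x => h x z = 0) (fun x => h x z = 0), Finset.card_product]
    push_cast; ring
  have h2 := dcount (isoV h) (sp f ×ˢ sp f) (fun z w => h w.1 z = 0 ∧ h w.2 z = 0)
  rw [Finset.sum_product] at h2
  rw [Finset.sum_congr rfl h1]
  refine Eq.trans (Eq.trans ?_ h2) ?_
  · congr!
  apply Finset.sum_congr rfl
  intro x _
  apply Finset.sum_congr rfl
  intro y _
  congr 2
  ext z; simp [mem_isoV, mem_isoP]

theorem HS.card_dep (H : HS p q h) [Finite V] (S : Finset V) {x : V} (hx : x ≠ 0) :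
    ((S.filter (fun y => y ∈ Submodule.span F {x})).card : ℝ) ≤ (q:ℝ)^2 := by
  have h1 : (S.filter (fun y => y ∈ Submodule.span F {x})) ⊆ fs (Submodule.span F {x} : Set V) := by
    intro y hy; rw [mem_fs]; exact (Finset.mem_filter.1 hy).2
  have h2 := Finset.card_le_card h1
  rw [H.card_fs_sub, finrank_span_singleton hx] at h2
  exact_mod_cast h2

theorem CW.variance (H : HS p q h) [Finite V] {m : ℕ} (hm : 1 ≤ m) (hV : Module.finrank F V = 2*m+4)
    {f : V → ZMod p} {n : ℕ} (hf : CW p h n f) (hs : (q:ℝ)^(2*m+3)/2 ≤ (sp f).card) :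
    ∑ z ∈ isoV h, (((nbr h f z).card : ℝ) - (sp f).card/(q:ℝ)^2)^2 ≤ 8 * ((sp f).card:ℝ)^2 * (q:ℝ)^(4*m+2) := by
  have hq := H.qR
  set s : ℝ := ((sp f).card : ℝ) with hsd
  set L : ℝ := (q:ℝ)^(4*m+2) with hL
  have hL0 : 0 < L := by positivity
  have hne : ∀ x ∈ sp f, x ≠ 0 := by
    rintro x hx rfl; exact mem_sp.1 hx hf.zero
  have e3 : (q:ℝ)^(4*m+3) = q * L := by rw [hL]; ring
  have e4 : (q:ℝ)^(4*m+4) = q^2 * L := by rw [hL]; ring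
  have e5 : (q:ℝ)^(4*m+5) = q^3 * L := by rw [hL]; ring
  have e6 : (q:ℝ)^(4*m+6) = q^4 * L := by rw [hL]; ring
  have e7 : (q:ℝ)^(4*m+7) = q^5 * L := by rw [hL]; ring
  have hT1 : s * (q^3 * L - q^2 * L) ≤ ∑ z ∈ isoV h, ((nbr h f z).card : ℝ) := by
    rw [sum_nbr, hsd, ← nsmul_eq_mul]
    apply Finset.card_nsmul_le_sum
    intro x hx
    have := H.le_isoP1 hV (hne x hx)
    rwa [e5, e4] at this
  have hT2 : ∑ z ∈ isoV h, ((nbr h f z).card : ℝ)^2 ≤ s * (q^2 * (q^3 * L + q^2 * L) + s * (q * L + L)) := by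
    rw [sum_nbr2, hsd, ← nsmul_eq_mul]
    apply Finset.sum_le_card_nsmul
    intro x hx
    rw [← Finset.sum_filter_add_sum_filter_not (sp f) (fun y => y ∈ Submodule.span F {x})]
    apply add_le_add
    · refine le_trans (Finset.sum_le_card_nsmul _ _ (q^3 * L + q^2 * L) ?_) ?_
      · intro y hy
        have h1 := H.isoP1_le hV (hne x hx)
        rw [e5, e4] at h1
        refine le_trans ?_ h1
        have : isoP h {x, y} ⊆ isoP h {x} := by
          intro z hz
          rw [mem_isoP] at hz ⊢
          exact ⟨hz.1, fun w hw => hz.2 w (by simp at hw; simp [hw])⟩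
        exact_mod_cast Finset.card_le_card this
      · rw [nsmul_eq_mul]
        exact mul_le_mul_of_nonneg_right (H.card_dep _ (hne x hx)) (by positivity)
    · refine le_trans (Finset.sum_le_card_nsmul _ _ (q * L + L) ?_) ?_
      · intro y hy
        have h1 := H.isoP2_le hm hV (hne x hx) (Finset.mem_filter.1 hy).2
        rwa [e3] at h1
      · rw [nsmul_eq_mul]
        apply mul_le_mul_of_nonneg_right _ (by positivity)
        exact_mod_cast Finset.card_le_card (Finset.filter_subset _ _)
  have hT0 := H.isoV_le hV
  rw [e6, e7] at hT0
  have hexp : ∑ z ∈ isoV h, (((nbr h f z).card : ℝ) - s/(q:ℝ)^2)^2 =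
      ∑ z ∈ isoV h, ((nbr h f z).card : ℝ)^2 - 2 * (s/(q:ℝ)^2) * ∑ z ∈ isoV h, ((nbr h f z).card : ℝ)
       + (isoV h).card * (s/(q:ℝ)^2)^2 := by
    rw [Finset.mul_sum, ← nsmul_eq_mul, ← Finset.sum_const, ← Finset.sum_sub_distrib, ← Finset.sum_add_distrib]
    apply Finset.sum_congr rfl
    intro z _; ring
  rw [hexp]
  have hs0 : 0 ≤ s := by positivity
  have hq0 : (q:ℝ) ≠ 0 := by positivity
  have a1 : 2 * (s/(q:ℝ)^2) * (s * (q^3 * L - q^2 * L)) ≤ 2 * (s/(q:ℝ)^2) * ∑ z ∈ isoV h, ((nbr h f z).card : ℝ) :=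
    mul_le_mul_of_nonneg_left hT1 (by positivity)
  have a2 : ((isoV h).card : ℝ) * (s/(q:ℝ)^2)^2 ≤ (q^5 * L + q^4 * L) * (s/(q:ℝ)^2)^2 :=
    mul_le_mul_of_nonneg_right hT0 (by positivity)
  have a3 : 2 * (s/(q:ℝ)^2) * (s * (q^3 * L - q^2 * L)) = 2 * s^2 * (q * L - L) := by
    field_simp
  have a4 : (q^5 * L + q^4 * L) * (s/(q:ℝ)^2)^2 = s^2 * (q * L + L) := by
    field_simp
  have a5 : (q:ℝ)^5 ≤ 2 * s := by
    have : (q:ℝ)^5 ≤ (q:ℝ)^(2*m+3) := pow_le_pow_right₀ (by linarith) (by omega)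
    linarith
  have a6 : (q:ℝ)^4 ≤ (q:ℝ)^5 := pow_le_pow_right₀ (by linarith) (by omega)
  have a7 : s * L * ((q:ℝ)^5 + (q:ℝ)^4) ≤ s * L * (4 * s) := 
    mul_le_mul_of_nonneg_left (by linarith) (by positivity)
  nlinarith [a1, a2, a3, a4, a7, hT2]

/-- non-single vectors -/
theorem HS.sum_multi (H : HS p q h) [Finite V] (f : V → ZMod p) :
    ∑ z ∈ isoV h, ((nbr h f z \ sing h f z).card : ℝ) ≤ ((sp f).card : ℝ)^2 * (q:ℝ)^2 := by
  have h1 : ∑ z ∈ isoV h, (nbr h f z \ sing h f z).card ≤ ((sp f) ×ˢ (sp f ×ˢ (Finset.univ : Finset F))).card := by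
    rw [← Finset.card_sigma]
    have hch : ∀ w : (_ : V) × V, ∃ l : F, w.2 ∈ nbr h f w.1 \ sing h f w.1 → l ≠ 0 ∧ f (w.2 + l • w.1) ≠ 0 := by
      intro w
      by_contra hcon
      push Not at hcon
      have h2 := (hcon 0).1
      rw [Finset.mem_sdiff, mem_nbr, mem_sing] at h2
      exact h2.2 ⟨h2.1.1, h2.1.2, fun l hl => (hcon l).2 hl⟩
    choose l hl using hch
    apply Finset.card_le_card_of_injOn (fun w => (w.2, (w.2 + l w • w.1, l w)))
    · intro w hw
      rw [Finset.mem_coe, Finset.mem_sigma] at hw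
      have h3 := hl w hw.2
      have h4 := (mem_nbr.1 (Finset.mem_sdiff.1 hw.2).1).1
      simp [mem_sp, h3.2, h4]
    · intro w hw w' hw' he
      rw [Finset.mem_coe, Finset.mem_sigma] at hw hw'
      simp only [Prod.mk.injEq] at he
      obtain ⟨e1, e2, e3⟩ := he
      rw [← e3, e1] at e2
      have e4 := add_left_cancel e2
      have e5 := smul_right_injective V (hl w hw.2).1 e4
      cases w; cases w'
      simp at e1 e5
      rw [e1, e5]
  have h2 : ((sp f) ×ˢ (sp f ×ˢ (Finset.univ : Finset F))).card = (sp f).card^2 * q^2 := by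
    rw [Finset.card_product, Finset.card_product, Finset.card_univ, H.card]; ring
  rw [h2] at h1
  exact_mod_cast h1

end variance2

set_option linter.all false

section triples
open scoped Classical
variable {p q : ℕ} {F V : Type} [Field F] [Fintype F] [AddCommGroup V] [Module F V]
  {h : V →ₗ[F] V → F}

/-- symmetric difference of neighbourhoods inside the perp of z -/
noncomputable def DZ [Finite V] (h : V →ₗ[F] V → F) (f : V → ZMod p) (x y z : V) : Finset V :=
  fs {X | f X ≠ 0 ∧ ¬ (h X x = 0 ↔ h X y = 0) ∧ h X z = 0}

theorem mem_DZ [Finite V] {f : V → ZMod p} {x y z X : V} :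
    X ∈ DZ h f x y z ↔ f X ≠ 0 ∧ ¬ (h X x = 0 ↔ h X y = 0) ∧ h X z = 0 := by simp [DZ, mem_fs]

theorem DZ_comm [Finite V] {f : V → ZMod p} {x y z : V} : DZ h f x y z = DZ h f y x z := by
  ext X; simp only [mem_DZ]; tauto

/-- bad pairs at z -/
noncomputable def badP [Finite V] (h : V →ₗ[F] V → F) (f : V → ZMod p) (T : ℝ) (z : V) : Finset (V × V) :=
  fs {w | f w.1 ≠ 0 ∧ f w.2 ≠ 0 ∧ h w.1 z = 0 ∧ h w.2 z = 0 ∧ h w.1 w.2 = 0 ∧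
    ((DZ h f w.1 w.2 z).card : ℝ) < T}

theorem mem_badP [Finite V] {f : V → ZMod p} {T : ℝ} {z : V} {w : V × V} : w ∈ badP h f T z ↔
    f w.1 ≠ 0 ∧ f w.2 ≠ 0 ∧ h w.1 z = 0 ∧ h w.2 z = 0 ∧ h w.1 w.2 = 0 ∧
    ((DZ h f w.1 w.2 z).card : ℝ) < T := by simp [badP, mem_fs]

theorem sing_sub_nbr [Finite V] {f : V → ZMod p} {z : V} : sing h f z ⊆ nbr h f z := by
  intro x hx; rw [mem_sing] at hx; exact mem_nbr.2 ⟨hx.1, hx.2.1⟩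

theorem HS.nice_pair (H : HS p q h) [Finite V] {f : V → ZMod p} {z : V} {c : ℕ} {A B : Set V}
    (hAB : ∀ x ∈ sing h f z, x ∈ A ∨ x ∈ B) (hperp : ∀ a ∈ A, ∀ b ∈ B, h a b = 0)
    (hA : ∀ a ∈ A, (fs {x | x ∈ sing h f z ∧ h a x = 0 ∧ x ∈ A}).card ≤ c)
    (hB : ∀ b ∈ B, (fs {x | x ∈ sing h f z ∧ h b x = 0 ∧ x ∈ B}).card ≤ c)
    {x y : V} (hx : x ∈ A) (hy : y ∈ B) : (sing h f z).card ≤ (DZ h f x y z).card + 2 * c := by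
  have h1 : sing h f z ⊆ (DZ h f x y z) ∪ (fs {u | u ∈ sing h f z ∧ h x u = 0 ∧ u ∈ A} ∪
      fs {u | u ∈ sing h f z ∧ h y u = 0 ∧ u ∈ B}) := by
    intro u hu
    have hu' := mem_sing.1 hu
    simp only [Finset.mem_union, mem_DZ, mem_fs, Set.mem_setOf_eq]
    rcases hAB u hu with hA' | hB'
    · by_cases h0 : h x u = 0
      · exact Or.inr (Or.inl ⟨hu, h0, hA'⟩)
      · left
        have h2 := hperp u hA' y hy
        have h3 : h u x ≠ 0 := fun hc => h0 (H.comm hc)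
        exact ⟨hu'.1, by tauto, hu'.2.1⟩
    · by_cases h0 : h y u = 0
      · exact Or.inr (Or.inr ⟨hu, h0, hB'⟩)
      · left
        have h2 := H.comm (hperp x hx u hB')
        have h3 : h u y ≠ 0 := fun hc => h0 (H.comm hc)
        exact ⟨hu'.1, by tauto, hu'.2.1⟩
  have h2 := Finset.card_le_card h1
  have h3 := Finset.card_union_le (DZ h f x y z) (fs {u | u ∈ sing h f z ∧ h x u = 0 ∧ u ∈ A} ∪
      fs {u | u ∈ sing h f z ∧ h y u = 0 ∧ u ∈ B})
  have h4 := Finset.card_union_le (fs {u | u ∈ sing h f z ∧ h x u = 0 ∧ u ∈ A}) 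
      (fs {u | u ∈ sing h f z ∧ h y u = 0 ∧ u ∈ B})
  have h5 := hA x hx
  have h6 := hB y hy
  omega

theorem HS.good_pairs (H : HS p q h) [Finite V] {f : V → ZMod p} {z : V} {c : ℕ} {T : ℝ} {A B : Set V}
    (hAB : ∀ x ∈ sing h f z, x ∈ A ∨ x ∈ B) (hperp : ∀ a ∈ A, ∀ b ∈ B, h a b = 0)
    (hA : ∀ a ∈ A, (fs {x | x ∈ sing h f z ∧ h a x = 0 ∧ x ∈ A}).card ≤ c)
    (hB : ∀ b ∈ B, (fs {x | x ∈ sing h f z ∧ h b x = 0 ∧ x ∈ B}).card ≤ c)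
    (hT : T ≤ ((sing h f z).card : ℝ) - 2 * c) :
    (badP h f T z).card ≤ 2 * ((nbr h f z \ sing h f z).card * (nbr h f z).card) + (nbr h f z).card * c := by
  have hno : ∀ x ∈ A, ∀ y ∈ B, ¬ ((DZ h f x y z).card : ℝ) < T := by
    intro x hx y hy hlt
    have h1 := H.nice_pair hAB hperp hA hB hx hy
    have h2 : ((sing h f z).card : ℝ) ≤ (DZ h f x y z).card + 2 * c := by exact_mod_cast h1
    linarith
  have h1 : badP h f T z ⊆ ((nbr h f z \ sing h f z) ×ˢ (nbr h f z) ∪ (nbr h f z) ×ˢ (nbr h f z \ sing h f z)) ∪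
      ((nbr h f z).biUnion (fun x => (fs {y | x ∈ sing h f z ∧ y ∈ sing h f z ∧ (x, y) ∈ badP h f T z}).image (fun y => (x, y)))) := by
    rintro ⟨x, y⟩ hw
    have hw' := mem_badP.1 hw
    have hx : x ∈ nbr h f z := mem_nbr.2 ⟨hw'.1, hw'.2.2.1⟩
    have hy : y ∈ nbr h f z := mem_nbr.2 ⟨hw'.2.1, hw'.2.2.2.1⟩
    simp only [Finset.mem_union, Finset.mem_product, Finset.mem_sdiff, Finset.mem_biUnion, Finset.mem_image, mem_fs, Set.mem_setOf_eq]
    by_cases h1 : x ∈ sing h f z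
    · by_cases h2 : y ∈ sing h f z
      · exact Or.inr ⟨x, hx, y, ⟨h1, h2, hw⟩, rfl⟩
      · exact Or.inl (Or.inr ⟨hx, hy, h2⟩)
    · exact Or.inl (Or.inl ⟨⟨hx, h1⟩, hy⟩)
  have h2 := Finset.card_le_card h1
  have h3 : ((nbr h f z).biUnion (fun x => (fs {y | x ∈ sing h f z ∧ y ∈ sing h f z ∧ (x, y) ∈ badP h f T z}).image (fun y => (x, y)))).card ≤ (nbr h f z).card * c := by
    apply Finset.card_biUnion_le_card_mul
    intro x hx
    refine le_trans Finset.card_image_le ?_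
    by_cases hxs : x ∈ sing h f z
    · rcases hAB x hxs with hxA | hxB
      · refine le_trans (Finset.card_le_card ?_) (hA x hxA)
        intro y hy
        obtain ⟨_, hy1, hy2⟩ := mem_fs.1 hy
        have hy3 := mem_badP.1 hy2
        refine mem_fs.2 ⟨hy1, hy3.2.2.2.2.1, ?_⟩
        rcases hAB y hy1 with h4 | h4
        · exact h4
        · exact absurd hy3.2.2.2.2.2 (hno x hxA y h4)
      · refine le_trans (Finset.card_le_card ?_) (hB x hxB)
        intro y hy
        obtain ⟨_, hy1, hy2⟩ := mem_fs.1 hy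
        have hy3 := mem_badP.1 hy2
        refine mem_fs.2 ⟨hy1, hy3.2.2.2.2.1, ?_⟩
        rcases hAB y hy1 with h4 | h4
        · have h5 := hy3.2.2.2.2.2
          simp only at h5
          rw [DZ_comm] at h5
          exact absurd h5 (hno y h4 x hxB)
        · exact h4
    · have : fs {y | x ∈ sing h f z ∧ y ∈ sing h f z ∧ (x, y) ∈ badP h f T z} = ∅ := by
        ext y; simp [mem_fs, hxs]
      rw [this]; simp
  have h4 := Finset.card_union_le ((nbr h f z \ sing h f z) ×ˢ (nbr h f z) ∪ (nbr h f z) ×ˢ (nbr h f z \ sing h f z))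
    ((nbr h f z).biUnion (fun x => (fs {y | x ∈ sing h f z ∧ y ∈ sing h f z ∧ (x, y) ∈ badP h f T z}).image (fun y => (x, y))))
  have h5 := Finset.card_union_le ((nbr h f z \ sing h f z) ×ˢ (nbr h f z)) ((nbr h f z) ×ˢ (nbr h f z \ sing h f z))
  rw [Finset.card_product, Finset.card_product] at h5
  have h6 := mul_comm ((nbr h f z).card) ((nbr h f z \ sing h f z).card)
  omega

theorem badP_le [Finite V] (f : V → ZMod p) (T : ℝ) (z : V) : ((badP h f T z).card : ℝ) ≤ ((nbr h f z).card : ℝ)^2 := by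
  have : badP h f T z ⊆ nbr h f z ×ˢ nbr h f z := by
    intro w hw
    have hw' := mem_badP.1 hw
    exact Finset.mem_product.2 ⟨mem_nbr.2 ⟨hw'.1, hw'.2.2.1⟩, mem_nbr.2 ⟨hw'.2.1, hw'.2.2.2.1⟩⟩
  have := Finset.card_le_card this
  rw [Finset.card_product, ← sq] at this
  exact_mod_cast this

/-- pointwise bound -/
theorem CW.badP_point (H : HS p q h) [Finite V] {n m : ℕ} (hV : Module.finrank F V = 2*n+2)
    (hn : n = m+1) {f : V → ZMod p} (hf : CW p h n f) {N τ η : ℝ}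
    (hT : ∀ (V' : Type) [AddCommGroup V'] [Module F V'] [Finite V'] (h' : V' →ₗ[F] V' → F), HS p q h' →
      Module.finrank F V' = 2*m+2 → ∀ f : V' → ZMod p, CW p h' m f → f ≠ 0 →
      ((sp f).card : ℝ) ≤ N → Concl h' m f) (hη : 0 < η) (hη2 : η ≤ 1/8) (hτ : 0 < τ) (hN : (1+η)*τ ≤ N)
    (hqτ : 2 * (q:ℝ)^(2*m) ≤ η * τ) {z : V} (hzz : h z z = 0) :
    ((badP h f ((1-4*η)*τ) z).card : ℝ) ≤ 6*η*τ^2 + (2+2/η^2) * (((nbr h f z).card : ℝ) - τ)^2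
      + 4*τ^2*(if z ∈ insert 0 (sp f) then 1 else 0) + 4*τ/η * ((nbr h f z \ sing h f z).card : ℝ) := by
  set t : ℝ := ((nbr h f z).card : ℝ) with ht
  set μ : ℝ := ((nbr h f z \ sing h f z).card : ℝ) with hμ
  have hμ0 : 0 ≤ μ := by positivity
  have ht0 : 0 ≤ t := by positivity
  have hble := badP_le (h := h) f ((1-4*η)*τ) z
  rw [← ht] at hble
  have p1 : 0 ≤ 6*η*τ^2 := by positivity
  have p2 : 0 ≤ (2+2/η^2) * (t - τ)^2 := by positivity
  have p4 : 0 ≤ 4*τ/η * μ := by positivity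
  have p3 : 0 ≤ 4*τ^2*(if z ∈ insert 0 (sp f) then (1:ℝ) else 0) := by positivity
  by_cases c1 : |t - τ| ≤ η * τ
  · rw [abs_le] at c1
    have ht2 : t ≤ 2 * τ := by nlinarith
    have ht3 : t^2 ≤ 4 * τ^2 := by nlinarith
    by_cases c2 : z ∈ insert 0 (sp f)
    · rw [if_pos c2] at p3 ⊢
      linarith
    by_cases c3 : μ ≤ η * τ
    · have hz0 : z ≠ 0 := by rintro rfl; simp at c2
      have hfz : f z = 0 := by
        by_contra h0
        exact c2 (Finset.mem_insert_of_mem (mem_sp.2 h0))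
      have hsc : ((sing h f z).card : ℝ) = t - μ := by
        rw [ht, hμ, Finset.card_sdiff_of_subset sing_sub_nbr, Nat.cast_sub (Finset.card_le_card sing_sub_nbr)]
        ring
      have hsne : (sing h f z).Nonempty := by
        rw [← Finset.card_pos]
        have : (0:ℝ) < ((sing h f z).card : ℝ) := by rw [hsc]; nlinarith
        exact_mod_cast this
      obtain ⟨A, B, hAB, hperp, hA, hB⟩ := hf.local H hV hn hz0 hzz hfz hT (by nlinarith) hsne
      have h1 := H.good_pairs (T := (1-4*η)*τ) hAB hperp hA hB (by
        rw [hsc]; push_cast; nlinarith)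
      have h2 : ((badP h f ((1-4*η)*τ) z).card : ℝ) ≤ 2 * (μ * t) + t * (q:ℝ)^(2*m) := by
        rw [hμ, ht]; exact_mod_cast h1
      have h3 : μ * t ≤ (η * τ) * (2 * τ) := by gcongr
      have h4 : t * (q:ℝ)^(2*m) ≤ (2 * τ) * (η * τ) := by
        have : (q:ℝ)^(2*m) ≤ η * τ := by
          have : (0:ℝ) ≤ (q:ℝ)^(2*m) := by positivity
          linarith
        gcongr
      nlinarith
    · push Not at c3
      have : 4 * τ^2 ≤ 4*τ/η * μ := by
        rw [div_mul_eq_mul_div, le_div_iff₀ hη]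
        nlinarith
      linarith
  · push Not at c1
    have h1 : (η * τ)^2 ≤ (t-τ)^2 := by
      rw [← sq_abs (t-τ)]
      have : 0 ≤ η * τ := by positivity
      gcongr
    have h2 : τ^2 ≤ (t-τ)^2 / η^2 := by
      rw [le_div_iff₀ (by positivity)]; nlinarith
    have h3 : t^2 ≤ 2 * (t-τ)^2 + 2 * τ^2 := by nlinarith [sq_nonneg (t - 2*τ)]
    have h4 : (2+2/η^2) * (t - τ)^2 = 2 * (t-τ)^2 + 2 * ((t-τ)^2/η^2) := by ring
    linarith

theorem arith_fin {η q : ℝ} (hη : 0 < η) (hη2 : η ≤ 1/8) (hq2 : 1 ≤ q) (hq' : 60 ≤ q * η^3) :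
    6 * η * (q + 1) + (2+2/η^2)*8 + 24 + 12/η ≤ 13 * η * q := by
  have h1 : 2/η^2*8 + 12/η + 40 ≤ 60/η^2 := by
    have : 2/η^2*8 + 12/η + 40 = (16 + 12*η+40*η^2)/η^2 := by field_simp; ring
    rw [this]
    apply div_le_div_of_nonneg_right _ (by positivity)
    nlinarith
  have h2 : 60/η^2 ≤ η * q := by
    rw [div_le_iff₀ (by positivity)]
    linarith [show η * q * η^2 = q * η^3 by ring]
  have h3 : η * 1 ≤ η * q := by gcongr
  linarith

set_option maxHeartbeats 1000000 in
theorem CW.bad_triples (H : HS p q h) [Finite V] {n m : ℕ} (hm : 1 ≤ m) (hV : Module.finrank F V = 2*n+2)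
    (hn : n = m+1) {f : V → ZMod p} (hf : CW p h n f) {N η : ℝ}
    (hT : ∀ (V' : Type) [AddCommGroup V'] [Module F V'] [Finite V'] (h' : V' →ₗ[F] V' → F), HS p q h' →
      Module.finrank F V' = 2*m+2 → ∀ f : V' → ZMod p, CW p h' m f → f ≠ 0 →
      ((sp f).card : ℝ) ≤ N → Concl h' m f) (hη : 0 < η) (hη2 : η ≤ 1/8) 
    (hN : (1+η)*((sp f).card/(q:ℝ)^2) ≤ N) (hs : (q:ℝ)^(2*m+3)/2 ≤ (sp f).card)
    (hs3 : ((sp f).card : ℝ) ≤ 3 * (q:ℝ)^(2*m+3)) (hq : 60/η^3 ≤ q) :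
    ∑ z ∈ isoV h, ((badP h f ((1-4*η)*((sp f).card/(q:ℝ)^2)) z).card : ℝ) ≤
      13 * η * ((sp f).card : ℝ)^2 * (q:ℝ)^(4*m+3) := by
  have hq2 := H.qR
  set s : ℝ := ((sp f).card : ℝ) with hsd
  set τ : ℝ := s/(q:ℝ)^2 with hτd
  set L : ℝ := (q:ℝ)^(4*m+2) with hL
  have hL0 : 0 < L := by positivity
  have hs0 : 0 < s := lt_of_lt_of_le (by positivity) hs
  have hs1 : 1 ≤ s := by
    have h1 : (0:ℝ) < s := hs0
    rw [hsd] at h1 ⊢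
    exact_mod_cast h1
  have hτ0 : 0 < τ := by positivity
  have e3 : (q:ℝ)^(4*m+3) = q * L := by rw [hL]; ring
  have e6 : (q:ℝ)^(4*m+6) = q^4 * L := by rw [hL]; ring
  have e7 : (q:ℝ)^(4*m+7) = q^5 * L := by rw [hL]; ring
  have hη3 : η^3 ≤ η := by nlinarith [mul_pos hη hη]
  have hq' : 60 ≤ q * η^3 := by rwa [div_le_iff₀ (by positivity)] at hq
  have hqη : 60 ≤ q * η := by nlinarith
  have hqτ : 2 * (q:ℝ)^(2*m) ≤ η * τ := by
    rw [hτd, mul_div_assoc', le_div_iff₀ (by positivity)]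
    have : η * ((q:ℝ)^(2*m+3)/2) ≤ η * s := by gcongr
    have e : η * ((q:ℝ)^(2*m+3)/2) = (q * η) / 2 * ((q:ℝ)^(2*m) * q^2) := by ring
    have : 30 * ((q:ℝ)^(2*m) * q^2) ≤ (q * η) / 2 * ((q:ℝ)^(2*m) * q^2) := by gcongr; linarith
    have : 0 ≤ (q:ℝ)^(2*m) * q^2 := by positivity
    nlinarith
  have hpt := fun z (hz : z ∈ isoV h) => hf.badP_point H hV hn hT hη hη2 hτ0 hN hqτ (mem_isoV.1 hz)
  refine le_trans (Finset.sum_le_sum hpt) ?_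
  rw [Finset.sum_add_distrib, Finset.sum_add_distrib, Finset.sum_add_distrib, ← Finset.mul_sum, ← Finset.mul_sum,
    ← Finset.mul_sum, ← Finset.mul_sum, Finset.sum_const, nsmul_eq_mul]
  have hvar := hf.variance H hm (by omega) hs
  have hmul := H.sum_multi f
  rw [← hsd, ← hL, ← hτd] at hvar
  rw [← hsd] at hmul
  have hZ := H.isoV_le (m := m) (by omega)
  rw [e6, e7] at hZ
  have hins : ∑ z ∈ isoV h, (if z ∈ insert 0 (sp f) then (1:ℝ) else 0) ≤ 2 * s := by
    rw [← Finset.sum_filter, Finset.sum_const, nsmul_eq_mul, mul_one]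
    have h1 : ((isoV h).filter (fun z => z ∈ insert 0 (sp f))).card ≤ (sp f).card + 1 :=
      le_trans (Finset.card_le_card (by intro z hz; exact (Finset.mem_filter.1 hz).2)) (Finset.card_insert_le _ _)
    have h2 : (((isoV h).filter (fun z => z ∈ insert 0 (sp f))).card : ℝ) ≤ s + 1 := by
      rw [hsd]; exact_mod_cast h1
    linarith
  have hq0 : (q:ℝ) ≠ 0 := by positivity
  have b1 : ((isoV h).card : ℝ) * (6*η*τ^2) ≤ 6 * η * s^2 * (q * L + L) := by
    refine le_trans (mul_le_mul_of_nonneg_right hZ (by positivity)) (le_of_eq ?_)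
    rw [hτd]; field_simp
  have b2 : (2+2/η^2) * ∑ z ∈ isoV h, (((nbr h f z).card : ℝ) - τ)^2 ≤ (2+2/η^2) * (8 * s^2 * L) :=
    mul_le_mul_of_nonneg_left hvar (by positivity)
  have b3 : 4*τ^2 * ∑ z ∈ isoV h, (if z ∈ insert 0 (sp f) then (1:ℝ) else 0) ≤ 4*τ^2 * (2*s) :=
    mul_le_mul_of_nonneg_left hins (by positivity)
  have b4 : 4*τ/η * ∑ z ∈ isoV h, ((nbr h f z \ sing h f z).card : ℝ) ≤ 4*τ/η * (s^2 * (q:ℝ)^2) :=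
    mul_le_mul_of_nonneg_left hmul (by positivity)
  have hτs : τ ≤ s := by
    rw [hτd]; apply div_le_self hs0.le; nlinarith
  have hsL : s ≤ 3 * L := by
    refine le_trans hs3 ?_
    have : (q:ℝ)^(2*m+3) ≤ L := pow_le_pow_right₀ (by linarith) (by omega)
    linarith
  have c3 : 4*τ^2 * (2*s) ≤ 24 * s^2 * L := by
    have h1 : τ^2 ≤ s^2 := by gcongr
    calc 4*τ^2 * (2*s) ≤ 4 * s^2 * (2 * (3 * L)) := by gcongr
      _ = _ := by ring
  have c4 : 4*τ/η * (s^2 * (q:ℝ)^2) ≤ 12/η * s^2 * L := by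
    have h1 : 4*τ/η * (s^2 * (q:ℝ)^2) = 4/η * s^2 * s := by rw [hτd]; field_simp
    rw [h1]
    calc 4/η * s^2 * s ≤ 4/η * s^2 * (3 * L) := by gcongr
      _ = _ := by ring
  have hfin := arith_fin hη hη2 (by linarith) hq'
  have hfin2 : s^2 * L * (6 * η * (q + 1) + (2+2/η^2)*8 + 24 + 12/η) ≤ s^2 * L * (13 * η * q) :=
    mul_le_mul_of_nonneg_left hfin (by positivity)
  rw [e3]
  have e1 : s^2 * L * (6 * η * (q + 1) + (2+2/η^2)*8 + 24 + 12/η) = 6 * η * s^2 * (q * L + L) + (2+2/η^2) * (8 * s^2 * L) + 24 * s^2 * L + 12/η * s^2 * L := by ring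
  have e2 : s^2 * L * (13 * η * q) = 13 * η * s^2 * (q * L) := by ring
  linarith

end triples

set_option linter.all false

section stageone
open scoped Classical
variable {p q : ℕ} {F V : Type} [Field F] [Fintype F] [AddCommGroup V] [Module F V]
  {h : V →ₗ[F] V → F}

/-- symmetric difference of neighbourhoods -/
noncomputable def DD [Finite V] (h : V →ₗ[F] V → F) (f : V → ZMod p) (x y : V) : Finset V :=
  fs {X | f X ≠ 0 ∧ ¬ (h X x = 0 ↔ h X y = 0)}

theorem mem_DD [Finite V] {f : V → ZMod p} {x y X : V} :
    X ∈ DD h f x y ↔ f X ≠ 0 ∧ ¬ (h X x = 0 ↔ h X y = 0) := by simp [DD, mem_fs]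

theorem DZ_eq [Finite V] (f : V → ZMod p) (x y z : V) : DZ h f x y z = (DD h f x y).filter (fun X => h X z = 0) := by
  ext X; simp [mem_DZ, mem_DD, and_assoc]

theorem CW.D_large (H : HS p q h) [Finite V] {m n : ℕ} (hm : 1 ≤ m) (hV : Module.finrank F V = 2*m+4)
    {f : V → ZMod p} (hf : CW p h n f) {η θ : ℝ} (hη : 0 < η) (hηθ : 4 * η ≤ θ) (hθ : θ ≤ 1/100)
    (hq : 1 ≤ θ * q) {x y : V} (hx : f x ≠ 0) (hy : f y ≠ 0) (hxy : h x y = 0)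
    (hyx : y ∉ Submodule.span F ({x} : Set V))
    (hb : (((isoV h).filter (fun z => (x, y) ∈ badP h f ((1-4*η)*((sp f).card/(q:ℝ)^2)) z)).card : ℝ) ≤ θ * (q:ℝ)^(4*m+3)) :
    (1 - 4 * θ) * (sp f).card ≤ ((DD h f x y).card : ℝ) := by
  have hq2 := H.qR
  have hx0 : x ≠ 0 := by rintro rfl; exact hx hf.zero
  set s : ℝ := ((sp f).card : ℝ) with hsd
  set T : ℝ := (1-4*η)*(s/(q:ℝ)^2) with hT
  set P : ℝ := (q:ℝ)^(4*m) with hP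
  have hP0 : 0 < P := by positivity
  have hs0 : 0 ≤ s := by positivity
  have hT0 : 0 ≤ T := by
    apply mul_nonneg <;> [linarith; positivity]
  have e3 : (q:ℝ)^(4*m+3) = q^3 * P := by rw [hP]; ring
  have e2 : (q:ℝ)^(4*m+2) = q^2 * P := by rw [hP]; ring
  have e1 : (q:ℝ)^(4*m+1) = q * P := by rw [hP]; ring
  set d : ℝ := ((DD h f x y).card : ℝ) with hd
  have hd0 : 0 ≤ d := by positivity
  -- upper bound
  have hup : ∑ z ∈ isoP h {x, y}, ((DZ h f x y z).card : ℝ) ≤ d * (q * P + P) := by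
    simp only [DZ_eq]
    rw [dcount (isoP h {x, y}) (DD h f x y) (fun z X => h X z = 0), hd, ← nsmul_eq_mul]
    apply Finset.sum_le_card_nsmul
    intro X hX
    rw [mem_DD] at hX
    have h1 := H.isoP3_le hm hV hx0 hyx (hf.iso x hx) (hf.iso y hy) (hf.iso X hX.1) hxy hX.2
    rw [e1] at h1
    refine le_trans ?_ h1
    have : (isoP h {x, y}).filter (fun z => h X z = 0) ⊆ isoP h {x, y, X} := by
      intro z hz
      simp [mem_isoP] at hz ⊢
      tauto
    exact_mod_cast Finset.card_le_card this
  set G := (isoP h {x, y}).filter (fun z => ¬ (x, y) ∈ badP h f T z) with hG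
  have hlow : (G.card : ℝ) * T ≤ ∑ z ∈ isoP h {x, y}, ((DZ h f x y z).card : ℝ) := by
    refine le_trans ?_ (Finset.sum_le_sum_of_subset_of_nonneg (Finset.filter_subset (fun z => ¬ (x, y) ∈ badP h f T z) _) (by intros; positivity))
    rw [← nsmul_eq_mul]
    apply Finset.card_nsmul_le_sum
    intro z hz
    rw [Finset.mem_filter, mem_isoP] at hz
    by_contra hlt
    push Not at hlt
    apply hz.2
    rw [mem_badP]
    exact ⟨hx, hy, hz.1.2 x (by simp), hz.1.2 y (by simp), hxy, hlt⟩
  have hGc : q^3 * P - q^2 * P - θ * (q^3 * P) ≤ (G.card : ℝ) := by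
    have h1 := H.le_isoP2 hm hV hx0 hyx
    rw [e3, e2] at h1
    have h2 : (isoP h {x, y}).card ≤ G.card + ((isoV h).filter (fun z => (x, y) ∈ badP h f T z)).card := by
      rw [hG]
      refine le_trans (Finset.card_le_card ?_) (Finset.card_union_le _ _)
      intro z hz
      rw [Finset.mem_union, Finset.mem_filter, Finset.mem_filter]
      by_cases hc : (x, y) ∈ badP h f T z
      · exact Or.inr ⟨mem_isoV.2 (mem_isoP.1 hz).1, hc⟩
      · exact Or.inl ⟨hz, hc⟩
    have h3 : ((isoP h {x, y}).card : ℝ) ≤ G.card + ((isoV h).filter (fun z => (x, y) ∈ badP h f T z)).card := by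
      exact_mod_cast h2
    rw [e3] at hb
    linarith
  have hmain : (q^3 * P - q^2 * P - θ * (q^3 * P)) * T ≤ d * (q * P + P) :=
    le_trans (mul_le_mul_of_nonneg_right hGc hT0) (le_trans hlow hup)
  have hθ0 : 0 < θ := by linarith
  have hq0 : (q:ℝ) ≠ 0 := by positivity
  have h1 : (q^3 * P - q^2 * P - θ * (q^3 * P)) * T = P * ((q * (1-θ) - 1) * ((1-4*η) * s)) := by
    rw [hT]; field_simp; ring
  have h2 : (q * (1-θ) - 1) * ((1-4*η) * s) ≤ d * (q + 1) := by
    rw [h1] at hmain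
    have : P * ((q * (1-θ) - 1) * ((1-4*η) * s)) ≤ P * (d * (q+1)) := by linarith
    exact le_of_mul_le_mul_left this hP0
  have h3 : (q * (1-2*θ)) * ((1-θ) * s) ≤ d * (q * (1 + θ)) := by
    refine le_trans ?_ (le_trans h2 ?_)
    · apply mul_le_mul
      · linarith
      · apply mul_le_mul_of_nonneg_right _ hs0; linarith
      · apply mul_nonneg _ hs0; linarith
      · nlinarith
    · apply mul_le_mul_of_nonneg_left _ hd0; linarith
  have h4 : (1-2*θ) * ((1-θ) * s) ≤ d * (1 + θ) := by
    have hq1 : (0:ℝ) < q := by positivity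
    have : q * ((1-2*θ) * ((1-θ) * s)) ≤ q * (d * (1 + θ)) := by linarith
    exact le_of_mul_le_mul_left this hq1
  by_contra hlt
  push Not at hlt
  have h5 : d * (1 + θ) ≤ (1 - 4*θ) * s * (1 + θ) := mul_le_mul_of_nonneg_right hlt.le (by linarith)
  have hs1 : 0 < s := by
    by_contra h0
    have : s = 0 := by linarith
    rw [this] at hlt; linarith
  have h6 : 0 < θ^2 * s := by positivity
  nlinarith

/-- exceptional pairs -/
noncomputable def exc [Finite V] (h : V →ₗ[F] V → F) (f : V → ZMod p) (θ : ℝ) : Finset (V × V) :=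
  fs {w | f w.1 ≠ 0 ∧ f w.2 ≠ 0 ∧ h w.1 w.2 = 0 ∧ ((DD h f w.1 w.2).card : ℝ) < (1 - 4*θ) * (sp f).card}

theorem mem_exc [Finite V] {f : V → ZMod p} {θ : ℝ} {w : V × V} : w ∈ exc h f θ ↔
    f w.1 ≠ 0 ∧ f w.2 ≠ 0 ∧ h w.1 w.2 = 0 ∧ ((DD h f w.1 w.2).card : ℝ) < (1 - 4*θ) * (sp f).card := by
  simp [exc, mem_fs]

theorem CW.exc_le (H : HS p q h) [Finite V] {m n : ℕ} (hm : 1 ≤ m) (hV : Module.finrank F V = 2*m+4)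
    {f : V → ZMod p} (hf : CW p h n f) {η θ : ℝ} (hη : 0 < η) (hηθ : 4 * η ≤ θ) (hθ : θ ≤ 1/100)
    (hηθ2 : 13 * η ≤ θ^2)
    (hq : 1 ≤ θ * q) (hs : (q:ℝ)^(2*m+3)/2 ≤ (sp f).card)
    (hbad : ∑ z ∈ isoV h, ((badP h f ((1-4*η)*((sp f).card/(q:ℝ)^2)) z).card : ℝ) ≤
      13 * η * ((sp f).card : ℝ)^2 * (q:ℝ)^(4*m+3)) :
    ((exc h f θ).card : ℝ) ≤ 2 * θ * ((sp f).card : ℝ)^2 := by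
  have hq2 := H.qR
  have hθ0 : 0 < θ := by linarith
  set s : ℝ := ((sp f).card : ℝ) with hsd
  set T : ℝ := (1-4*η)*(s/(q:ℝ)^2) with hT
  set K : ℝ := (q:ℝ)^(4*m+3) with hK
  have hK0 : 0 < K := by positivity
  have hne : ∀ x ∈ sp f, x ≠ 0 := by
    rintro x hx rfl; exact mem_sp.1 hx hf.zero
  set E1 := (sp f).biUnion (fun x => ((sp f).filter (fun y => y ∈ Submodule.span F {x})).image (fun y => (x, y))) with hE1
  set E2 := (sp f ×ˢ sp f).filter (fun w => θ * K < (((isoV h).filter (fun z => w ∈ badP h f T z)).card : ℝ)) with hE2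
  have hsub : exc h f θ ⊆ E1 ∪ E2 := by
    rintro ⟨x, y⟩ hw
    obtain ⟨hx, hy, hxy, hlt⟩ := mem_exc.1 hw
    simp only at hx hy hxy hlt
    rw [Finset.mem_union]
    by_cases h1 : y ∈ Submodule.span F ({x} : Set V)
    · left
      rw [hE1, Finset.mem_biUnion]
      exact ⟨x, mem_sp.2 hx, Finset.mem_image.2 ⟨y, Finset.mem_filter.2 ⟨mem_sp.2 hy, h1⟩, rfl⟩⟩
    · right
      rw [hE2, Finset.mem_filter, Finset.mem_product]
      refine ⟨⟨mem_sp.2 hx, mem_sp.2 hy⟩, ?_⟩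
      by_contra hc
      push Not at hc
      have := hf.D_large H hm hV hη hηθ hθ hq hx hy hxy h1 hc
      linarith
  have hE1c : (E1.card : ℝ) ≤ s * q^2 := by
    have : E1.card ≤ (sp f).card * q^2 := by
      apply Finset.card_biUnion_le_card_mul
      intro x hx
      refine le_trans Finset.card_image_le ?_
      exact_mod_cast H.card_dep (sp f) (hne x hx)
    rw [hsd]; exact_mod_cast this
  have hE2c : (E2.card : ℝ) * (θ * K) ≤ 13 * η * s^2 * K := by
    refine le_trans ?_ hbad
    have h1 : (E2.card : ℝ) * (θ * K) ≤ ∑ w ∈ E2, (((isoV h).filter (fun z => w ∈ badP h f T z)).card : ℝ) := by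
      rw [← nsmul_eq_mul]
      apply Finset.card_nsmul_le_sum
      intro w hw
      exact (Finset.mem_filter.1 hw).2.le
    refine le_trans h1 ?_
    have h2 := dcount (isoV h) E2 (fun z w => w ∈ badP h f T z)
    refine le_trans (le_of_eq (Eq.trans (by congr!) h2.symm)) ?_
    apply Finset.sum_le_sum
    intro z _
    rw [Nat.cast_le]
    apply Finset.card_le_card
    intro w hw
    simp only [Finset.mem_filter] at hw; exact hw.2
  have hE2d : (E2.card : ℝ) ≤ θ * s^2 := by
    have h1 : 13 * η * s^2 * K ≤ θ^2 * s^2 * K := by gcongr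
    have h2 : (E2.card : ℝ) * (θ * K) ≤ (θ * s^2) * (θ * K) := by nlinarith
    exact le_of_mul_le_mul_right h2 (by positivity)
  have hE1d : s * q^2 ≤ θ * s^2 := by
    have h1 : (q:ℝ)^2 ≤ θ * s := by
      have h2 : (q:ℝ)^5 ≤ (q:ℝ)^(2*m+3) := pow_le_pow_right₀ (by linarith) (by omega)
      have h3 : θ * ((q:ℝ)^5/2) ≤ θ * s := by gcongr; linarith
      have h4 : θ * ((q:ℝ)^5/2) = (θ * q) * q^2 * (q^2/2) := by ring
      have h5 : (1:ℝ) * q^2 * 1 ≤ (θ * q) * q^2 * (q^2/2) := by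
        gcongr; nlinarith
      linarith
    have hs0 : 0 ≤ s := by positivity
    nlinarith
  have hfin := le_trans (Finset.card_le_card hsub) (Finset.card_union_le _ _)
  have : ((exc h f θ).card : ℝ) ≤ E1.card + E2.card := by exact_mod_cast hfin
  linarith

end stageone

set_option linter.all false

section stageoneb
open scoped Classical
variable {p q : ℕ} {F V : Type} [Field F] [Fintype F] [AddCommGroup V] [Module F V]
  {h : V →ₗ[F] V → F}

theorem CW.nbr_lb (H : HS p q h) [Finite V] {n m : ℕ} (hV : Module.finrank F V = 2*n+2) (hn : n = m+1)
    {f : V → ZMod p} (hf : CW p h n f) {x : V} (hx : f x ≠ 0) :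
    (q:ℝ)^(2*m+3) - (q:ℝ)^(2*m+1) ≤ ((nbr h f x).card : ℝ) := by
  have h1 := hf.degree H hV hn hx
  have hq := H.qR
  have h2 : ((sp f).filter (fun y => h x y = 0 ∧ y ∉ Submodule.span F {x})) ⊆ nbr h f x := by
    intro y hy
    rw [Finset.mem_filter, mem_sp] at hy
    exact mem_nbr.2 ⟨hy.1, H.comm hy.2.1⟩
  have h3 : (((sp f).filter (fun y => h x y = 0 ∧ y ∉ Submodule.span F {x})).card : ℝ) ≤ ((nbr h f x).card : ℝ) := by
    exact_mod_cast Finset.card_le_card h2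
  have h4 : ((q:ℝ)^2 - 1) * ((q:ℝ)^(2*m+1) + 1) = (q:ℝ)^(2*m+3) - (q:ℝ)^(2*m+1) + ((q:ℝ)^2 - 1) := by ring
  nlinarith

theorem nbr_sub_sp [Finite V] {f : V → ZMod p} {x : V} : nbr h f x ⊆ sp f := by
  intro y hy; exact mem_sp.2 (mem_nbr.1 hy).1

theorem exists_few [Finite V] {f : V → ZMod p} {θ : ℝ} (hf : f ≠ 0)
    (hexc : ((exc h f θ).card : ℝ) ≤ 2 * θ * ((sp f).card : ℝ)^2) :
    ∃ x, f x ≠ 0 ∧ ((fs {y | (x, y) ∈ exc h f θ}).card : ℝ) ≤ 2 * θ * (sp f).card := by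
  have hne : (sp f).Nonempty := by
    obtain ⟨x, hx⟩ := Function.ne_iff.1 hf
    exact ⟨x, mem_sp.2 hx⟩
  by_contra hcon
  push Not at hcon
  have h1 : ((sp f).card : ℝ) * (2 * θ * (sp f).card) < ∑ x ∈ sp f, ((fs {y | (x, y) ∈ exc h f θ}).card : ℝ) := by
    rw [← nsmul_eq_mul, ← Finset.sum_const]
    apply Finset.sum_lt_sum_of_nonempty hne
    intro x hx
    exact hcon x (mem_sp.1 hx)
  have h2 : ∑ x ∈ sp f, (fs {y | (x, y) ∈ exc h f θ}).card ≤ (exc h f θ).card := by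
    rw [← Finset.card_sigma]
    apply Finset.card_le_card_of_injOn (fun w => (w.1, w.2))
    · intro w hw
      rw [Finset.mem_coe, Finset.mem_sigma] at hw
      have h9 := mem_fs.1 hw.2
      exact h9
    · rintro ⟨a, b⟩ _ ⟨c, d⟩ _ he
      simp at he
      rw [he.1, he.2]
  have h3 : ∑ x ∈ sp f, ((fs {y | (x, y) ∈ exc h f θ}).card : ℝ) ≤ ((exc h f θ).card : ℝ) := by exact_mod_cast h2
  nlinarith

theorem CW.stage1 (H : HS p q h) [Finite V] {n m : ℕ} (hV : Module.finrank F V = 2*n+2) (hn : n = m+1)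
    {f : V → ZMod p} (hf : CW p h n f) (hf0 : f ≠ 0) {κ θ : ℝ} (hκ : 0 < κ) (hκ2 : κ * (n + 1) ≤ 1/100)
    (hθ : θ = κ^2/100) (hq100 : (100:ℝ) ≤ q) (hq : 1 ≤ θ * q)
    (hS : ((sp f).card : ℝ) ≤ (2 + κ^2) * (q:ℝ)^(2*n+1))
    (hexc : ((exc h f θ).card : ℝ) ≤ 2 * θ * ((sp f).card : ℝ)^2) : Concl h n f := by
  have hn0 : (0:ℝ) ≤ n := Nat.cast_nonneg n
  have hκ1 : κ ≤ 1/100 := by nlinarith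
  have hκκ : κ^2 ≤ 1/10000 := by nlinarith
  have hκκ0 : 0 < κ^2 := by positivity
  have hθ0 : 0 < θ := by rw [hθ]; positivity
  have hM' : (q:ℝ)^(2*n+1) = (q:ℝ)^(2*m+3) := by rw [hn]; ring_nf
  set s : ℝ := ((sp f).card : ℝ) with hsd
  set M : ℝ := (q:ℝ)^(2*n+1) with hM
  have hM0 : 0 < M := by positivity
  have hs3 : s ≤ 3 * M := by nlinarith
  have hlb : ∀ x, f x ≠ 0 → (1 - θ) * M ≤ ((nbr h f x).card : ℝ) := by
    intro x hx
    refine le_trans ?_ (hf.nbr_lb H hV hn hx)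
    have : (q:ℝ)^(2*m+1) ≤ θ * M := by
      have e : θ * M = (θ * q) * q * (q:ℝ)^(2*m+1) := by rw [hM']; ring
      rw [e]
      have h1 : 0 < (q:ℝ)^(2*m+1) := by positivity
      have : 1 * 1 * (q:ℝ)^(2*m+1) ≤ (θ * q) * q * (q:ℝ)^(2*m+1) := by gcongr; linarith
      linarith
    rw [← hM']; linarith
  obtain ⟨x, hx, hex⟩ := exists_few hf0 hexc
  set Y := fs {y | (x, y) ∈ exc h f θ} with hY
  have hcd : ∀ y ∈ nbr h f x, y ∉ Y → ((sp f \ DD h f x y).card : ℝ) ≤ 4 * θ * s := by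
    intro y hy hyY
    have hy' := mem_nbr.1 hy
    have h1 : (1 - 4*θ) * s ≤ ((DD h f x y).card : ℝ) := by
      by_contra hc
      push Not at hc
      apply hyY
      rw [hY, mem_fs]
      exact mem_exc.2 ⟨hx, hy'.1, H.comm hy'.2, hc⟩
    have hsub : DD h f x y ⊆ sp f := fun X hX => mem_sp.2 (mem_DD.1 hX).1
    rw [Finset.card_sdiff_of_subset hsub, Nat.cast_sub (Finset.card_le_card hsub)]
    linarith
  have hBl := hlb x hx
  obtain ⟨y0, hy0, hy0Y⟩ : ∃ y0 ∈ nbr h f x, y0 ∉ Y := by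
    by_contra hcon
    push Not at hcon
    have h1 : ((nbr h f x).card : ℝ) ≤ (Y.card : ℝ) := by exact_mod_cast Finset.card_le_card hcon
    nlinarith
  refine hf.stage2 H hV hn hq100 κ hκ hκ2 hS (sp f \ nbr h f x) (nbr h f x) Finset.sdiff_subset nbr_sub_sp
    Finset.sdiff_disjoint ?_ ?_ ?_
  · have h1 : nbr h f y0 \ (sp f \ DD h f x y0) ⊆ sp f \ nbr h f x := by
      intro X hX
      simp only [Finset.mem_sdiff, mem_nbr, mem_sp, mem_DD] at hX ⊢
      tauto
    have h2 := Finset.card_le_card h1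
    have h3 := Finset.le_card_sdiff (sp f \ DD h f x y0) (nbr h f y0)
    have h4 : ((nbr h f y0).card : ℝ) ≤ (sp f \ nbr h f x).card + (sp f \ DD h f x y0).card := by
      have : (nbr h f y0).card ≤ (sp f \ nbr h f x).card + (sp f \ DD h f x y0).card := by omega
      exact_mod_cast this
    have h5 := hlb y0 (mem_nbr.1 hy0).1
    have h6 := hcd y0 hy0 hy0Y
    have h7 : 4 * θ * s ≤ 4 * θ * (3 * M) := by gcongr
    have h8 : (1 - κ^2) * M ≤ (1 - 13 * θ) * M := by
      apply mul_le_mul_of_nonneg_right _ hM0.le; rw [hθ]; linarith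
    nlinarith
  · refine le_trans ?_ hBl
    apply mul_le_mul_of_nonneg_right _ hM0.le; rw [hθ]; linarith
  · have h1 : (((sp f \ nbr h f x) ×ˢ nbr h f x).filter (fun z => ¬ h z.1 z.2 = 0)).card =
        ∑ b ∈ nbr h f x, ((sp f \ nbr h f x).filter (fun a => ¬ h a b = 0)).card := by
      rw [Finset.card_filter, Finset.sum_product_right]
      apply Finset.sum_congr rfl
      intro b _
      rw [Finset.card_filter]
    have h2 : ∑ b ∈ nbr h f x, (((sp f \ nbr h f x).filter (fun a => ¬ h a b = 0)).card : ℝ) ≤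
        ∑ b ∈ nbr h f x, (4 * θ * s + if b ∈ Y then s else 0) := by
      apply Finset.sum_le_sum
      intro b hb
      by_cases hbY : b ∈ Y
      · rw [if_pos hbY]
        have h3 : (((sp f \ nbr h f x).filter (fun a => ¬ h a b = 0)).card : ℝ) ≤ s := by
          rw [hsd]
          exact_mod_cast Finset.card_le_card ((Finset.filter_subset _ _).trans Finset.sdiff_subset)
        have : 0 ≤ 4 * θ * s := by positivity
        linarith
      · rw [if_neg hbY, add_zero]
        refine le_trans ?_ (hcd b hb hbY)
        have : (sp f \ nbr h f x).filter (fun a => ¬ h a b = 0) ⊆ sp f \ DD h f x b := by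
          intro a ha
          simp only [Finset.mem_filter, Finset.mem_sdiff, mem_nbr, mem_sp, mem_DD] at ha ⊢
          tauto
        exact_mod_cast Finset.card_le_card this
    have h3 : ∑ b ∈ nbr h f x, (4 * θ * s + if b ∈ Y then s else 0) ≤ s * (4 * θ * s) + 2 * θ * s * s := by
      rw [Finset.sum_add_distrib, Finset.sum_const, nsmul_eq_mul, ← Finset.sum_filter, Finset.sum_const, nsmul_eq_mul]
      have h4 : ((nbr h f x).card : ℝ) ≤ s := by rw [hsd]; exact_mod_cast Finset.card_le_card nbr_sub_sp
      have h5 : (((nbr h f x).filter (fun b => b ∈ Y)).card : ℝ) ≤ 2 * θ * s := by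
        refine le_trans ?_ hex
        have : (nbr h f x).filter (fun b => b ∈ Y) ⊆ Y := fun b hb => (Finset.mem_filter.1 hb).2
        exact_mod_cast Finset.card_le_card this
      gcongr
    have h6 : ((((sp f \ nbr h f x) ×ˢ nbr h f x).filter (fun z => ¬ h z.1 z.2 = 0)).card : ℝ) ≤ 6 * θ * s^2 := by
      rw [h1]; push_cast; linarith
    have hs0 : 0 ≤ s := by positivity
    have h7 : s^2 ≤ (3*M)^2 := by gcongr
    have h8 : 6 * θ * s^2 ≤ 6 * θ * (3*M)^2 := by gcongr
    have h9 : 6 * θ * (3*M)^2 ≤ κ^2 * M^2 := by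
      rw [hθ]
      have : 0 ≤ κ^2 * M^2 := by positivity
      nlinarith
    exact le_trans h6 (le_trans h8 h9)

theorem TT_step (m : ℕ) (hm : 1 ≤ m) (hTT : TT m) : TT (m+1) := by
  obtain ⟨ε, hε, Q, hQ⟩ := hTT
  set κ : ℝ := 1/(100*(m+2)) with hκd
  have hm0 : (1:ℝ) ≤ m := by exact_mod_cast hm
  have hκ : 0 < κ := by positivity
  set θ : ℝ := κ^2/100 with hθd
  have hθ : 0 < θ := by positivity
  have hκ1 : κ ≤ 1/100 := by
    rw [hκd]; apply one_div_le_one_div_of_le <;> linarith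
  have hκκ : κ^2 ≤ 1/10000 := by nlinarith
  have hθ1 : θ ≤ 1/100 := by rw [hθd]; linarith
  set η : ℝ := min (θ^2/13) (min (ε/8) (1/8)) with hηd
  have hη : 0 < η := by positivity
  have hη1 : η ≤ θ^2/13 := min_le_left _ _
  have hη2 : η ≤ ε/8 := (min_le_right _ _).trans (min_le_left _ _)
  have hη3 : η ≤ 1/8 := (min_le_right _ _).trans (min_le_right _ _)
  refine ⟨min (κ^2) (ε/4), by positivity, max Q (max 100 (max (1/θ) (60/η^3))), ?_⟩
  intro p q F V _ _ _ _ _ h H hV hq f hf hf0 hs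
  have hq1 : Q ≤ q := (le_max_left _ _).trans hq
  have hq2 : (100:ℝ) ≤ q := ((le_max_left _ _).trans (le_max_right _ _)).trans hq
  have hq3 : 1/θ ≤ q := ((le_max_left _ _).trans ((le_max_right _ _).trans (le_max_right _ _))).trans hq
  have hq4 : 60/η^3 ≤ q := ((le_max_right _ _).trans ((le_max_right _ _).trans (le_max_right _ _))).trans hq
  have hε1 : min (κ^2) (ε/4) ≤ κ^2 := min_le_left _ _
  have hε2 : min (κ^2) (ε/4) ≤ ε/4 := min_le_right _ _
  have hθq : 1 ≤ θ * q := by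
    rw [div_le_iff₀ hθ] at hq3; linarith
  have hM' : (q:ℝ)^(2*(m+1)+1) = (q:ℝ)^(2*m+3) := by ring_nf
  rw [hM'] at hs
  have hM0 : 0 < (q:ℝ)^(2*m+3) := by positivity
  have hS1 : ((sp f).card : ℝ) ≤ (2 + κ^2) * (q:ℝ)^(2*m+3) := by nlinarith
  have hS3 : ((sp f).card : ℝ) ≤ 3 * (q:ℝ)^(2*m+3) := by nlinarith
  have hlow : (q:ℝ)^(2*m+3)/2 ≤ (sp f).card := by
    obtain ⟨x, hx⟩ := Function.ne_iff.1 hf0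
    have h1 := hf.nbr_lb H hV rfl hx
    have h2 : ((nbr h f x).card : ℝ) ≤ (sp f).card := by exact_mod_cast Finset.card_le_card nbr_sub_sp
    have h3 : (q:ℝ)^(2*m+3) = q^2 * (q:ℝ)^(2*m+1) := by ring
    have h4 : 0 < (q:ℝ)^(2*m+1) := by positivity
    have h5 : 2 * (q:ℝ)^(2*m+1) ≤ q^2 * (q:ℝ)^(2*m+1) := by
      apply mul_le_mul_of_nonneg_right _ h4.le; nlinarith
    linarith
  have hN : (1+η)*((sp f).card/(q:ℝ)^2) ≤ (2+ε) * (q:ℝ)^(2*m+1) := by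
    rw [mul_div_assoc', div_le_iff₀ (by positivity)]
    have e : (2+ε) * (q:ℝ)^(2*m+1) * (q:ℝ)^2 = (2+ε) * (q:ℝ)^(2*m+3) := by ring
    rw [e]
    calc (1+η) * ((sp f).card : ℝ) ≤ (1+η) * ((2 + min (κ^2) (ε/4)) * (q:ℝ)^(2*m+3)) := by gcongr
      _ = ((1+η) * (2 + min (κ^2) (ε/4))) * (q:ℝ)^(2*m+3) := by ring
      _ ≤ _ := by
        apply mul_le_mul_of_nonneg_right _ hM0.le
        nlinarith
  have hbad := hf.bad_triples H hm hV rfl (N := (2+ε) * (q:ℝ)^(2*m+1)) (η := η) (by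
    intro V' _ _ _ h' H' hV' f' hf' hf0' hs'
    exact hQ p q F V' h' H' hV' hq1 f' hf' hf0' hs') hη hη3 hN hlow hS3 hq4
  have hexc := hf.exc_le H hm (by omega) (θ := θ) hη (by nlinarith) hθ1 (by linarith) hθq hlow hbad
  refine hf.stage1 H hV rfl hf0 hκ ?_ hθd hq2 hθq (by rw [hM']; exact hS1) hexc
  rw [hκd]; push_cast
  rw [div_mul_eq_mul_div, div_le_div_iff₀ (by positivity) (by norm_num)]
  linarith

theorem TT_all (n : ℕ) (hn : 1 ≤ n) : TT n := by
  induction n, hn using Nat.le_induction with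
  | base => exact TT_one
  | succ m hm ih => exact TT_step m hm ih

end stageoneb

set_option linter.all false
section counting
open scoped Classical
variable {p q : ℕ} {F V : Type} [Field F] [Fintype F] [AddCommGroup V] [Module F V]
  {h : V →ₗ[F] V → F}

theorem HS.card_std (H : HS p q h) [Finite V] {n : ℕ} (hV : Module.finrank F V = 2*n+2)
    {α : ZMod p} (hα : α ≠ 0) {W : Submodule F V} (hW : Module.finrank F W = n+1) :
    (q:ℤ) * (sp (std h α W)).card + 2 * q ^ (2 * Module.finrank F (W ⊓ perp h W : Submodule F V) + 1) =
      2 * (q ^ (2*n+2) + (-1)^(n+1+Module.finrank F (W ⊓ perp h W : Submodule F V)) * (q-1) *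
        q^(n+1+Module.finrank F (W ⊓ perp h W : Submodule F V))) := by
  haveI : Fact p.Prime := ⟨H.pp⟩
  have hW' : Module.finrank F (perp h W) = n+1 := by
    have := H.finrank_perp W; omega
  have e1 := H.cI_formula W
  have e2 := H.cI_formula (perp h W)
  rw [H.perp_perp, inf_comm (perp h W) W, hW'] at e2
  rw [hW] at e1
  set R := (W ⊓ perp h W : Submodule F V)
  rw [cI_eq] at e1 e2
  set A := fs {x | x ∈ W ∧ h x x = 0}
  set B := fs {x | x ∈ perp h W ∧ h x x = 0}
  have hAB : A ∩ B = fs (R : Set V) := by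
    ext x
    simp only [A, B, R, Finset.mem_inter, mem_fs, Set.mem_setOf_eq, SetLike.mem_coe, Submodule.mem_inf]
    constructor
    · rintro ⟨a, b⟩; exact ⟨a.1, b.1⟩
    · rintro ⟨a, b⟩; exact ⟨⟨a, b x a⟩, ⟨b, b x a⟩⟩
  have hS : sp (std h α W) = (A \ B) ∪ (B \ A) := by
    ext x
    simp only [A, B, mem_sp, std, Finset.mem_union, Finset.mem_sdiff, mem_fs, Set.mem_setOf_eq]
    by_cases h1 : h x x = 0 <;> by_cases h2 : x ∈ W <;> by_cases h3 : x ∈ perp h W <;>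
      simp [h1, h2, h3, hα]
  have hd : Disjoint (A \ B) (B \ A) := by
    rw [Finset.disjoint_left]; intro x hx hx'
    rw [Finset.mem_sdiff] at hx hx'
    exact hx.2 hx'.1
  have c0 : (sp (std h α W)).card = (A \ B).card + (B \ A).card := by
    rw [hS, Finset.card_union_of_disjoint hd]
  have c1 := Finset.card_sdiff_add_card_inter A B
  have c2 := Finset.card_sdiff_add_card_inter B A
  rw [Finset.inter_comm B A] at c2
  rw [hAB, H.card_fs_sub R] at c1 c2
  have c3 : (sp (std h α W)).card + 2 * q ^ (2 * Module.finrank F R) = A.card + B.card := by omega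
  have c4 : ((sp (std h α W)).card : ℤ) + 2 * q ^ (2 * Module.finrank F R) = A.card + B.card := by
    exact_mod_cast c3
  have : 2 * (n+1) = 2*n+2 := by ring
  rw [this] at e1 e2
  rw [pow_succ]
  linear_combination (q:ℤ) * c4 + e1 + e2

theorem HS.std_ge (H : HS p q h) [Finite V] {m : ℕ} (hV : Module.finrank F V = 2*(m+2)+2)
    {α : ZMod p} {W : Submodule F V} (hW : Module.finrank F W = m+2+1)
    (hne : std h α W ≠ 0) :
    2 * ((q:ℤ)^2 - 1) * q^(2*m) * (q^3+1) ≤ (sp (std h α W)).card := by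
  have hα : α ≠ 0 := by
    rintro rfl
    exact hne (by ext x; simp [std])
  have e := H.card_std hV hα hW
  have hq : (2:ℤ) ≤ q := by exact_mod_cast H.q2
  have hS : 0 < (sp (std h α W)).card := by
    rw [Finset.card_pos]
    by_contra h0
    rw [Finset.not_nonempty_iff_eq_empty] at h0
    apply hne
    ext x
    by_contra h1
    have := mem_sp.2 h1
    rw [h0] at this
    simp at this
  have hr : Module.finrank F (W ⊓ perp h W : Submodule F V) ≤ m + 3 := by
    rw [show m + 3 = m+2+1 by ring, ← hW]
    exact Submodule.finrank_mono inf_le_left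
  set r := Module.finrank F (W ⊓ perp h W : Submodule F V)
  set S := (sp (std h α W)).card
  have hS' : (0:ℤ) < S := by exact_mod_cast hS
  have hq0 : (0:ℤ) < q := by linarith
  have hqm : (0:ℤ) < (q:ℤ)^(2*m) := by positivity
  refine le_of_mul_le_mul_left ?_ hq0
  rcases Nat.lt_or_ge r m with hrm | hrm
  · obtain ⟨m, rfl⟩ : ∃ k, m = k + 1 := ⟨m - 1, by omega⟩
    have hs : -(1:ℤ) ≤ (-1)^((m+1)+2+1+r) := by
      rcases neg_one_pow_eq_or ℤ ((m+1)+2+1+r) with h | h <;> rw [h] <;> norm_num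
    have h1 : (q:ℤ)^((m+1)+2+1+r) ≤ q^(2*m+4) := pow_le_pow_right₀ (by linarith) (by omega)
    have h2 : (q:ℤ)^(2*r+1) ≤ q^(2*m+1) := pow_le_pow_right₀ (by linarith) (by omega)
    have h3 : -((q-1) * (q:ℤ)^(2*m+4)) ≤ (-1)^((m+1)+2+1+r) * (q-1) * (q:ℤ)^((m+1)+2+1+r) := by
      have h4 : (q-1) * (q:ℤ)^((m+1)+2+1+r) ≤ (q-1) * q^(2*m+4) := mul_le_mul_of_nonneg_left h1 (by linarith)
      have h5 : 0 ≤ (q-1) * (q:ℤ)^((m+1)+2+1+r) := mul_nonneg (by linarith) (by positivity)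
      nlinarith
    have hqm : (0:ℤ) < (q:ℤ)^(2*m) := by positivity
    have e3 : (q:ℤ)^(2*m+4) = q^(2*m)*q^4 := by ring
    have e4 : (q:ℤ)^(2*m+1) = q^(2*m)*q := by ring
    have e5 : (q:ℤ)^(2*(m+1+2)+2) = q^(2*m)*q^8 := by ring
    have e6 : (q:ℤ)^(2*(m+1)) = q^(2*m)*q^2 := by ring
    rw [e3] at h3
    rw [e4] at h2
    rw [e5] at e
    rw [e6]
    have key : 0 ≤ (q:ℤ)^(2*m) * (2 * (q^8 - (q-1)*q^4 - q) - 2*(q^2-1)*q^2*(q^3+1)*q) := by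
      apply mul_nonneg hqm.le
      have : 2 * ((q:ℤ)^8 - (q-1)*q^4 - q) - 2*(q^2-1)*q^2*(q^3+1)*q = 2*q*(q^3*(q-1)^2 + (q^2-1)) := by ring
      rw [this]
      have h9 : (0:ℤ) ≤ q^2 - 1 := by nlinarith
      positivity
    nlinarith
  · have : r = m ∨ r = m+1 ∨ r = m+2 ∨ r = m+3 := by omega
    have sg : ∀ k, (-1:ℤ)^(2*k) = 1 := fun k => by rw [pow_mul]; norm_num
    rcases this with h | h | h | h <;> rw [h] at e
    · rw [show m+2+1+m = 2*(m+1)+1 by ring, pow_succ (-1:ℤ), sg] at e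
      apply le_of_eq
      linear_combination -e
    · rw [show m+2+1+(m+1) = 2*(m+2) by ring, sg] at e
      have : (q:ℤ) * S - q * (2 * ((q:ℤ)^2 - 1) * q^(2*m) * (q^3+1)) =
         q^(2*m) * (2*q*(q^2-1)^2) := by linear_combination e
      have : 0 ≤ (q:ℤ)^(2*m) * (2*(q:ℤ)*(q^2-1)^2) := by positivity
      linarith
    · rw [show m+2+1+(m+2) = 2*(m+2)+1 by ring, pow_succ (-1:ℤ), sg] at e
      exfalso
      have : (q:ℤ) * S = 0 := by linear_combination e
      nlinarith
    · rw [show m+2+1+(m+3) = 2*(m+3) by ring, sg] at e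
      exfalso
      have : (q:ℤ) * S = 0 := by linear_combination e
      nlinarith

theorem HS.cut (H : HS p q h) [Finite V] {X : Submodule F V}
    (hX : Module.finrank F (X ⊓ perp h X : Submodule F V) < Module.finrank F X) :
    ∃ Y : Submodule F V, Module.finrank F Y + 1 = Module.finrank F X ∧
      (Y ⊓ perp h Y : Submodule F V) = X ⊓ perp h X := by
  have : ¬ TI h X := by
    intro hT
    rw [inf_eq_left.2 (H.TI_iff.1 hT)] at hX
    omega
  unfold TI at this
  push Not at this
  obtain ⟨x, hx, hxx⟩ := this
  set Y := X ⊓ perp h (Submodule.span F {x})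
  have hp : ∀ y, y ∈ perp h (Submodule.span F {x}) ↔ h y x = 0 := fun y => by
    rw [H.mem_perp_span]; simp
  have hxY : x ∉ Y := fun hm => hxx ((hp x).1 hm.2)
  have hdec : ∀ y ∈ X, ∃ a : F, y - a • x ∈ Y := by
    intro y hy
    refine ⟨h y x / h x x, X.sub_mem hy (X.smul_mem _ hx), (hp _).2 ?_⟩
    simp [hxx]
  have hsup : Y ⊔ Submodule.span F {x} = X := by
    apply le_antisymm
    · exact sup_le inf_le_left (by simpa using hx)
    · intro y hy
      obtain ⟨a, ha⟩ := hdec y hy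
      rw [show y = (y - a • x) + a • x by simp]
      exact Submodule.add_mem_sup ha (Submodule.smul_mem _ _ (Submodule.mem_span_singleton_self x))
  refine ⟨Y, ?_, ?_⟩
  · rw [← finrank_sup_span hxY, hsup]
  · apply le_antisymm
    · intro y hy
      refine ⟨hy.1.1, fun z hz => ?_⟩
      obtain ⟨a, ha⟩ := hdec z hz
      have h1 := hy.2 _ ha
      have h2 := (hp y).1 hy.1.2
      rw [show z = (z - a • x) + a • x by simp, H.add_right, h1, H.smul_right, h2]
      simp
    · intro y hy
      refine ⟨⟨hy.1, (hp y).2 (hy.2 x hx)⟩, fun z hz => hy.2 z hz.1⟩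

theorem HS.exists_W (H : HS p q h) [Finite V] {m : ℕ} (hV : Module.finrank F V = 2*(m+2)+2) :
    ∃ W : Submodule F V, Module.finrank F W = m+2+1 ∧
      Module.finrank F (W ⊓ perp h W : Submodule F V) = m := by
  have h1 := H.gen_count hV (m+2+1) ⊥ (by intro x hx; rw [Submodule.mem_bot] at hx; subst hx; simp) (by simp)
  have h2 := gg_pos q (m+2+1)
  rw [← h1, Finset.card_pos] at h2
  obtain ⟨μ, hμ⟩ := h2
  have hμ := (mem_gens.1 hμ).1
  obtain ⟨s, hs1, hs2⟩ := exists_finset_linearIndependent_of_le_finrank (R := F) (M := μ) (n := m) (by rw [hμ.1]; omega)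
  obtain ⟨U, hUμ, hU⟩ : ∃ U : Submodule F V, U ≤ μ ∧ Module.finrank F U = m := by
    refine ⟨(Submodule.span F (s : Set μ)).map μ.subtype, Submodule.map_subtype_le _ _, ?_⟩
    rw [Submodule.finrank_map_subtype_eq, finrank_span_finset_eq_card hs2, hs1]
  have hT : U ≤ perp h U := H.TI_iff.1 fun x hx => hμ.2 x (hUμ hx)
  have hp := H.finrank_perp U
  have hr0 : (perp h U ⊓ perp h (perp h U) : Submodule F V) = U := by
    rw [H.perp_perp, inf_eq_right.2 hT]
  obtain ⟨Y1, a1, b1⟩ := H.cut (X := perp h U) (by rw [hr0]; omega)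
  rw [hr0] at b1
  obtain ⟨Y2, a2, b2⟩ := H.cut (X := Y1) (by rw [b1]; omega)
  rw [b1] at b2
  obtain ⟨Y3, a3, b3⟩ := H.cut (X := Y2) (by rw [b2]; omega)
  rw [b2] at b3
  exact ⟨Y3, by omega, by rw [b3, hU]⟩

theorem HS.exists_std (H : HS p q h) [Finite V] {m : ℕ} (hV : Module.finrank F V = 2*(m+2)+2) :
    ∃ f : V → ZMod p, CW p h (m+2) f ∧ ((sp f).card : ℤ) = ((q:ℤ)^2 - 1) * (2 * q^(2*m) * (q^3+1)) := by
  haveI : Fact p.Prime := ⟨H.pp⟩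
  obtain ⟨W, h1, h2⟩ := H.exists_W hV
  refine ⟨std h 1 W, H.std_cw hV 1 h1, ?_⟩
  have e := H.card_std hV (α := (1 : ZMod p)) one_ne_zero h1
  have sg : ∀ k, (-1:ℤ)^(2*k) = 1 := fun k => by rw [pow_mul]; norm_num
  rw [h2, show m+2+1+m = 2*(m+1)+1 by ring, pow_succ (-1:ℤ), sg] at e
  have hq0 : (q:ℤ) ≠ 0 := by exact_mod_cast H.q0
  apply mul_left_cancel₀ hq0
  linear_combination e

/-- sums over vectors and over points -/
theorem HS.sum_pts (H : HS p q h) [Finite V] {M : Type*} [AddCommMonoid M] (g : Submodule F V → M)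
    (hg : ∀ P : Submodule F V, Module.finrank F P ≠ 1 → g P = 0) (μ : Submodule F V) :
    ∑ x ∈ fs (μ : Set V), g (Submodule.span F {x}) =
      (q^2-1) • ∑ P ∈ fs {P : Submodule F V | Module.finrank F P = 1 ∧ P ≤ μ}, g P := by
  have h1 : ∑ x ∈ fs (μ : Set V), g (Submodule.span F {x}) =
      ∑ x ∈ fs {x | x ∈ μ ∧ x ≠ 0}, g (Submodule.span F {x}) := by
    symm
    apply Finset.sum_subset
    · intro x hx; rw [mem_fs] at hx ⊢; exact hx.1
    · intro x hx hx'
      rw [mem_fs] at hx hx'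
      have : x = 0 := by by_contra h0; exact hx' ⟨hx, h0⟩
      subst this
      apply hg
      rw [Submodule.span_zero_singleton, finrank_bot]; norm_num
  rw [h1, ← Finset.sum_fiberwise_of_maps_to (g := fun x => Submodule.span F {x})
    (t := fs {P : Submodule F V | Module.finrank F P = 1 ∧ P ≤ μ})]
  · rw [Finset.smul_sum]
    apply Finset.sum_congr rfl
    intro P hP
    rw [mem_fs] at hP
    obtain ⟨hP1, hP2⟩ := hP
    obtain ⟨x, hx0, hx⟩ := finrank_eq_one_iff'.1 hP1
    have hx0' : (x : V) ≠ 0 := by simpa using hx0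
    have hPx : P = Submodule.span F {(x:V)} := by
      apply le_antisymm
      · intro y hy
        obtain ⟨a, ha⟩ := hx ⟨y, hy⟩
        rw [Submodule.mem_span_singleton]
        exact ⟨a, congrArg Subtype.val ha⟩
      · rw [Submodule.span_singleton_le_iff_mem]; exact x.2
    rw [← H.card_ml hx0', ← Finset.sum_const]
    have : (fs {x | x ∈ μ ∧ x ≠ 0}).filter (fun y => Submodule.span F {y} = P) = ml F (x:V) := by
      ext y
      simp only [Finset.mem_filter, mem_fs, Set.mem_setOf_eq, mem_ml]
      constructor
      · rintro ⟨⟨hy, hy0⟩, hyP⟩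
        have : y ∈ P := by rw [← hyP]; exact Submodule.mem_span_singleton_self y
        obtain ⟨a, ha⟩ := hx ⟨y, this⟩
        have ha : a • (x:V) = y := congrArg Subtype.val ha
        exact ⟨a, by rintro rfl; exact hy0 (by simpa using ha.symm), ha.symm, hx0'⟩
      · rintro ⟨a, ha, rfl, _⟩
        refine ⟨⟨μ.smul_mem _ (hP2 x.2), smul_ne_zero ha hx0'⟩, ?_⟩
        exact (Submodule.span_singleton_smul_eq (IsUnit.mk0 a ha) _).trans hPx.symm
    rw [← this]
    apply Finset.sum_congr rfl
    intro y hy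
    rw [(Finset.mem_filter.1 hy).2]
  · intro x hx
    rw [mem_fs] at hx ⊢
    exact ⟨finrank_span_singleton hx.2, by rw [Submodule.span_singleton_le_iff_mem]; exact hx.1⟩

end counting

set_option linter.all false
section final
open scoped Classical

/-- the Hermitian form as a linear map into functions -/
def hF (q : ℕ) (F : Type) [Field F] (k : ℕ) : (Fin k → F) →ₗ[F] (Fin k → F) → F where
  toFun x y := herm q x y
  map_add' a b := by ext y; simp [herm, add_mul, Finset.sum_add_distrib]
  map_smul' c a := by ext y; simp [herm, Finset.mul_sum, mul_assoc]

theorem hF_apply (q : ℕ) {F : Type} [Field F] {k : ℕ} (x y : Fin k → F) : hF q F k x y = herm q x y := rfl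

theorem hF_HS {p q k hh : ℕ} {F : Type} [Field F] [Fintype F] (hp : p.Prime) (hq : q = p ^ hh) (q2 : 2 ≤ q)
    (hc : Fintype.card F = q ^ 2) : HS p q (hF q F k) where
  pp := hp
  hq := ⟨hh, hq⟩
  q2 := q2
  card := hc
  symm x y := by
    have h0 : ((p : F)) = 0 := by
      have := FiniteField.cast_card_eq_zero F
      rw [hc, hq] at this
      push_cast at this
      rw [← pow_mul] at this
      exact pow_eq_zero_iff (by
        rintro h0
        have : hh = 0 := by omega
        subst this
        simp at hq
        omega) |>.1 this
    haveI : Fact p.Prime := ⟨hp⟩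
    haveI : CharP F p := (CharP.charP_iff_prime_eq_zero hp).2 h0
    have hs : ∀ g : Fin k → F, (∑ i, g i) ^ q = ∑ i, g i ^ q := by
      intro g
      rw [hq]
      exact sum_pow_char_pow p hh Finset.univ g
    rw [hF_apply, hF_apply, herm, herm, hs]
    apply Finset.sum_congr rfl
    intro i _
    rw [mul_pow, ← pow_mul, ← sq, ← hc, FiniteField.pow_card, mul_comm]
  nondeg x hx := by
    ext i
    have := hx (Pi.single i 1)
    rw [hF_apply, herm, Finset.sum_eq_single i] at this
    · simpa using this
    · intro j _ hj
      rw [Pi.single_eq_of_ne hj, zero_pow (by omega), mul_zero]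
    · simp

variable {p q n : ℕ} {F : Type} [Field F] [Fintype F]

theorem span_herm (H : HS p q (hF q F (2*n+2))) {x : Fin (2*n+2) → F} (hx0 : x ≠ 0) :
    IsHermPoint q (Submodule.span F {x}) ↔ herm q x x = 0 := by
  constructor
  · intro h
    exact h.2 x (Submodule.mem_span_singleton_self x)
  · intro h
    refine ⟨finrank_span_singleton hx0, ?_⟩
    intro y hy
    obtain ⟨a, rfl⟩ := Submodule.mem_span_singleton.1 hy
    rw [← hF_apply, map_smul, Pi.smul_apply, H.smul_right, hF_apply, h]
    simp

theorem finsum_fs (c : Submodule F (Fin (2*n+2) → F) → ZMod p)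
    (hc : ∀ P, ¬ IsHermPoint q P → c P = 0) (μ : Submodule F (Fin (2*n+2) → F)) :
    (∑ᶠ P ∈ {P | IsHermPoint q P ∧ P ≤ μ}, c P) =
      ∑ P ∈ fs {P : Submodule F (Fin (2*n+2) → F) | Module.finrank F P = 1 ∧ P ≤ μ}, c P := by
  rw [finsum_mem_eq_finite_toFinset_sum _ (Set.toFinite _)]
  apply Finset.sum_subset
  · intro P hP
    rw [Set.Finite.mem_toFinset] at hP
    rw [mem_fs]
    exact ⟨hP.1.1, hP.2⟩
  · intro P hP hP'
    rw [mem_fs] at hP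
    rw [Set.Finite.mem_toFinset] at hP'
    exact hc P fun h => hP' ⟨h, hP.2⟩

theorem wt_eq (H : HS p q (hF q F (2*n+2))) (c : Submodule F (Fin (2*n+2) → F) → ZMod p)
    (hc : ∀ P, ¬ IsHermPoint q P → c P = 0) :
    (sp (fun x => c (Submodule.span F {x}))).card = (q^2-1) * wt c := by
  have h1 := H.sum_pts (fun P => if c P ≠ 0 then (1:ℕ) else 0) (by
    intro P hP
    have : c P = 0 := hc P fun h => hP h.1
    simp [this]) ⊤
  have h2 : wt c = ∑ P ∈ fs {P : Submodule F (Fin (2*n+2) → F) | Module.finrank F P = 1 ∧ P ≤ ⊤},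
      (if c P ≠ 0 then (1:ℕ) else 0) := by
    rw [← Finset.sum_filter, Finset.sum_const, smul_eq_mul, mul_one]
    have : wt c = (fs {P | c P ≠ 0}).card := by rw [card_fs]; rfl
    rw [this]
    congr 1
    ext P
    simp only [Finset.mem_filter, mem_fs, Set.mem_setOf_eq]
    constructor
    · intro h
      refine ⟨⟨?_, le_top⟩, h⟩
      by_contra h1
      exact h (hc P fun h => h1 h.1)
    · exact fun h => h.2
  rw [smul_eq_mul, ← h2, ← Finset.sum_filter, Finset.sum_const, smul_eq_mul, mul_one] at h1
  rw [← h1]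
  congr 1
  ext x
  simp [mem_sp, mem_fs]

theorem cw_of_codeword (H : HS p q (hF q F (2*n+2))) {c : Submodule F (Fin (2*n+2) → F) → ZMod p}
    (hc : IsCodeword p q n c) : CW p (hF q F (2*n+2)) n (fun x => c (Submodule.span F {x})) where
  smul a x ha := by
    show c _ = c _
    rw [Submodule.span_singleton_smul_eq (IsUnit.mk0 a ha)]
  iso x hx := by
    by_contra h0
    apply hx
    apply hc.1
    intro h1
    exact h0 (h1.2 x (Submodule.mem_span_singleton_self x))
  zero := by
    apply hc.1
    intro h
    have := h.1
    rw [Submodule.span_zero_singleton, finrank_bot] at this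
    omega
  sum μ hμ := by
    rw [H.sum_pts c (fun P hP => hc.1 P fun h => hP h.1) μ, ← finsum_fs c hc.1,
      hc.2 μ ⟨hμ.1, fun x hx => hμ.2 x hx⟩, smul_zero]

theorem codeword_of_cw (H : HS p q (hF q F (2*n+2))) {f : (Fin (2*n+2) → F) → ZMod p}
    (hf : CW p (hF q F (2*n+2)) n f) :
    ∃ c : Submodule F (Fin (2*n+2) → F) → ZMod p, IsCodeword p q n c ∧ (fun x => c (Submodule.span F {x})) = f := by
  let c : Submodule F (Fin (2*n+2) → F) → ZMod p := fun P =>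
    if h : ∃ x : Fin (2*n+2) → F, x ≠ 0 ∧ P = Submodule.span F {x} then f h.choose else 0
  have hcx : ∀ x : Fin (2*n+2) → F, x ≠ 0 → c (Submodule.span F {x}) = f x := by
    intro x hx
    have h : ∃ y : Fin (2*n+2) → F, y ≠ 0 ∧ Submodule.span F {x} = Submodule.span F {y} := ⟨x, hx, rfl⟩
    have h1 : c (Submodule.span F {x}) = f h.choose := dif_pos h
    rw [h1]
    obtain ⟨h2, h3⟩ := h.choose_spec
    have : h.choose ∈ Submodule.span F {x} := by
      have := Submodule.mem_span_singleton_self (R := F) h.choose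
      rwa [← h3] at this
    obtain ⟨a, ha⟩ := Submodule.mem_span_singleton.1 this
    rw [← ha]
    apply hf.smul
    rintro rfl
    exact h2 (by rw [← ha, zero_smul])
  have hc0 : ∀ P, ¬ IsHermPoint q P → c P = 0 := by
    intro P hP
    by_cases h : ∃ x : Fin (2*n+2) → F, x ≠ 0 ∧ P = Submodule.span F {x}
    · obtain ⟨x, hx, rfl⟩ := h
      rw [hcx x hx]
      by_contra h0
      exact hP ((span_herm H hx).2 (hf.iso x h0))
    · exact dif_neg h
  have hcf : (fun x => c (Submodule.span F {x})) = f := by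
    funext x
    by_cases hx : x = 0
    · subst hx
      rw [hf.zero]
      apply hc0
      intro h
      have := h.1
      rw [Submodule.span_zero_singleton, finrank_bot] at this
      omega
    · exact hcx x hx
  refine ⟨c, ⟨hc0, ?_⟩, hcf⟩
  intro μ hμ
  rw [finsum_fs c hc0]
  have h1 := H.sum_pts c (fun P hP => hc0 P fun h => hP h.1) μ
  have h2 := hf.sum μ ⟨hμ.1, fun x hx => hμ.2 x hx⟩
  rw [← hcf] at h2
  rw [h2, nsmul_eq_mul, H.cast_card] at h1
  simpa using h1.symm

theorem final (p m : ℕ) (hp : p.Prime) :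
    ∃ Q : ℝ,
      ∀ (hh q : ℕ), q = p ^ hh → Q ≤ (q:ℝ) →
      ∀ (F : Type) [Field F] [Fintype F], Fintype.card F = q ^ 2 →
      IsLeast {w : ℕ | ∃ c : Submodule F (Fin (2*(m+2)+2) → F) → ZMod p,
          IsCodeword p q (m+2) c ∧ c ≠ 0 ∧ wt c = w}
        (2 * q^(2*m) * (q^3 + 1)) := by
  obtain ⟨ε, hε, Q, hT⟩ := TT_all (m+2) (by omega)
  refine ⟨max Q 2, ?_⟩
  intro hh q hq hQ F _ _ hc
  have hQ1 : Q ≤ q := le_trans (le_max_left _ _) hQ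
  have hQ2 : (2:ℝ) ≤ q := le_trans (le_max_right _ _) hQ
  have q2 : 2 ≤ q := by exact_mod_cast hQ2
  have H : HS p q (hF q F (2*(m+2)+2)) := hF_HS hp hq q2 hc
  have hV : Module.finrank F (Fin (2*(m+2)+2) → F) = 2*(m+2)+2 := by simp
  have hq1 : 1 ≤ q^2 := Nat.one_le_pow _ _ (by omega)
  have hqp : 0 < q^2 - 1 := by
    have : 2^2 ≤ q^2 := Nat.pow_le_pow_left q2 2
    omega
  constructor
  · obtain ⟨f, hf, hs⟩ := H.exists_std hV
    obtain ⟨c, hcw, hcf⟩ := codeword_of_cw H hf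
    have hw := wt_eq H c hcw.1
    rw [hcf] at hw
    have hwt : wt c = 2 * q^(2*m) * (q^3+1) := by
      apply Nat.eq_of_mul_eq_mul_left hqp
      rw [← hw]
      zify [hq1]
      exact_mod_cast hs
    refine ⟨c, hcw, ?_, hwt⟩
    rintro rfl
    have h0 : wt (0 : Submodule F (Fin (2*(m+2)+2) → F) → ZMod p) = 0 := by
      simp [wt]
    rw [h0] at hwt
    have : 0 < 2 * q^(2*m) * (q^3+1) := by positivity
    omega
  · rintro w ⟨c, hcw, hc0, rfl⟩
    by_contra hlt
    push Not at hlt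
    have hw := wt_eq H c hcw.1
    have hf := cw_of_codeword H hcw
    set f := fun x => c (Submodule.span F {x}) with hfdef
    have hf0 : f ≠ 0 := by
      intro h0
      apply hc0
      funext P
      by_contra hP
      have : IsHermPoint q P := by by_contra h1; exact hP (hcw.1 P h1)
      obtain ⟨x, hx0, hx⟩ := finrank_eq_one_iff'.1 this.1
      have hPx : P = Submodule.span F {(x:Fin (2*(m+2)+2) → F)} := by
        apply le_antisymm
        · intro y hy
          obtain ⟨a, ha⟩ := hx ⟨y, hy⟩
          rw [Submodule.mem_span_singleton]
          exact ⟨a, congrArg Subtype.val ha⟩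
        · rw [Submodule.span_singleton_le_iff_mem]; exact x.2
      apply hP
      have h2 := congrFun h0 (x:Fin (2*(m+2)+2) → F)
      rw [hfdef] at h2
      simp only at h2
      rw [← hPx] at h2
      exact h2
    have hlt' : ((sp f).card : ℤ) < ((q:ℤ)^2-1) * (2 * q^(2*m) * (q^3+1)) := by
      have : (sp f).card < (q^2-1) * (2 * q^(2*m) * (q^3+1)) := by
        rw [hw]
        exact Nat.mul_lt_mul_of_pos_left hlt hqp
      zify [hq1] at this
      exact this
    have hlt'' : ((sp f).card : ℝ) ≤ ((q:ℝ)^2-1) * (2 * q^(2*m) * (q^3+1)) := by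
      exact_mod_cast hlt'.le
    obtain ⟨W, α, hW, hfW⟩ := hT p q F _ (hF q F (2*(m+2)+2)) H hV hQ1 f hf hf0 (by
      refine hlt''.trans ?_
      have e : (q:ℝ)^(2*(m+2)+1) = q^(2*m) * q^5 := by ring
      rw [e]
      have hqm : (0:ℝ) < (q:ℝ)^(2*m) := by positivity
      have h5 : (0:ℝ) < ε * ((q:ℝ)^(2*m) * q^5) := by positivity
      have h6 : ((q:ℝ)^2-1)*(q^3+1) ≤ q^5 := by nlinarith [mul_nonneg (sq_nonneg (q:ℝ)) (by linarith : (0:ℝ) ≤ q - 1)]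
      nlinarith)
    have := H.std_ge (m := m) hV (α := α) hW (by rw [← hfW]; exact hf0)
    rw [← hfW] at this
    linarith

end final

/-- For fixed `p` and `n ≥ 2` there is a constant `Q` such that for all
`q = p^h ≥ Q`, the minimum distance of `C_n(H(2n+1,q²))^⊥` equals
`2·q^(2n-4)·(q³+1)`. -/
theorem stmt19 (p n : ℕ) (hp : p.Prime) (hn : 2 ≤ n) :
    ∃ Q : ℝ,
      ∀ (hh q : ℕ), q = p ^ hh → Q ≤ (q:ℝ) →
      ∀ (F : Type) [Field F] [Fintype F], Fintype.card F = q ^ 2 →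
      IsLeast {w : ℕ | ∃ c : Submodule F (Fin (2*n+2) → F) → ZMod p,
          IsCodeword p q n c ∧ c ≠ 0 ∧ wt c = w}
        (2 * q^(2*n-4) * (q^3 + 1)) := by
  obtain ⟨m, rfl⟩ : ∃ m, n = m + 2 := ⟨n - 2, by omega⟩
  have h := final p m hp
  have e : 2 * (m + 2) - 4 = 2 * m := by omega
  rw [e]
  exact h

end HermCode
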